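/- arXiv:2511.11783 — 2 statements merged into one kernel-verified Lean document; each statement's English description precedes it below -/
import Mathlib

section
/- Let f ∈ ℤ[x] be a square-free polynomial of degree d = 2(2k + 1) with k ≥ 0, such that f(t) > 0 for all t ∈ ℝ, and assume the constant coefficient f(0) is NOT of the form 2^{2a}·(8b + 1) with nonnegative integers a, b. Then there exists ℓ₀ ∈ ℕ such that for every ℓ ≥ ℓ₀ the polynomial f(x) − 2^{−2ℓ}·(x² + x + 1)^{2k}·x² is a sum of four squares in ℚ[x]. -/
section
open Polynomial
namespace DTO

/-- sum of four squares -/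
def S4 (f : ℚ[X]) : Prop := ∃ a b c d : ℚ[X], f = a ^ 2 + b ^ 2 + c ^ 2 + d ^ 2

theorem S4.mul {f g : ℚ[X]} (hf : S4 f) (hg : S4 g) : S4 (f * g) := by
  obtain ⟨a, b, c, d, rfl⟩ := hf
  obtain ⟨x, y, z, w, rfl⟩ := hg
  exact ⟨a*x+b*y+c*z+d*w, a*y-b*x+c*w-d*z, a*z-b*w-c*x+d*y, a*w+b*z-c*y-d*x, by ring⟩

theorem S4_C {q : ℚ} (hq : 0 ≤ q) : S4 (C q) := by
  obtain ⟨a, b, c, d, h⟩ := Nat.sum_four_squares (q.num.toNat * q.den)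
  have hq0 : (q.den : ℚ) ≠ 0 := by exact_mod_cast q.den_ne_zero
  have hn : (q.num.toNat : ℚ) = q.num := by
    have : ((q.num.toNat : ℤ)) = q.num := Int.toNat_of_nonneg (Rat.num_nonneg.mpr hq)
    exact_mod_cast this
  have h' : (a:ℚ)^2 + b^2 + c^2 + d^2 = q.num * q.den := by
    rw [← hn]; exact_mod_cast h
  have : q = (a / q.den : ℚ)^2 + (b/q.den)^2 + (c/q.den)^2 + (d/q.den)^2 := by
    field_simp
    rw [h']
    have := Rat.num_div_den q
    field_simp at this
    nlinarith
  refine ⟨C (a / q.den : ℚ), C (b / q.den : ℚ), C (c / q.den : ℚ), C (d / q.den : ℚ), ?_⟩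
  simp only [← C_pow, ← C_add]
  rw [← this]

theorem sum_sq_eq_zero {a b c d : ℚ[X]} (h : a ^ 2 + b ^ 2 + c ^ 2 + d ^ 2 = 0) :
    a = 0 ∧ b = 0 ∧ c = 0 ∧ d = 0 := by
  have key : ∀ t : ℚ, a.eval t = 0 ∧ b.eval t = 0 ∧ c.eval t = 0 ∧ d.eval t = 0 := by
    intro t
    have := congrArg (eval t) h
    simp only [eval_add, eval_pow, eval_zero] at this
    refine ⟨?_, ?_, ?_, ?_⟩ <;>
    · apply pow_eq_zero_iff (n := 2) (by norm_num) |>.mp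
      nlinarith [sq_nonneg (a.eval t), sq_nonneg (b.eval t), sq_nonneg (c.eval t), sq_nonneg (d.eval t)]
  refine ⟨?_, ?_, ?_, ?_⟩ <;> apply Polynomial.funext <;> intro t <;> simp [key t]

/-- Degree drop. -/
theorem deg_drop {a b c d h q : ℚ[X]} (hq : q ≠ 0) (ha : a.degree < q.degree) (hb : b.degree < q.degree)
    (hc : c.degree < q.degree) (hd : d.degree < q.degree)
    (e : a ^ 2 + b ^ 2 + c ^ 2 + d ^ 2 = q * h) : h.degree < q.degree := by
  have hs : ∀ a : ℚ[X], a.degree < q.degree → (a^2).degree < (q * q).degree := by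
    intro a ha
    rw [pow_two, degree_mul, degree_mul]
    rw [degree_eq_natDegree hq] at ha ⊢
    by_cases h0 : a = 0
    · simp [h0]
    rw [degree_eq_natDegree h0] at ha ⊢
    norm_cast at ha ⊢
    omega
  have h1 : (q * h).degree < (q * q).degree := by
    rw [← e]
    refine (degree_add_le _ _).trans_lt (max_lt ((degree_add_le _ _).trans_lt (max_lt ((degree_add_le _ _).trans_lt (max_lt ?_ ?_)) ?_)) ?_) <;> apply hs <;> assumption
  by_contra hcon
  push Not at hcon
  rw [degree_mul, degree_mul] at h1
  exact absurd h1 (not_lt.mpr (by gcongr))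

theorem descent (p : ℚ[X]) (hp : Irreducible p) : ∀ n : ℕ, ∀ h a b c d : ℚ[X], h ≠ 0 → h.natDegree ≤ n →
    h.degree < p.degree →
    a ^ 2 + b ^ 2 + c ^ 2 + d ^ 2 = p * h → ∃ q : ℚ, q ≠ 0 ∧ S4 (p * C q) := by
  intro n
  induction n with
  | zero =>
    intro h a b c d h0 hn _ e
    obtain ⟨q, rfl⟩ := natDegree_eq_zero.mp (Nat.le_zero.mp hn)
    exact ⟨q, by rintro rfl; simp at h0, a, b, c, d, e.symm⟩
  | succ n ih =>
    intro h a b c d h0 hn hlt e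
    by_cases hu : h.natDegree = 0
    · obtain ⟨q, rfl⟩ := natDegree_eq_zero.mp hu
      exact ⟨q, by rintro rfl; simp at h0, a, b, c, d, e.symm⟩
    have hm : ∀ a : ℚ[X], ∃ x y : ℚ[X], a = x + h * y ∧ x.degree < h.degree := fun a =>
      ⟨a % h, a / h, (EuclideanDomain.mod_add_div a h).symm, Polynomial.degree_mod_lt a h0⟩
    obtain ⟨x, x', ex, dx⟩ := hm a
    obtain ⟨y, y', ey, dy⟩ := hm b
    obtain ⟨z, z', ez, dz⟩ := hm c
    obtain ⟨w, w', ew, dw⟩ := hm d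
    have hdvd : h ∣ x ^ 2 + y ^ 2 + z ^ 2 + w ^ 2 := by
      refine ⟨p - 2*x*x' - 2*y*y' - 2*z*z' - 2*w*w' - h * (x'^2+y'^2+z'^2+w'^2), ?_⟩
      rw [ex, ey, ez, ew] at e
      linear_combination e
    obtain ⟨h', e'⟩ := hdvd
    have hd' := deg_drop h0 dx dy dz dw e'
    by_cases h0' : h' = 0
    · exfalso
      rw [h0', mul_zero] at e'
      obtain ⟨rfl, rfl, rfl, rfl⟩ := sum_sq_eq_zero e'
      have : p = h * (x'^2+y'^2+z'^2+w'^2) := by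
        apply mul_right_cancel₀ h0
        rw [← e, ex, ey, ez, ew]; ring
      rcases hp.isUnit_or_isUnit this with hh | hh
      · exact hu (natDegree_eq_zero_of_isUnit hh)
      · rw [this, degree_mul, degree_eq_zero_of_isUnit hh, add_zero] at hlt
        exact lt_irrefl _ hlt
    -- quaternion product
    have e1 : h * (a*x'+b*y'+c*z'+d*w') = a*a+b*b+c*c+d*d - (a*x+b*y+c*z+d*w) := by
      rw [ex, ey, ez, ew]; ring
    have e2 : ∃ A, a*x+b*y+c*z+d*w = h * A := ⟨p - (a*x'+b*y'+c*z'+d*w'), by linear_combination e + e1⟩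
    obtain ⟨A, hA⟩ := e2
    have hB : a*y-b*x+c*w-d*z = h * (b*x' - a*y' + d*z' - c*w') := by
      rw [ex, ey, ez, ew]; ring
    have hC : a*z-b*w-c*x+d*y = h * (b*w' - a*z' + c*x' - d*y') := by
      rw [ex, ey, ez, ew]; ring
    have hD : a*w+b*z-c*y-d*x = h * (c*y' - a*w' - b*z' + d*x') := by
      rw [ex, ey, ez, ew]; ring
    refine ih h' A (b*x' - a*y' + d*z' - c*w') (b*w' - a*z' + c*x' - d*y') (c*y' - a*w' - b*z' + d*x') h0' ?_ (hd'.trans hlt) ?_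
    · have := natDegree_lt_natDegree h0' hd'
      omega
    · apply mul_left_cancel₀ (pow_ne_zero 2 h0)
      have : h^2 * (A ^ 2 + (b*x' - a*y' + d*z' - c*w') ^ 2 + (b*w' - a*z' + c*x' - d*y') ^ 2 + (c*y' - a*w' - b*z' + d*x') ^ 2) = (h*A)^2 + (h*(b*x' - a*y' + d*z' - c*w'))^2 + (h*(b*w' - a*z' + c*x' - d*y'))^2 + (h*(c*y' - a*w' - b*z' + d*x'))^2 := by ring
      rw [this, ← hA, ← hB, ← hC, ← hD]
      linear_combination (x^2+y^2+z^2+w^2) * e + p * h * e'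

/-- irreducible factor positive, isotropic mod p -/
theorem S4_irred (p : ℚ[X]) (hp : Irreducible p) (hpos : ∀ t : ℚ, 0 < p.eval t)
    (hiso : ∃ a b c d : ℚ[X], ¬ (p ∣ a ∧ p ∣ b ∧ p ∣ c ∧ p ∣ d) ∧ p ∣ a ^ 2 + b ^ 2 + c ^ 2 + d ^ 2) :
    S4 p := by
  obtain ⟨a, b, c, d, hn, hdv⟩ := hiso
  have h0 := hp.ne_zero
  have hm : ∀ a : ℚ[X], ∃ x y : ℚ[X], a = x + p * y ∧ x.degree < p.degree := fun a =>
      ⟨a % p, a / p, (EuclideanDomain.mod_add_div a p).symm, Polynomial.degree_mod_lt a h0⟩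
  obtain ⟨x, x', ex, dx⟩ := hm a
  obtain ⟨y, y', ey, dy⟩ := hm b
  obtain ⟨z, z', ez, dz⟩ := hm c
  obtain ⟨w, w', ew, dw⟩ := hm d
  obtain ⟨k, hk⟩ := hdv
  have e : x ^ 2 + y ^ 2 + z ^ 2 + w ^ 2 = p * (k - 2*x*x' - 2*y*y' - 2*z*z' - 2*w*w' - p * (x'^2+y'^2+z'^2+w'^2)) := by
    rw [ex, ey, ez, ew] at hk
    linear_combination hk
  generalize (k - 2*x*x' - 2*y*y' - 2*z*z' - 2*w*w' - p * (x'^2+y'^2+z'^2+w'^2)) = h at e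
  have hh : h ≠ 0 := by
    rintro rfl
    rw [mul_zero] at e
    obtain ⟨rfl, rfl, rfl, rfl⟩ := sum_sq_eq_zero e
    apply hn
    simp [ex, ey, ez, ew]
  obtain ⟨q, hq, hS⟩ := descent p hp _ h x y z w hh le_rfl (deg_drop h0 dx dy dz dw e) e
  have hq' : 0 ≤ q := by
    obtain ⟨a, b, c, d, h⟩ := hS
    have := congrArg (eval 0) h
    simp only [eval_add, eval_pow, eval_mul, eval_C] at this
    have h1 : 0 ≤ eval 0 p * q := by rw [this]; positivity
    exact nonneg_of_mul_nonneg_right h1 (hpos 0)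
  have := hS.mul (S4_C (inv_nonneg.mpr hq'))
  rwa [mul_assoc, ← C_mul, mul_inv_cancel₀ hq, C_1, mul_one] at this

theorem S4_of_factors (g : ℚ[X]) (hg : g ≠ 0) (hpos : ∀ t : ℝ, 0 < aeval t g)
    (H : ∀ p : ℚ[X], Irreducible p → p ∣ g → 
      ∃ a b c d : ℚ[X], ¬ (p ∣ a ∧ p ∣ b ∧ p ∣ c ∧ p ∣ d) ∧ p ∣ a ^ 2 + b ^ 2 + c ^ 2 + d ^ 2) :
    S4 g := by
  have posQ : ∀ p : ℚ[X], p ∣ g → ∀ t : ℝ, aeval t p ≠ 0 := by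
    rintro p ⟨q, rfl⟩ t h
    have := hpos t
    rw [map_mul, h, zero_mul] at this
    exact lt_irrefl _ this
  -- sign: no real roots implies constant sign
  have sgn : ∀ p : ℚ[X], p ∣ g → 0 < p.eval 0 → ∀ t : ℝ, 0 < aeval t p := by
    intro p hp h0 t
    by_contra hcon
    push Not at hcon
    have hc : Continuous fun t : ℝ => aeval t p := p.continuous_aeval
    have h0' : 0 < aeval (0:ℝ) p := by
      have : aeval (0:ℝ) p = ((p.eval 0 : ℚ) : ℝ) := by
        have := aeval_algebraMap_apply ℝ (0:ℚ) p
        simpa using this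
      rw [this]; exact_mod_cast h0
    have : (0:ℝ) ∈ Set.range fun t : ℝ => aeval t p :=
      mem_range_of_exists_le_of_exists_ge hc ⟨t, hcon⟩ ⟨0, h0'.le⟩
    obtain ⟨s, hs⟩ := this
    exact posQ p hp s hs
  have evQ : ∀ (p : ℚ[X]) (t : ℚ), aeval (t:ℝ) p = ((p.eval t : ℚ) : ℝ) := by
    intro p t
    have := aeval_algebraMap_apply ℝ t p
    simpa using this
  have main : ∀ h : ℚ[X], h ∣ g → S4 h ∨ S4 (-h) := by
    intro h
    induction h using WfDvdMonoid.induction_on_irreducible with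
    | zero => intro _; exact Or.inl ⟨0, 0, 0, 0, by simp⟩
    | unit u hu =>
      intro _
      obtain ⟨r, hr, rfl⟩ := Polynomial.isUnit_iff.mp hu
      rcases le_total 0 r with h | h
      · exact Or.inl (S4_C h)
      · right; rw [← C_neg]; exact S4_C (by linarith)
    | mul a p ha hp ih =>
      intro hd
      have hpd : p ∣ g := (dvd_mul_right _ _).trans hd
      have had : a ∣ g := (dvd_mul_left _ _).trans hd
      have hp0 : p.eval 0 ≠ 0 := by
        intro h
        apply posQ p hpd ((0:ℚ):ℝ)
        rw [evQ, h]; simp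
      have hpS : S4 p ∨ S4 (-p) := by
        rcases lt_or_gt_of_ne hp0 with hneg | hp1
        · right
          apply S4_irred (-p) ((Associated.neg_left (Associated.refl p)).symm.irreducible hp)
          · intro t
            have := sgn (-p) (neg_dvd.mpr hpd) (by simpa using hneg) t
            rw [evQ] at this; exact_mod_cast this
          · obtain ⟨x, y, z, w, h1, h2⟩ := H p hp hpd
            exact ⟨x, y, z, w, by simpa using h1, by simpa using h2⟩
        · left
          apply S4_irred p hp
          · intro t
            have := sgn p hpd hp1 t
            rw [evQ] at this; exact_mod_cast this
          · exact H p hp hpd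
      rcases hpS with h1 | h1 <;> rcases ih had with h2 | h2
      · exact Or.inl (h1.mul h2)
      · right; simpa using h1.mul h2
      · right; simpa using h1.mul h2
      · left; simpa using h1.mul h2
  rcases main g dvd_rfl with h | h
  · exact h
  · exfalso
    obtain ⟨a, b, c, d, h⟩ := h
    have h1 := hpos ((0:ℚ):ℝ)
    rw [evQ] at h1
    have h1 : 0 < g.eval 0 := by exact_mod_cast h1
    have h2 := congrArg (eval 0) h
    simp only [eval_add, eval_pow, eval_neg] at h2
    nlinarith [sq_nonneg (a.eval 0), sq_nonneg (b.eval 0), sq_nonneg (c.eval 0), sq_nonneg (d.eval 0)]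

end DTO
end

section
open Polynomial
namespace DTO

theorem bound_ratio (f h : ℝ[X]) (hd : h.degree ≤ f.degree) (hpos : ∀ t : ℝ, 0 < f.eval t) :
    ∃ M : ℝ, 0 < M ∧ ∀ t, h.eval t ≤ M * f.eval t := by
  have h1 := Polynomial.isBigO_of_degree_le h f hd
  have h2 := Polynomial.isBigO_of_degree_le (h.comp (-X)) (f.comp (-X)) (by
    have : ∀ p : ℝ[X], (p.comp (-X)).degree = p.degree := by
      intro p
      by_cases hp : p = 0
      · simp [hp]
      · have h0 : p.comp (-X) ≠ 0 := by
          intro h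
          apply hp
          have := congrArg (fun q => q.comp (-X)) h
          simpa [comp_assoc] using this
        rw [degree_eq_natDegree hp, degree_eq_natDegree h0, natDegree_comp]
        simp
    rw [this, this]; exact hd)
  obtain ⟨c1, h1⟩ := h1.bound
  obtain ⟨c2, h2⟩ := h2.bound
  obtain ⟨a, ha⟩ := Filter.eventually_atTop.mp h1
  obtain ⟨b, hb⟩ := Filter.eventually_atTop.mp h2
  have hcont : ContinuousOn (fun t => h.eval t / f.eval t) (Set.Icc (-b) a) :=
    (h.continuous.div f.continuous (fun t => (hpos t).ne')).continuousOn
  obtain ⟨c3, h3⟩ := isCompact_Icc.exists_bound_of_continuousOn hcont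
  refine ⟨max (max c1 c2) (max c3 1), by positivity, fun t => ?_⟩
  have hf := hpos t
  have key : ∀ c, c ≤ max (max c1 c2) (max c3 1) → |h.eval t| ≤ c * f.eval t → h.eval t ≤ max (max c1 c2) (max c3 1) * f.eval t := by
    intro c hc hh
    exact (le_abs_self _).trans (hh.trans (by gcongr))
  by_cases hta : a ≤ t
  · have := ha t hta
    rw [Real.norm_eq_abs, Real.norm_eq_abs, abs_of_pos hf] at this
    exact key c1 (by simp) this
  by_cases htb : b ≤ -t
  · have := hb (-t) htb
    simp only [eval_comp, eval_neg, eval_X, neg_neg] at this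
    rw [Real.norm_eq_abs, Real.norm_eq_abs, abs_of_pos hf] at this
    exact key c2 (by simp) this
  · have := h3 t ⟨by linarith, by linarith⟩
    rw [Real.norm_eq_abs, abs_div, abs_of_pos hf, div_le_iff₀ hf] at this
    exact key c3 (by simp) this

/-- the polynomial `g` -/
noncomputable def gpoly (f : ℤ[X]) (k ℓ : ℕ) : ℚ[X] :=
  f.map (Int.castRingHom ℚ) - C ((1 : ℚ) / 2 ^ (2 * ℓ)) * ((X ^ 2 + X + 1) ^ (2 * k) * X ^ 2)

theorem gpoly_pos (f : ℤ[X]) (k : ℕ) (hdeg : f.natDegree = 2 * (2 * k + 1))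
    (hpos : ∀ t : ℝ, 0 < aeval t f) :
    ∃ ℓ₀ : ℕ, ∀ ℓ : ℕ, ℓ₀ ≤ ℓ → ∀ t : ℝ, 0 < aeval t (gpoly f k ℓ) := by
  have hf0 : f ≠ 0 := by rintro rfl; simpa using hpos 0
  obtain ⟨M, hM, hb⟩ := bound_ratio (f.map (Int.castRingHom ℝ)) ((X ^ 2 + X + 1) ^ (2 * k) * X ^ 2) (by
    rw [degree_map_eq_of_injective (RingHom.injective_int _), degree_eq_natDegree hf0, hdeg]
    apply degree_le_of_natDegree_le
    refine natDegree_mul_le.trans ?_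
    have h1 : (X ^ 2 + X + 1 : ℝ[X]).natDegree ≤ 2 := by compute_degree
    have h2 := natDegree_pow_le_of_le (2 * k) h1
    rw [natDegree_X_pow]
    omega) (by
    intro t
    have := hpos t
    rwa [aeval_def, ← eval_map] at this)
  obtain ⟨n, hn⟩ := pow_unbounded_of_one_lt M (show (1:ℝ) < 4 by norm_num)
  refine ⟨n, fun ℓ hℓ t => ?_⟩
  have e : aeval t (gpoly f k ℓ) = aeval t f - 1 / 4 ^ ℓ * ((t ^ 2 + t + 1) ^ (2 * k) * t ^ 2) := by
    simp only [gpoly, map_sub, map_mul, map_pow, map_add, aeval_X, map_one, aeval_C]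
    congr 1
    · simp [aeval_def, eval₂_map]
      congr 1
    · rw [pow_mul]; norm_num
  have h1 := hb t
  have h2 := hpos t
  have e2 : (f.map (Int.castRingHom ℝ)).eval t = aeval t f := by rw [aeval_def, ← eval_map]; rfl
  rw [e2] at h1
  simp only [eval_mul, eval_pow, eval_add, eval_X, eval_one] at h1
  have h3 : M < 4 ^ ℓ := hn.trans_le (by gcongr; norm_num)
  rw [e]
  have h4 : 1 / 4 ^ ℓ * ((t ^ 2 + t + 1) ^ (2 * k) * t ^ 2) ≤ 1 / 4 ^ ℓ * (M * aeval t f) := by gcongr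
  have h5 : 1 / 4 ^ ℓ * (M * aeval t f) < aeval t f := by
    rw [div_mul_eq_mul_div, one_mul, div_lt_iff₀ (by positivity)]
    nlinarith
  linarith

end DTO
end

section
namespace DTO

theorem index_two_add (G : Type*) [AddCommGroup G] [AddGroup.FG G] :
    (nsmulAddMonoidHom (α := G) 2).range.index =
      2 ^ Module.finrank ℤ G * Nat.card (nsmulAddMonoidHom (α := G) 2).ker := by
  obtain ⟨n, ι, _, p, hp, e, ⟨φ⟩⟩ := AddCommGroup.equiv_free_prod_directSum_zmod G
  have : ∀ i, NeZero (p i ^ e i) := fun i => ⟨pow_ne_zero _ (hp i).ne_zero⟩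
  let F := ((i : ι) → ZMod (p i ^ e i))
  let ψ : G ≃+ (Fin n → ℤ) × F := φ.trans (Finsupp.addEquivFunOnFinite.prodCongr (DirectSum.addEquivProd _))
  have hrank : Module.finrank ℤ G = n := by
    rw [ψ.toIntLinearEquiv.finrank_eq]
    have : Module.finrank ℤ F = 0 := by
      apply Module.finrank_eq_zero_iff_isTorsion.mpr
      intro x
      have := isOfFinAddOrder_of_finite x
      refine ⟨⟨(addOrderOf x : ℤ), ?_⟩, ?_⟩
      · simp [addOrderOf_pos x |>.ne']
      · show (addOrderOf x : ℤ) • x = 0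
        rw [natCast_zsmul, addOrderOf_nsmul_eq_zero]
    have h1 : LinearMap.range (LinearMap.fst ℤ (Fin n → ℤ) F) = ⊤ :=
      LinearMap.range_eq_top.mpr Prod.fst_surjective
    have h2 := Submodule.finrank_quotient_add_finrank (LinearMap.ker (LinearMap.fst ℤ (Fin n → ℤ) F))
    rw [(LinearMap.quotKerEquivRange _).finrank_eq, h1, finrank_top, Module.finrank_fin_fun] at h2
    have h3 : Module.finrank ℤ (LinearMap.ker (LinearMap.fst ℤ (Fin n → ℤ) F)) = 0 := by
      rw [LinearMap.ker_fst]
      have := (LinearEquiv.ofInjective (LinearMap.inr ℤ (Fin n → ℤ) F) LinearMap.inr_injective).finrank_eq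
      rw [← this]; assumption
    omega
  have hidx : (nsmulAddMonoidHom (α := G) 2).range.index = (nsmulAddMonoidHom (α := (Fin n → ℤ) × F) 2).range.index := by
    rw [← AddSubgroup.index_map_equiv _ ψ]
    congr 1
    ext x
    simp only [AddSubgroup.mem_map, AddMonoidHom.mem_range, nsmulAddMonoidHom_apply]
    constructor
    · rintro ⟨y, ⟨z, rfl⟩, rfl⟩
      exact ⟨ψ z, by simp⟩
    · rintro ⟨z, rfl⟩
      exact ⟨2 • ψ.symm z, ⟨ψ.symm z, rfl⟩, by simp⟩
  have hr : (nsmulAddMonoidHom (α := (Fin n → ℤ) × F) 2).range =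
      ((AddSubgroup.pi Set.univ (fun _ : Fin n => AddSubgroup.zmultiples (2:ℤ)))).prod (nsmulAddMonoidHom (α := F) 2).range := by
    ext ⟨x, y⟩
    simp only [AddMonoidHom.mem_range, AddSubgroup.mem_prod, AddSubgroup.mem_pi, nsmulAddMonoidHom_apply, Set.mem_univ, AddSubgroup.mem_zmultiples_iff, Prod.ext_iff, Prod.exists]
    constructor
    · rintro ⟨a, b, h1, h2⟩
      refine ⟨fun i _ => ⟨a i, ?_⟩, b, h2⟩
      have := congrFun h1 i
      simp at this ⊢; linarith
    · rintro ⟨h1, b, h2⟩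
      choose a ha using h1
      refine ⟨fun i => a i trivial, b, ?_, h2⟩
      funext i
      have := ha i trivial
      simp at this ⊢; linarith
  have hker : Nat.card (nsmulAddMonoidHom (α := G) 2).ker = Nat.card (nsmulAddMonoidHom (α := F) 2).ker := by
    refine Nat.card_congr ⟨fun x => ⟨(ψ x.1).2, ?_⟩, fun y => ⟨ψ.symm (0, y.1), ?_⟩, ?_, ?_⟩
    · have h := x.2
      rw [AddMonoidHom.mem_ker, nsmulAddMonoidHom_apply] at h ⊢
      rw [← Prod.smul_snd, ← map_nsmul, h]; simp
    · have h := y.2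
      rw [AddMonoidHom.mem_ker, nsmulAddMonoidHom_apply] at h ⊢
      rw [← map_nsmul, Prod.smul_mk, h]; simp
    · intro x
      have h := x.2
      rw [AddMonoidHom.mem_ker, nsmulAddMonoidHom_apply] at h
      have h1 : 2 • (ψ x.1).1 = 0 := by rw [← Prod.smul_fst, ← map_nsmul, h]; simp
      have h2 : (ψ x.1).1 = 0 := by
        funext i
        have := congrFun h1 i
        simpa using this
      apply Subtype.ext
      apply ψ.injective
      simp [Prod.ext_iff, h2]
    · intro y
      simp
  rw [hidx, hr, AddSubgroup.index_prod, AddSubgroup.index_pi, hrank, hker]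
  simp only [Int.index_zmultiples]
  congr 1
  · simp
  · exact AddSubgroup.index_range

theorem index_sq (A : Type*) [CommGroup A] [Group.FG A] :
    (powMonoidHom (α := A) 2).range.index =
      2 ^ Module.finrank ℤ (Additive A) * Nat.card (powMonoidHom (α := A) 2).ker := 
  index_two_add (Additive A)
end DTO
end

section
namespace DTO
open IsDedekindDomain HeightOneSpectrum NumberField WithZero

/-- finite places -/
abbrev Pl (K : Type*) [Field K] := HeightOneSpectrum (𝓞 K)

section
variable {K : Type*} [Field K] [NumberField K]

theorem vl_of_span (v : Pl K) (n : ℕ) (I : Ideal (𝓞 K)) (c : 𝓞 K) (hI : ¬ I ≤ v.asIdeal)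
    (h : Ideal.span {c} = v.asIdeal ^ n * I) : v.valuation K (c : K) = exp (-(n:ℤ)) := by
  rw [show (c : K) = algebraMap (𝓞 K) K c from rfl, valuation_of_algebraMap]
  apply le_antisymm
  · rw [intValuation_le_pow_iff_dvd, h]; exact dvd_mul_right _ _
  · by_contra hcon
    have hlt := not_le.mp hcon
    have : v.intValuation c ≤ exp (-((n+1 : ℕ):ℤ)) := by
      by_cases h0 : v.intValuation c = 0
      · rw [h0]; exact zero_le
      rw [← log_le_iff_le_exp h0]
      rw [← log_lt_iff_lt_exp h0] at hlt
      push_cast; omega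
    rw [intValuation_le_pow_iff_dvd, h, pow_succ] at this
    apply hI
    rw [← Ideal.dvd_iff_le]
    exact (mul_dvd_mul_iff_left (pow_ne_zero n v.ne_bot)).mp this

theorem vl_of_span' (v v' : Pl K) (hv : v' ≠ v) (n : ℕ) (I : Ideal (𝓞 K)) (c : 𝓞 K) (hI : ¬ I ≤ v'.asIdeal)
    (h : Ideal.span {c} = v.asIdeal ^ n * I) : v'.valuation K (c : K) = 1 := by
  rw [show (c : K) = algebraMap (𝓞 K) K c from rfl, valuation_eq_one_iff_notMem]
  intro hc
  have : v.asIdeal ^ n * I ≤ v'.asIdeal := by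
    rw [← h]; exact (Ideal.span_singleton_le_iff_mem _).mpr hc
  rcases (v'.isPrime.mul_le).mp this with h1 | h1
  · have := v'.isPrime.le_of_pow_le h1
    exact hv (HeightOneSpectrum.ext (v.isMaximal.eq_of_le v'.isPrime.ne_top this).symm)
  · exact hI h1

theorem vl_int (v : Pl K) (c : 𝓞 K) : v.valuation K (c : K) ≤ 1 := valuation_le_one v c

/-- class-trivial set -/
def CT (S : Set (Pl K)) : Prop := ∀ v, v ∉ S → ∃ c : Kˣ, v.valuation K (c : K) = exp (-1 : ℤ) ∧
  ∀ v', v' ∉ S → v' ≠ v → v'.valuation K (c : K) = 1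

theorem CT.mono {S T : Set (Pl K)} (h : CT S) (hST : S ⊆ T) : CT T := by
  intro v hv
  obtain ⟨c, h1, h2⟩ := h v (fun h => hv (hST h))
  exact ⟨c, h1, fun v' hv' => h2 v' (fun h => hv' (hST h))⟩

open Classical in
theorem CT.exists_fun {S : Set (Pl K)} (h : CT S) (F : Finset (Pl K)) (n : Pl K → ℤ) :
    ∃ c : Kˣ, ∀ v ∉ S, v.valuation K (c : K) = if v ∈ F then exp (n v) else 1 := by
  induction F using Finset.induction_on with
  | empty => exact ⟨1, fun v _ => by simp⟩
  | insert w F hw ih =>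
    obtain ⟨c, hc⟩ := ih
    by_cases hwS : w ∈ S
    · refine ⟨c, fun v hv => ?_⟩
      have : v ≠ w := by rintro rfl; exact hv hwS
      rw [hc v hv]; simp [this]
    · obtain ⟨d, hd1, hd2⟩ := h w hwS
      refine ⟨c * d ^ (-(n w)), fun v hv => ?_⟩
      rw [Units.val_mul, Units.val_zpow_eq_zpow_val, map_mul, map_zpow₀, hc v hv]
      by_cases hvw : v = w
      · subst hvw
        rw [hd1, ← exp_zsmul]
        simp [hw]
      · rw [hd2 v hv hvw]; simp [hvw]

theorem exists_CT (S0 : Finset (Pl K)) : ∃ S : Finset (Pl K), S0 ⊆ S ∧ CT (S : Set (Pl K)) := by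
  classical
  have hsurj := ClassGroup.mk0_surjective (R := 𝓞 K)
  choose I hI using hsurj
  have hfin : ∀ C : ClassGroup (𝓞 K), {v : Pl K | (I C : Ideal (𝓞 K)) ≤ v.asIdeal}.Finite := by
    intro C
    have := Ideal.finite_factors (I := (I C : Ideal (𝓞 K))) (nonZeroDivisors.coe_ne_zero _)
    simpa only [Ideal.dvd_iff_le] using this
  refine ⟨S0 ∪ Finset.univ.biUnion (fun C => (hfin C).toFinset), Finset.subset_union_left, ?_⟩
  intro v hv
  have hv' : ∀ v : Pl K, v ∉ ((S0 ∪ Finset.univ.biUnion (fun C => (hfin C).toFinset) : Finset (Pl K)) : Set (Pl K)) → ∀ C, ¬ (I C : Ideal (𝓞 K)) ≤ v.asIdeal := by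
    intro v hv C hC
    apply hv
    simp only [Finset.coe_union, Set.mem_union, Finset.mem_coe, Finset.mem_biUnion]
    right
    exact ⟨C, Finset.mem_univ _, by simpa using hC⟩
  have hv0 : v.asIdeal ∈ nonZeroDivisors (Ideal (𝓞 K)) := mem_nonZeroDivisors_of_ne_zero v.ne_bot
  let C := (ClassGroup.mk0 ⟨v.asIdeal, hv0⟩)⁻¹
  have h1 : ClassGroup.mk0 (⟨v.asIdeal, hv0⟩ * I C) = 1 := by
    rw [map_mul, hI]; simp [C]
  have h2 : (v.asIdeal * (I C : Ideal (𝓞 K))).IsPrincipal := by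
    have := (ClassGroup.mk0_eq_one_iff (R := 𝓞 K) (I := v.asIdeal * (I C : Ideal (𝓞 K))) (mul_mem hv0 (I C).2)).mp (by
      rw [← h1]; rfl)
    exact this
  obtain ⟨c, hc⟩ := h2
  have hc' : Ideal.span {c} = v.asIdeal ^ 1 * (I C : Ideal (𝓞 K)) := by rw [pow_one, hc]
  have hv1 := vl_of_span v 1 _ c (hv' v hv C) hc'
  have hc0 : (c : K) ≠ 0 := by
    intro h; rw [h, map_zero] at hv1; exact exp_ne_zero hv1.symm
  refine ⟨Units.mk0 (c : K) hc0, ?_, ?_⟩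
  · rw [Units.val_mk0, hv1]; simp
  · intro v' h1 h2
    exact vl_of_span' v v' h2 1 _ c (hv' v' h1 C) hc'

end

section SUnit
variable (F : Type*) [Field F] [NumberField F] (S : Finset (Pl F))

/-- S-units -/
noncomputable abbrev US : Subgroup Fˣ := Set.unit (S : Set (Pl F)) F

/-- valuation vector -/
noncomputable def logMap : Additive (US F S) →+ (S → ℤ) where
  toFun x := fun v => log (v.1.valuation F (((Additive.toMul x : US F S) : Fˣ) : F))
  map_zero' := by funext v; simp
  map_add' x y := by
    funext v
    simp only [toMul_add, Subgroup.coe_mul, Units.val_mul, map_mul, Pi.add_apply]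
    rw [log_mul]
    · simp
    · simp

theorem logMap_ker : Nonempty ((logMap F S).toIntLinearMap.ker ≃ₗ[ℤ] Additive (𝓞 F)ˣ) := by
  have hval : ∀ u : (𝓞 F)ˣ, ∀ v : Pl F, v.valuation F ((u : 𝓞 F) : F) = 1 := by
    intro u v
    apply (valuation_eq_one_iff_notMem (K := F) (v := v) (r := (u : 𝓞 F))).mpr
    intro h
    exact v.isPrime.ne_top (Ideal.eq_top_of_isUnit_mem _ h u.isUnit)
  let g : (𝓞 F)ˣ →* US F S := (Units.map (algebraMap (𝓞 F) F : 𝓞 F →* F)).codRestrict _ (fun u v _ => hval u v)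
  have ginj : Function.Injective g := by
    intro a b h
    have := congrArg (fun x : US F S => ((x : Fˣ) : F)) h
    exact Units.ext (RingOfIntegers.ext this)
  let G : Additive (𝓞 F)ˣ →ₗ[ℤ] Additive (US F S) := (MonoidHom.toAdditive g).toIntLinearMap
  have Ginj : Function.Injective G := ginj
  have hr : LinearMap.range G = (logMap F S).toIntLinearMap.ker := by
    ext x
    rw [LinearMap.mem_range, LinearMap.mem_ker]
    constructor
    · rintro ⟨u, rfl⟩
      funext v
      show log (v.1.valuation F ((((Additive.toMul u) : (𝓞 F)ˣ) : 𝓞 F) : F)) = 0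
      rw [hval]; simp
    · intro hx
      have h1 : ∀ v : Pl F, v.valuation F (((Additive.toMul x : US F S) : Fˣ) : F) = 1 := by
        intro v
        by_cases hv : v ∈ S
        · have := congrFun hx ⟨v, hv⟩
          change log (v.valuation F (((Additive.toMul x : US F S) : Fˣ) : F)) = 0 at this
          rw [← exp_log (x := v.valuation F (((Additive.toMul x : US F S) : Fˣ) : F)) (by simp), this]; simp
        · exact (Additive.toMul x : US F S).2 v hv
      obtain ⟨a, ha⟩ := mem_integers_of_valuation_le_one F _ (fun v => (h1 v).le)
      obtain ⟨b, hb⟩ := mem_integers_of_valuation_le_one F ((((Additive.toMul x : US F S) : Fˣ)⁻¹ : Fˣ) : F) (fun v => by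
        rw [Units.val_inv_eq_inv_val, map_inv₀, h1 v]; simp)
      have hab : a * b = 1 := by
        apply FaithfulSMul.algebraMap_injective (𝓞 F) F
        rw [map_mul, ha, hb]; simp
      refine ⟨Additive.ofMul (Units.mk a b hab (by rw [mul_comm]; exact hab)), ?_⟩
      apply Additive.toMul.injective
      apply Subtype.ext
      apply Units.ext
      exact ha
  exact ⟨((LinearEquiv.ofInjective G Ginj).trans (LinearEquiv.ofEq _ _ hr)).symm⟩

theorem logMap_range : Module.finrank ℤ (logMap F S).toIntLinearMap.range = S.card := by
  classical
  apply le_antisymm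
  · refine (Submodule.finrank_le _).trans ?_
    simp
  · have hx : ∀ v : S, ∃ x : Additive (US F S), logMap F S x = Pi.single v (-(Fintype.card (ClassGroup (𝓞 F)) : ℤ)) := by
      rintro ⟨v, hvS⟩
      have hv0 : v.asIdeal ^ (Fintype.card (ClassGroup (𝓞 F))) ∈ nonZeroDivisors (Ideal (𝓞 F)) :=
        pow_mem (mem_nonZeroDivisors_of_ne_zero v.ne_bot) _
      have h2 : (v.asIdeal ^ (Fintype.card (ClassGroup (𝓞 F)))).IsPrincipal := by
        rw [← ClassGroup.mk0_eq_one_iff hv0]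
        have : (⟨v.asIdeal ^ (Fintype.card (ClassGroup (𝓞 F))), hv0⟩ : nonZeroDivisors (Ideal (𝓞 F))) = ⟨v.asIdeal, mem_nonZeroDivisors_of_ne_zero v.ne_bot⟩ ^ (Fintype.card (ClassGroup (𝓞 F))) := rfl
        rw [this, map_pow, pow_card_eq_one]
      obtain ⟨c, hc⟩ := h2
      have hc' : Ideal.span {c} = v.asIdeal ^ (Fintype.card (ClassGroup (𝓞 F))) * (⊤ : Ideal (𝓞 F)) := by
        rw [Ideal.mul_top, hc]
      have htop : ∀ v : Pl F, ¬ (⊤ : Ideal (𝓞 F)) ≤ v.asIdeal := fun v h => v.isPrime.ne_top (top_le_iff.mp h)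
      have hv1 := vl_of_span v _ _ c (htop v) hc'
      have hv2 := fun v' hv' => vl_of_span' v v' hv' _ _ c (htop v') hc'
      have hc0 : (c : F) ≠ 0 := by
        intro h; rw [h, map_zero] at hv1; exact exp_ne_zero hv1.symm
      refine ⟨Additive.ofMul ⟨Units.mk0 (c : F) hc0, ?_⟩, ?_⟩
      · intro v' hv'
        apply hv2
        rintro rfl
        exact hv' hvS
      · funext w
        show log (w.1.valuation F (c : F)) = _
        by_cases hw : w = ⟨v, hvS⟩
        · subst hw
          rw [hv1]; simp
        · rw [hv2 w.1 (fun h => hw (Subtype.ext h))]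
          simp [hw]
    choose x hx using hx
    have hli : LinearIndependent ℤ (fun v : S => (⟨logMap F S (x v), ⟨x v, rfl⟩⟩ : (logMap F S).toIntLinearMap.range)) := by
      apply LinearIndependent.of_comp (Submodule.subtype _)
      have : (⇑(Submodule.subtype (logMap F S).toIntLinearMap.range) ∘ fun v : S => (⟨logMap F S (x v), ⟨x v, rfl⟩⟩ : (logMap F S).toIntLinearMap.range)) = fun v : S => (Pi.single v (-(Fintype.card (ClassGroup (𝓞 F)) : ℤ)) : S → ℤ) := by
        funext v
        exact hx v
      rw [this]
      rw [Fintype.linearIndependent_iff]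
      intro g hg v
      have := congrFun hg v
      simp only [Finset.sum_apply, Pi.smul_apply, Pi.zero_apply] at this
      rw [Finset.sum_eq_single v] at this
      · simpa using this
      · intro w _ hw
        simp [Pi.single_apply, hw.symm]
      · simp
    have := hli.fintype_card_le_finrank
    simpa using this

instance US_finite : Module.Finite ℤ (Additive (US F S)) := by
  obtain ⟨e⟩ := logMap_ker F S
  have : Module.Finite ℤ (Additive (𝓞 F)ˣ) := inferInstance
  have h1 : Module.Finite ℤ (logMap F S).toIntLinearMap.ker := Module.Finite.equiv e.symm
  have h2 : Module.Finite ℤ (Additive (US F S) ⧸ (logMap F S).toIntLinearMap.ker) :=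
    Module.Finite.equiv (LinearMap.quotKerEquivRange _).symm
  exact Module.Finite.of_submodule_quotient (logMap F S).toIntLinearMap.ker

instance US_fg : Group.FG (US F S) := by
  have := US_finite F S
  rw [Module.Finite.iff_addGroup_fg] at this
  exact GroupFG.iff_add_fg.mpr this

theorem US_rank : Module.finrank ℤ (Additive (US F S)) = S.card + NumberField.Units.rank F := by
  obtain ⟨e⟩ := logMap_ker F S
  have h := Submodule.finrank_quotient_add_finrank (logMap F S).toIntLinearMap.ker
  rw [(LinearMap.quotKerEquivRange _).finrank_eq, logMap_range, e.finrank_eq, NumberField.Units.finrank_eq] at h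
  exact h.symm

end SUnit
end DTO
end

section
namespace DTO
open IsDedekindDomain HeightOneSpectrum NumberField WithZero

universe u

/-- quadratic extension data `M = K(√b)` -/
structure Quad (K M : Type*) [Field K] [Field M] [Algebra K M] (b : K) where
  ω : M
  sq : ω ^ 2 = algebraMap K M b
  σ : M ≃ₐ[K] M
  hσ : σ ω = -ω
  rep : ∀ x : M, ∃ α β : K, x = algebraMap K M α + algebraMap K M β * ω

open Polynomial in
theorem exists_quad {K : Type u} [Field K] [NumberField K] (b : K) (hb : ¬ IsSquare b) :
    ∃ (M : Type u) (_ : Field M) (_ : NumberField M) (_ : Algebra K M), Nonempty (Quad K M b) := by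
  have hirr : Irreducible (X ^ 2 - C b : K[X]) := by
    apply X_pow_sub_C_irreducible_of_prime Nat.prime_two
    intro a ha
    exact hb ⟨a, by rw [← ha, pow_two]⟩
  have := Fact.mk hirr
  have hmon : (X ^ 2 - C b : K[X]).Monic := monic_X_pow_sub_C b two_ne_zero
  have hfin : Module.Finite K (AdjoinRoot (X ^ 2 - C b : K[X])) := hmon.finite_adjoinRoot
  have hroot : (AdjoinRoot.root (X ^ 2 - C b : K[X])) ^ 2 = algebraMap K _ b := by
    have := AdjoinRoot.eval₂_root (X ^ 2 - C b : K[X])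
    simp only [eval₂_sub, eval₂_pow, eval₂_X, eval₂_C] at this
    exact sub_eq_zero.mp this
  let s : AdjoinRoot (X ^ 2 - C b : K[X]) →ₐ[K] AdjoinRoot (X ^ 2 - C b : K[X]) :=
    AdjoinRoot.liftAlgHom _ (Algebra.ofId K _) (-AdjoinRoot.root (X ^ 2 - C b : K[X])) (by
      simp only [eval₂_sub, eval₂_pow, eval₂_X, eval₂_C, neg_sq, hroot]
      exact sub_self _)
  have hs : s (AdjoinRoot.root _) = -AdjoinRoot.root _ := by
    simp [s]
  have hss : s.comp s = AlgHom.id K _ := by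
    apply AdjoinRoot.algHom_ext
    simp [hs]
  refine ⟨AdjoinRoot (X ^ 2 - C b : K[X]), inferInstance, NumberField.of_module_finite K _, inferInstance,
    ⟨⟨AdjoinRoot.root _, hroot, AlgEquiv.ofAlgHom s s hss hss, hs, ?_⟩⟩⟩
  intro x
  obtain ⟨p, rfl⟩ := AdjoinRoot.mk_surjective x
  have h1 : p = p %ₘ (X ^ 2 - C b) + (X ^ 2 - C b) * (p /ₘ (X ^ 2 - C b)) := (modByMonic_add_div p _).symm
  have h2 : (p %ₘ (X ^ 2 - C b)).natDegree ≤ 1 := by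
    have := natDegree_modByMonic_lt p hmon (by
      intro h
      have := congrArg natDegree h
      rw [natDegree_X_pow_sub_C] at this
      simp at this)
    rw [natDegree_X_pow_sub_C] at this
    omega
  obtain ⟨β, α, h3⟩ := exists_eq_X_add_C_of_natDegree_le_one h2
  refine ⟨α, β, ?_⟩
  rw [h1, map_add, map_mul, AdjoinRoot.mk_self, zero_mul, add_zero, h3]
  simp only [map_add, map_mul, AdjoinRoot.mk_X, AdjoinRoot.mk_C]
  rw [add_comm]; rfl

namespace Quad
variable {K M : Type*} [Field K] [Field M] [Algebra K M] {b : K} (Q : Quad K M b)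

theorem σ_alg (α : K) : Q.σ (algebraMap K M α) = algebraMap K M α := Q.σ.commutes α

theorem σ_rep (α β : K) : Q.σ (algebraMap K M α + algebraMap K M β * Q.ω) = algebraMap K M α - algebraMap K M β * Q.ω := by
  rw [map_add, map_mul, Q.σ_alg, Q.σ_alg, Q.hσ]; ring

theorem σσ (x : M) : Q.σ (Q.σ x) = x := by
  obtain ⟨α, β, rfl⟩ := Q.rep x
  rw [σ_rep, map_sub, map_mul, σ_alg, σ_alg, Q.hσ]; ring

theorem norm_rep (α β : K) : (algebraMap K M α + algebraMap K M β * Q.ω) * Q.σ (algebraMap K M α + algebraMap K M β * Q.ω) =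
    algebraMap K M (α ^ 2 - b * β ^ 2) := by
  rw [σ_rep, map_sub, map_mul, map_pow, map_pow, ← Q.sq]; ring

theorem fixed [CharZero K] {x : M} (h : Q.σ x = x) : ∃ α : K, x = algebraMap K M α := by
  obtain ⟨α, β, rfl⟩ := Q.rep x
  refine ⟨α, ?_⟩
  rw [σ_rep] at h
  have : algebraMap K M 2 * (algebraMap K M β * Q.ω) = 0 := by rw [map_ofNat]; linear_combination -h
  rcases mul_eq_zero.mp this with h | h
  · rw [map_eq_zero] at h; norm_num at h
  · rw [h, add_zero]

end Quad

section
variable {K M : Type*} [Field K] [NumberField K] [Field M] [NumberField M] [Algebra K M]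

/-- place below -/
noncomputable def dn (K : Type*) {M : Type*} [Field K] [NumberField K] [Field M] [NumberField M] [Algebra K M]
    (w : Pl M) : Pl K := w.under (𝓞 K)

theorem dn_val (w : Pl M) : ∃ e : ℕ, e ≠ 0 ∧ ∀ x : K, w.valuation M (algebraMap K M x) = (dn K w).valuation K x ^ e := by
  have : w.asIdeal.LiesOver (dn K w).asIdeal := ⟨rfl⟩
  exact ⟨_, Ideal.IsDedekindDomain.ramificationIdx'_ne_zero_of_liesOver w.asIdeal (dn K w).ne_bot,
    fun x => (valuation_liesOver M (dn K w) w x).symm⟩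

theorem dn_lt (w : Pl M) (x : K) : w.valuation M (algebraMap K M x) < 1 ↔ (dn K w).valuation K x < 1 := by
  obtain ⟨e, he, h⟩ := dn_val (K := K) w
  rw [h]; exact pow_lt_one_iff he

theorem dn_le (w : Pl M) (x : K) : w.valuation M (algebraMap K M x) ≤ 1 ↔ (dn K w).valuation K x ≤ 1 := by
  obtain ⟨e, he, h⟩ := dn_val (K := K) w
  rw [h]; exact pow_le_one_iff he

theorem dn_eq (w : Pl M) (x : K) : w.valuation M (algebraMap K M x) = 1 ↔ (dn K w).valuation K x = 1 := by
  obtain ⟨e, he, h⟩ := dn_val (K := K) w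
  rw [h, pow_eq_one_iff, or_iff_left he]

theorem dn_surj (v : Pl K) : ∃ w : Pl M, dn K w = v := by
  obtain ⟨P, hP, hPv⟩ := Ideal.exists_maximal_ideal_liesOver_of_isIntegral (S := 𝓞 M) v.asIdeal
  have hP0 : P ≠ ⊥ := Ideal.ne_bot_of_liesOver_of_ne_bot v.ne_bot P
  exact ⟨⟨P, hP.isPrime, hP0⟩, HeightOneSpectrum.ext hPv.over.symm⟩

theorem dn_fin (S : Finset (Pl K)) : {w : Pl M | dn K w ∈ S}.Finite := by
  have : {w : Pl M | dn K w ∈ S} = ⋃ v ∈ S, {w : Pl M | dn K w = v} := by ext w; simp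
  rw [this]
  apply Set.Finite.biUnion S.finite_toSet
  intro v _
  have := IsDedekindDomain.primesOver_finite v.asIdeal (𝓞 M)
  refine Set.Finite.of_finite_image (f := HeightOneSpectrum.asIdeal) (this.subset ?_) ?_
  · rintro _ ⟨w, hw, rfl⟩
    refine ⟨w.isPrime, ⟨?_⟩⟩
    rw [← show dn K w = v from hw]; rfl
  · intro a _ b _ h
    exact HeightOneSpectrum.ext h

/-- places above `S` -/
noncomputable def up (M : Type*) [Field M] [NumberField M] [Algebra K M] (S : Finset (Pl K)) : Finset (Pl M) :=
  (dn_fin (M := M) S).toFinset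

theorem mem_up {S : Finset (Pl K)} {w : Pl M} : w ∈ up M S ↔ dn K w ∈ S := by simp [up]

theorem intVal_eq_of {R R' : Type*} [CommRing R] [IsDedekindDomain R] [CommRing R'] [IsDedekindDomain R']
    (v : HeightOneSpectrum R) (v' : HeightOneSpectrum R') (r : R) (r' : R') (h0 : r = 0 ↔ r' = 0)
    (h : ∀ n : ℕ, r ∈ v.asIdeal ^ n ↔ r' ∈ v'.asIdeal ^ n) : v.intValuation r = v'.intValuation r' := by
  by_cases hr : r = 0
  · rw [hr, h0.mp hr]; simp
  have hr' : r' ≠ 0 := fun h => hr (h0.mpr h)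
  have e1 := intValuation_eq_exp_neg_multiplicity v hr
  have e2 := intValuation_eq_exp_neg_multiplicity v' hr'
  apply le_antisymm
  · rw [e2, intValuation_le_pow_iff_mem, h, ← intValuation_le_pow_iff_mem, e2]
  · rw [e1, intValuation_le_pow_iff_mem, ← h, ← intValuation_le_pow_iff_mem, e1]

theorem twist (σ : M ≃ₐ[K] M) (w : Pl M) : ∃ w' : Pl M, dn K w' = dn K w ∧ 
    ∀ x, w'.valuation M x = w.valuation M (σ x) := by
  let τ : 𝓞 M ≃+* 𝓞 M := RingOfIntegers.mapRingEquiv σ.toRingEquiv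
  let w' : Pl M := HeightOneSpectrum.comap τ.toRingHom τ.surjective w
  have hpow : ∀ n : ℕ, w'.asIdeal ^ n = (w.asIdeal ^ n).comap τ.toRingHom := by
    intro n
    have h1 : ∀ I : Ideal (𝓞 M), I.comap τ.toRingHom = I.map τ.symm.toRingHom := fun I => (Ideal.map_symm τ).symm
    show (w.asIdeal.comap τ.toRingHom) ^ n = _
    rw [h1, h1, Ideal.map_pow]
  have hint : ∀ r : 𝓞 M, w'.intValuation r = w.intValuation (τ r) := by
    intro r
    apply intVal_eq_of
    · simp
    · intro n
      rw [hpow, Ideal.mem_comap]; rfl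
  have hval : ∀ x, w'.valuation M x = w.valuation M (σ x) := by
    intro x
    obtain ⟨a, c, hc, rfl⟩ := IsFractionRing.div_surjective (A := 𝓞 M) x
    have h2 : ∀ a : 𝓞 M, σ (algebraMap (𝓞 M) M a) = algebraMap (𝓞 M) M (τ a) := fun a => rfl
    rw [map_div₀, map_div₀, map_div₀, h2, h2, valuation_of_algebraMap, valuation_of_algebraMap, valuation_of_algebraMap, valuation_of_algebraMap, hint, hint]
  refine ⟨w', ?_, hval⟩
  apply HeightOneSpectrum.ext
  ext a
  have h3 : ∀ w : Pl M, a ∈ (dn K w).asIdeal ↔ w.valuation M (algebraMap K M (a : K)) < 1 := by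
    intro w
    rw [dn_lt]
    exact (valuation_lt_one_iff_mem (K := K) (dn K w) a).symm
  rw [h3, h3, hval, AlgEquiv.commutes]

/-- split criterion -/
def Split (v : Pl K) (b : K) : Prop := ∃ c d : K, v.valuation K (2 * c) = 1 ∧ v.valuation K (c ^ 2 - b * d ^ 2) < 1

theorem Split.two {b : K} (Q : Quad K M b) {v : Pl K} (h : Split v b) :
    ∃ w₁ w₂ : Pl M, w₁ ≠ w₂ ∧ dn K w₁ = v ∧ dn K w₂ = v := by
  obtain ⟨c, d, h1, h2⟩ := h
  obtain ⟨w, hw⟩ := dn_surj (M := M) v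
  obtain ⟨w', hw', hval⟩ := twist Q.σ w
  refine ⟨w, w', ?_, hw, hw'.trans hw⟩
  intro he
  rw [← he] at hval
  set z := algebraMap K M c + algebraMap K M d * Q.ω with hz
  have e1 : z * Q.σ z = algebraMap K M (c ^ 2 - b * d ^ 2) := Q.norm_rep c d
  have e2 : z + Q.σ z = algebraMap K M (2 * c) := by
    rw [hz, Q.σ_rep, map_mul, map_ofNat]; ring
  have f1 : w.valuation M (z * Q.σ z) < 1 := by rw [e1, dn_lt, hw]; exact h2
  have f2 : w.valuation M (z + Q.σ z) = 1 := by rw [e2, dn_eq, hw]; exact h1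
  rw [map_mul, ← hval z, ← pow_two, pow_lt_one_iff two_ne_zero] at f1
  have f3 := Valuation.map_add_lt (w.valuation M) (x := z) (y := Q.σ z) (g := 1) f1 (by rw [← hval]; exact f1)
  rw [f2] at f3
  exact lt_irrefl _ f3

open Classical in
theorem card_up {b : K} (Q : Quad K M b) (S : Finset (Pl K)) :
    S.card + (S.filter (fun v => Split v b)).card ≤ (up M S).card := by
  classical
  rw [Finset.card_eq_sum_card_fiberwise (f := dn K) (s := up M S) (t := S) (fun w hw => mem_up.mp hw)]
  rw [Finset.card_filter, Finset.card_eq_sum_ones, ← Finset.sum_add_distrib]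
  apply Finset.sum_le_sum
  intro v hv
  split_ifs with hs
  · obtain ⟨w₁, w₂, hne, h1, h2⟩ := hs.two Q
    have : 1 < ((up M S).filter (fun w => dn K w = v)).card := Finset.one_lt_card.mpr
      ⟨w₁, Finset.mem_filter.mpr ⟨mem_up.mpr (h1 ▸ hv), h1⟩, w₂, Finset.mem_filter.mpr ⟨mem_up.mpr (h2 ▸ hv), h2⟩, hne⟩
    exact this
  · obtain ⟨w, hw⟩ := dn_surj (M := M) v
    have : 0 < ((up M S).filter (fun w => dn K w = v)).card :=
      Finset.card_pos.mpr ⟨w, Finset.mem_filter.mpr ⟨mem_up.mpr (hw ▸ hv), hw⟩⟩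
    exact this

end
end DTO
end

section
namespace DTO
open IsDedekindDomain HeightOneSpectrum NumberField WithZero

section grp
variable {A : Type*} [CommGroup A]

theorem FG_sub [Group.FG A] (H : Subgroup A) : Group.FG H := by
  have h0 : AddGroup.FG (Additive A) := GroupFG.iff_add_fg.mp inferInstance
  have h1 : Module.Finite ℤ (Additive A) := Module.Finite.iff_addGroup_fg.mpr h0
  have h2 : Module.Finite ℤ (AddSubgroup.toIntSubmodule (Subgroup.toAddSubgroup H)) := inferInstance
  have h3 : AddGroup.FG (AddSubgroup.toIntSubmodule (Subgroup.toAddSubgroup H)) := Module.Finite.iff_addGroup_fg.mp h2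
  exact GroupFG.iff_add_fg.mpr h3

/-- squares -/
def sqs (A : Type*) [CommGroup A] : Subgroup A := (powMonoidHom 2 : A →* A).range

theorem mem_sqs {x : A} : x ∈ sqs A ↔ ∃ y, y ^ 2 = x := Iff.rfl

theorem relIndex_sq [Group.FG A] (H : Subgroup A) :
    (H.map (powMonoidHom 2)).relIndex H = 2 ^ Module.finrank ℤ (Additive H) * Nat.card (powMonoidHom (α := H) 2).ker := by
  have := FG_sub H
  rw [← index_sq, Subgroup.relIndex]
  congr 1
  ext x
  rw [Subgroup.mem_subgroupOf, Subgroup.mem_map, MonoidHom.mem_range]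
  constructor
  · rintro ⟨y, hy, h⟩
    exact ⟨⟨y, hy⟩, Subtype.ext h⟩
  · rintro ⟨y, rfl⟩
    exact ⟨y.1, y.2, rfl⟩

theorem herbrand [Group.FG A] (σ : A →* A) (D N : A →* A)
    (hD : ∀ x, D x = x / σ x) (hN : ∀ x, N x = x * σ x) (hσ : ∀ x, σ (σ x) = x)
    (H1 : ∀ x, N x = 1 → ∃ y, D y = x)
    (c1 : Nat.card (powMonoidHom (α := D.ker) 2).ker = 2) (c2 : Nat.card (powMonoidHom (α := N.ker) 2).ker = 2) :
    N.range.relIndex D.ker * 2 ^ Module.finrank ℤ (Additive A) = 2 ^ (2 * Module.finrank ℤ (Additive D.ker)) := by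
  have kD : ∀ x, x ∈ D.ker ↔ σ x = x := by
    intro x; rw [MonoidHom.mem_ker, hD, div_eq_one]; exact eq_comm
  have kN : ∀ x, x ∈ N.ker ↔ σ x = x⁻¹ := by
    intro x; rw [MonoidHom.mem_ker, hN, mul_eq_one_iff_inv_eq]; exact eq_comm
  have rD : D.range = N.ker := by
    ext x
    constructor
    · rintro ⟨y, rfl⟩
      rw [kN, hD, map_div, hσ, inv_div]
    · intro h; exact H1 x h
  have m1 : D.ker.map N = D.ker.map (powMonoidHom 2) := by
    ext x
    simp only [Subgroup.mem_map]
    constructor <;> rintro ⟨y, hy, rfl⟩ <;> refine ⟨y, hy, ?_⟩ <;> rw [hN, (kD y).mp hy] <;> simp [pow_two]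
  have m2 : N.ker.map D = N.ker.map (powMonoidHom 2) := by
    ext x
    simp only [Subgroup.mem_map]
    constructor <;> rintro ⟨y, hy, rfl⟩ <;> refine ⟨y, hy, ?_⟩ <;> rw [hD, (kN y).mp hy] <;> simp [pow_two]
  have e1 := Subgroup.relIndex_map_map N D.ker ⊤
  have e2 := Subgroup.relIndex_map_map D N.ker ⊤
  rw [m1, ← MonoidHom.range_eq_map] at e1
  rw [m2, ← MonoidHom.range_eq_map, rD, sup_comm, relIndex_sq, c2] at e2
  rw [top_sup_eq] at e1 e2
  rw [← e1] at e2
  have rN : N.range ≤ D.ker := by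
    rintro _ ⟨y, rfl⟩
    rw [kD, hN, map_mul, hσ, mul_comm]
  have le : D.ker.map (powMonoidHom 2) ≤ N.range := by
    rw [← m1]; rintro _ ⟨y, _, rfl⟩; exact ⟨y, rfl⟩
  have e3 := Subgroup.relIndex_mul_relIndex _ _ _ le rN
  rw [← e2, relIndex_sq, c1] at e3
  have hrk : Module.finrank ℤ (Additive A) = Module.finrank ℤ (Additive D.ker) + Module.finrank ℤ (Additive N.ker) := by
    let L : Additive A →ₗ[ℤ] Additive A := (MonoidHom.toAdditive D).toIntLinearMap
    have h0 : AddGroup.FG (Additive A) := GroupFG.iff_add_fg.mp inferInstance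
    have h1 : Module.Finite ℤ (Additive A) := Module.Finite.iff_addGroup_fg.mpr h0
    have h := Submodule.finrank_quotient_add_finrank (LinearMap.ker L)
    rw [(LinearMap.quotKerEquivRange _).finrank_eq] at h
    have h2 : Module.finrank ℤ (LinearMap.ker L) = Module.finrank ℤ (Additive D.ker) := rfl
    have h3 : Module.finrank ℤ (LinearMap.range L) = Module.finrank ℤ (Additive D.range) := rfl
    rw [h2, h3, rD] at h
    omega
  rw [hrk, pow_add]
  have e4 : N.range.relIndex D.ker * 2 ^ Module.finrank ℤ (Additive N.ker) = 2 ^ Module.finrank ℤ (Additive D.ker) := by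
    apply Nat.eq_of_mul_eq_mul_right (show 0 < 2 by norm_num)
    rw [← e3]; ring
  calc _ = (N.range.relIndex D.ker * 2 ^ Module.finrank ℤ (Additive N.ker)) * 2 ^ Module.finrank ℤ (Additive D.ker) := by ring
    _ = _ := by rw [e4, ← pow_add, two_mul]

end grp

section
variable {K : Type*} [Field K] [NumberField K]

theorem finite_supp {x : K} (hx : x ≠ 0) : {v : Pl K | v.valuation K x ≠ 1}.Finite := by
  obtain ⟨a, c, hc, rfl⟩ := IsFractionRing.div_surjective (A := 𝓞 K) x
  have hfin : ∀ a : 𝓞 K, a ≠ 0 → {v : Pl K | a ∈ v.asIdeal}.Finite := by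
    intro a ha
    have := Ideal.finite_factors (I := Ideal.span {a}) (by simpa using ha)
    simpa only [Ideal.dvd_span_singleton] using this
  have ha : a ≠ 0 := by rintro rfl; simp at hx
  refine ((hfin a ha).union (hfin c (nonZeroDivisors.ne_zero hc))).subset ?_
  intro v hv
  by_contra hcon
  simp only [Set.mem_union, Set.mem_ofPred_eq, not_or] at hcon
  apply hv
  rw [map_div₀, (valuation_eq_one_iff_notMem (K := K) (v := v) (r := a)).mpr hcon.1,
    (valuation_eq_one_iff_notMem (K := K) (v := v) (r := c)).mpr hcon.2, div_one]

/-- norm group -/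
def Nrm (b : K) : Subgroup Kˣ where
  carrier := {x | ∃ α β : K, (x : K) = α ^ 2 - b * β ^ 2}
  one_mem' := ⟨1, 0, by simp⟩
  mul_mem' := by
    rintro x y ⟨α, β, h⟩ ⟨γ, δ, h'⟩
    exact ⟨α * γ + b * β * δ, α * δ + β * γ, by rw [Units.val_mul, h, h']; ring⟩
  inv_mem' := by
    rintro x ⟨α, β, h⟩
    refine ⟨α / x, β / x, ?_⟩
    rw [Units.val_inv_eq_inv_val]
    have := x.ne_zero
    field_simp
    rw [h]

theorem mem_Nrm {b : K} {x : Kˣ} : x ∈ Nrm b ↔ ∃ α β : K, (x : K) = α ^ 2 - b * β ^ 2 := Iff.rfl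

theorem val_eq_of_two {v : Pl K} (h2 : v.valuation K (2:K) = 1) {x : K} : v.valuation K (2 * x) = v.valuation K x := by
  rw [map_mul, h2, one_mul]

variable {M : Type*} [Field M] [NumberField M] [Algebra K M]

/-- H¹ vanishing -/
theorem H1_van {b : K} (Q : Quad K M b) (S : Finset (Pl K)) (hCT : CT (S : Set (Pl K)))
    (h2 : ∀ v ∉ S, v.valuation K (2:K) = 1) (hb0 : b ≠ 0) (hb : ∀ v ∉ S, v.valuation K b = 1)
    (u : M) (hu : u * Q.σ u = 1) (hu1 : ∀ w ∉ up M S, w.valuation M u = 1) :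
    ∃ x : M, (∀ w ∉ up M S, w.valuation M x = 1) ∧ x ≠ 0 ∧ u = x / Q.σ x := by
  classical
  have hω : Q.ω ≠ 0 := by
    intro h
    have := Q.sq
    rw [h, zero_pow two_ne_zero] at this
    exact hb0 ((map_eq_zero _).mp this.symm)
  have hx0 : ∃ x : M, x ≠ 0 ∧ u * Q.σ x = x := by
    by_cases h : 1 + u = 0
    · refine ⟨Q.ω, hω, ?_⟩
      rw [Q.hσ]; linear_combination - Q.ω * h
    · exact ⟨1 + u, h, by rw [map_add, map_one]; linear_combination hu⟩
  obtain ⟨x, hx, hux⟩ := hx0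
  obtain ⟨α, β, hαβ⟩ := Q.rep x
  have hne : ¬ (α = 0 ∧ β = 0) := by
    rintro ⟨rfl, rfl⟩
    apply hx; rw [hαβ]; simp
  let m : Pl K → ℤᵐ⁰ := fun v => max (v.valuation K α) (v.valuation K β)
  have hm0 : ∀ v, m v ≠ 0 := by
    intro v h
    have h1 := (le_max_left (v.valuation K α) (v.valuation K β)).trans h.le
    have h2 := (le_max_right (v.valuation K α) (v.valuation K β)).trans h.le
    rw [le_zero_iff, map_eq_zero] at h1 h2
    exact hne ⟨h1, h2⟩
  have hfin : {v : Pl K | m v ≠ 1}.Finite := by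
    have f1 : {v : Pl K | α ≠ 0 ∧ v.valuation K α ≠ 1}.Finite := by
      by_cases h : α = 0
      · simp [h]
      · exact (finite_supp h).subset (fun v hv => hv.2)
    have f2 : {v : Pl K | β ≠ 0 ∧ v.valuation K β ≠ 1}.Finite := by
      by_cases h : β = 0
      · simp [h]
      · exact (finite_supp h).subset (fun v hv => hv.2)
    refine (f1.union f2).subset ?_
    intro v hv
    by_contra hcon
    simp only [Set.mem_union, Set.mem_ofPred_eq, not_or, not_and, not_not] at hcon
    apply hv
    by_cases hα : α = 0
    · have hβ : β ≠ 0 := fun h => hne ⟨hα, h⟩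
      simp [m, hα, hcon.2 hβ]
    · by_cases hβ : β = 0
      · simp [m, hβ, hcon.1 hα]
      · simp [m, hcon.1 hα, hcon.2 hβ]
  obtain ⟨c, hc⟩ := hCT.exists_fun hfin.toFinset (fun v => - log (m v))
  have hc' : ∀ v ∉ S, v.valuation K (c : K) = (m v)⁻¹ := by
    intro v hv
    rw [hc v hv]
    split_ifs with h
    · rw [exp_neg, exp_log (hm0 v)]
    · simp only [Set.Finite.mem_toFinset, Set.mem_ofPred_eq, not_not] at h
      rw [h, inv_one]
  have hc0 : algebraMap K M (c : K) ≠ 0 := by simp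
  refine ⟨algebraMap K M c * x, ?_, mul_ne_zero hc0 hx, ?_⟩
  swap
  · rw [map_mul, Q.σ_alg]
    have : Q.σ x ≠ 0 := by simpa using hx
    field_simp
    exact hux
  intro w hw
  have hv : dn K w ∉ S := fun h => hw (mem_up.mpr h)
  set v := dn K w with hvdef
  set y := algebraMap K M c * x with hy
  have hwω : w.valuation M Q.ω = 1 := by
    have := congrArg (w.valuation M) Q.sq
    rw [map_pow, (dn_eq w b).mpr (hb v hv), pow_eq_one_iff] at this
    simpa using this
  have hα1 : v.valuation K (c * α) ≤ 1 := by
    rw [map_mul, hc' v hv, inv_mul_le_one₀ (zero_lt_iff.mpr (hm0 v))]; exact le_max_left _ _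
  have hβ1 : v.valuation K (c * β) ≤ 1 := by
    rw [map_mul, hc' v hv, inv_mul_le_one₀ (zero_lt_iff.mpr (hm0 v))]; exact le_max_right _ _
  have hmax : ¬ (v.valuation K (c * α) < 1 ∧ v.valuation K (c * β) < 1) := by
    rintro ⟨h1, h2⟩
    rw [map_mul, hc' v hv, inv_mul_lt_one₀ (zero_lt_iff.mpr (hm0 v))] at h1 h2
    exact lt_irrefl _ (max_lt h1 h2)
  have ey : y = algebraMap K M (c * α) + algebraMap K M (c * β) * Q.ω := by
    rw [hy, hαβ, map_mul, map_mul]; ring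
  have esy : Q.σ y = algebraMap K M (c * α) - algebraMap K M (c * β) * Q.ω := by rw [ey, Q.σ_rep]
  have hle : w.valuation M y ≤ 1 := by
    rw [ey]
    refine (Valuation.map_add _ _ _).trans (max_le ((dn_le w _).mpr hα1) ?_)
    rw [map_mul, hwω, mul_one]; exact (dn_le w _).mpr hβ1
  by_contra hcon
  have hlt : w.valuation M y < 1 := lt_of_le_of_ne hle hcon
  have huy : u * Q.σ y = y := by
    rw [hy, map_mul, Q.σ_alg]; linear_combination algebraMap K M (c:K) * hux
  have hlt' : w.valuation M (Q.σ y) < 1 := by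
    have := congrArg (w.valuation M) huy
    rw [map_mul, hu1 w hw, one_mul] at this
    rw [this]; exact hlt
  apply hmax
  constructor
  · rw [← val_eq_of_two (h2 v hv), ← dn_lt w]
    have : algebraMap K M (2 * (c * α)) = y + Q.σ y := by rw [esy, ey, map_mul, map_ofNat]; ring
    rw [this]
    exact Valuation.map_add_lt _ hlt hlt'
  · rw [← val_eq_of_two (h2 v hv), ← dn_lt w]
    have : algebraMap K M (2 * (c * β)) * Q.ω = y - Q.σ y := by rw [esy, ey, map_mul, map_ofNat]; ring
    have h3 := congrArg (w.valuation M) this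
    rw [map_mul, hwω, mul_one] at h3
    rw [h3]
    exact Valuation.map_sub_lt _ hlt hlt'

end
end DTO
end

section
namespace DTO
open IsDedekindDomain HeightOneSpectrum NumberField WithZero

theorem card_tors {G F : Type*} [CommGroup G] [Field F] [CharZero F] (j : G →* Fˣ) (hj : Function.Injective j)
    (m : G) (hm : j m = -1) : Nat.card (powMonoidHom (α := G) 2).ker = 2 := by
  have h1 : ((powMonoidHom (α := G) 2).ker : Set G) = {1, m} := by
    ext x
    simp only [SetLike.mem_coe, MonoidHom.mem_ker, powMonoidHom_apply, Set.mem_insert_iff, Set.mem_singleton_iff]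
    rw [← hj.eq_iff, map_pow, map_one]
    rw [← hj.eq_iff (a := x) (b := 1), ← hj.eq_iff (a := x) (b := m), hm, map_one]
    rw [Units.ext_iff, Units.ext_iff, Units.ext_iff]
    push_cast
    exact sq_eq_one_iff
  have h2 : Nat.card (powMonoidHom (α := G) 2).ker = ((powMonoidHom (α := G) 2).ker : Set G).ncard := rfl
  rw [h2, h1, Set.ncard_pair]
  intro h
  rw [← hj.eq_iff, hm, map_one, Units.ext_iff] at h
  norm_num at h

section
variable {K M : Type*} [Field K] [NumberField K] [Field M] [NumberField M] [Algebra K M]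

theorem rank_tc [IsTotallyComplex K] : Module.finrank ℚ K = 2 * (Units.rank K + 1) := by
  have h1 := InfinitePlace.card_eq_nrRealPlaces_add_nrComplexPlaces (K := K)
  have h2 := IsTotallyComplex.nrRealPlaces_eq_zero K
  have h3 := IsTotallyComplex.finrank (K := K)
  have h4 : 0 < Fintype.card (InfinitePlace K) := Fintype.card_pos
  rw [Units.rank]
  omega

theorem rank_quad [IsTotallyComplex K] {b : K} (Q : Quad K M b) (hb : ¬ IsSquare b) :
    2 * (Units.rank K + 1) ≤ Units.rank M + 1 := by
  have : IsTotallyComplex M := isTotallyComplex_of_algebra K M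
  have h1 := rank_tc (K := K)
  have h2 := rank_tc (K := M)
  have h3 := Module.finrank_mul_finrank ℚ K M
  have h4 : 2 ≤ Module.finrank K M := by
    have hl : LinearIndependent K ![(1:M), Q.ω] := by
      rw [LinearIndependent.pair_iff]
      intro s t h
      have ht : t = 0 := by
        by_contra ht
        apply hb
        refine ⟨s / t, ?_⟩
        apply (algebraMap K M).injective
        rw [← Q.sq]
        have e : Q.ω = - algebraMap K M (s/t) := by
          rw [Algebra.smul_def, Algebra.smul_def] at h
          have ht' : algebraMap K M t ≠ 0 := by simpa using ht
          rw [map_div₀]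
          field_simp
          linear_combination h
        rw [e, map_mul]; ring
      subst ht
      simpa using h
    simpa using hl.fintype_card_le_finrank
  rw [h1, h2] at h3
  nlinarith

open Classical in
theorem lemmaH_Q [IsTotallyComplex K] {b : K} (Q : Quad K M b) (hb : ¬ IsSquare b) (S : Finset (Pl K))
    (hCT : CT (S : Set (Pl K)))
    (h2 : ∀ v ∉ S, v.valuation K (2:K) = 1) (hbS : ∀ v ∉ S, v.valuation K b = 1) :
    (Nrm b).relIndex (US K S) ≠ 0 ∧
      2 * (Nrm b).relIndex (US K S) ≤ 2 ^ (S.filter (fun v => ¬ Split v b)).card := by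
  have hb0 : b ≠ 0 := by rintro rfl; exact hb (by simp)
  have hσU : ∀ x : Mˣ, x ∈ US M (up M S) → Units.map (Q.σ : M →* M) x ∈ US M (up M S) := by
    intro x hx w hw
    obtain ⟨w', h1, h3⟩ := twist Q.σ w
    have h4 : w' ∉ up M S := by rw [Finset.mem_coe, mem_up] at hw; rw [mem_up]; rwa [h1]
    have := hx w' h4
    rw [h3] at this
    exact this
  let σ : US M (up M S) →* US M (up M S) :=
    ((Units.map (Q.σ : M →* M)).comp (US M (up M S)).subtype).codRestrict _ (fun x => hσU x x.2)
  have σv : ∀ x : US M (up M S), (((σ x : US M (up M S)) : Mˣ) : M) = Q.σ ((x : Mˣ) : M) := fun _ => rfl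
  have ext : ∀ x y : US M (up M S), ((x : Mˣ) : M) = ((y : Mˣ) : M) → x = y :=
    fun x y h => Subtype.ext (Units.ext h)
  let D : US M (up M S) →* US M (up M S) := MonoidHom.id _ / σ
  let N : US M (up M S) →* US M (up M S) := MonoidHom.id _ * σ
  have hD : ∀ x, D x = x / σ x := fun _ => rfl
  have hN : ∀ x, N x = x * σ x := fun _ => rfl
  have hσσ : ∀ x, σ (σ x) = x := fun x => ext _ _ (by rw [σv, σv, Q.σσ])
  have hιU : ∀ x : Kˣ, x ∈ US K S → Units.map (algebraMap K M : K →* M) x ∈ US M (up M S) := by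
    intro x hx w hw
    rw [Finset.mem_coe, mem_up] at hw
    have := hx _ hw
    exact (dn_eq w (x:K)).mpr this
  let ι : US K S →* US M (up M S) :=
    ((Units.map (algebraMap K M : K →* M)).comp (US K S).subtype).codRestrict _ (fun x => hιU x x.2)
  have ιv : ∀ x : US K S, (((ι x : US M (up M S)) : Mˣ) : M) = algebraMap K M ((x : Kˣ) : K) := fun _ => rfl
  have ιinj : Function.Injective ι := by
    intro x y h
    have := congrArg (fun z : US M (up M S) => ((z : Mˣ) : M)) h
    simp only [ιv] at this
    exact Subtype.ext (Units.ext ((algebraMap K M).injective this))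
  have kD : ∀ x, x ∈ D.ker ↔ Q.σ ((x : Mˣ) : M) = ((x : Mˣ) : M) := by
    intro x; rw [MonoidHom.mem_ker, hD, div_eq_one]
    exact ⟨fun h => by rw [← σv, ← h], fun h => ext _ _ (by rw [σv, h])⟩
  have hker : D.ker = ι.range := by
    ext x
    rw [kD]
    constructor
    · intro h
      obtain ⟨α, hα⟩ := Q.fixed h
      have hα0 : α ≠ 0 := by
        rintro rfl
        rw [map_zero] at hα
        exact (x : Mˣ).ne_zero hα
      refine ⟨⟨Units.mk0 α hα0, ?_⟩, ext _ _ (by rw [ιv, hα]; rfl)⟩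
      intro v hv
      obtain ⟨w, rfl⟩ := dn_surj (M := M) v
      have := x.2 w (by rw [Finset.mem_coe, mem_up]; exact hv)
      change w.valuation M ((x : Mˣ) : M) = 1 at this
      rw [hα, dn_eq] at this
      exact this
    · rintro ⟨y, rfl⟩
      rw [ιv, Q.σ_alg]
  have hm1 : (-1 : Mˣ) ∈ US M (up M S) := by
    intro w hw
    simp
  let m1 : US M (up M S) := ⟨-1, hm1⟩
  have m1v : ((m1 : Mˣ) : M) = -1 := rfl
  have m1D : m1 ∈ D.ker := by rw [kD, m1v, map_neg, map_one]
  have m1N : m1 ∈ N.ker := by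
    rw [MonoidHom.mem_ker, hN]
    apply ext
    push_cast
    rw [σv, m1v, map_neg, map_one]; norm_num
  have key := herbrand σ D N hD hN hσσ (by
      intro x hx
      have hx' := congrArg (fun z : US M (up M S) => ((z : Mˣ) : M)) hx
      simp only [hN] at hx'
      push_cast at hx'
      rw [σv] at hx'
      obtain ⟨y, hy1, hy0, hy⟩ := H1_van Q S hCT h2 hb0 hbS ((x : Mˣ) : M) hx' (fun w hw => x.2 w hw)
      refine ⟨⟨Units.mk0 y hy0, fun w hw => hy1 w hw⟩, ext _ _ ?_⟩
      rw [hD, hy]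
      push_cast
      rw [σv]; rfl)
    (card_tors ((US M (up M S)).subtype.comp D.ker.subtype)
      (Subtype.val_injective.comp Subtype.val_injective) ⟨m1, m1D⟩ rfl)
    (card_tors ((US M (up M S)).subtype.comp N.ker.subtype)
      (Subtype.val_injective.comp Subtype.val_injective) ⟨m1, m1N⟩ rfl)
  have hfr : Module.finrank ℤ (Additive D.ker) = Module.finrank ℤ (Additive (US K S)) := by
    rw [hker]
    have e : US K S ≃* ι.range := MonoidHom.ofInjective ιinj
    exact (MulEquiv.toAdditive e).toIntLinearEquiv.finrank_eq.symm
  rw [hfr, US_rank, US_rank, hker, ← Subgroup.index_comap] at key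
  have hdvd : (Nrm b).relIndex (US K S) ∣ (N.range.comap ι).index := by
    rw [Subgroup.relIndex]
    apply Subgroup.index_dvd_of_le
    rintro x ⟨y, hy⟩
    rw [Subgroup.mem_subgroupOf, mem_Nrm]
    obtain ⟨α, β, h⟩ := Q.rep ((y : Mˣ) : M)
    refine ⟨α, β, (algebraMap K M).injective ?_⟩
    rw [← Q.norm_rep, ← h]
    change _ = ((y : Mˣ) : M) * (((σ y : US M (up M S)) : Mˣ) : M)
    rw [← ιv, ← hy, hN]
    rfl
  have hpos : (N.range.comap ι).index ≠ 0 := by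
    intro h; rw [h, zero_mul] at key
    exact absurd key.symm (by positivity)
  have h5 := rank_quad Q hb
  have h6 := card_up Q S
  have h7 := Finset.card_filter_add_card_filter_not (s := S) (fun v => Split v b)
  refine ⟨fun h => hpos (Nat.eq_zero_of_zero_dvd (h ▸ hdvd)), ?_⟩
  have h8 := Nat.le_of_dvd (Nat.pos_of_ne_zero hpos) hdvd
  refine le_trans (Nat.mul_le_mul_left 2 h8) ?_
  set I := (N.range.comap ι).index
  set A := (S.filter (fun v => Split v b)).card
  set B := (S.filter (fun v => ¬ Split v b)).card
  have h9 : I * 2 ^ (S.card + A + (2 * Units.rank K + 1)) ≤ 2 ^ (2 * (S.card + Units.rank K)) := by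
    rw [← key]
    apply Nat.mul_le_mul_left
    apply Nat.pow_le_pow_right (by norm_num)
    omega
  have h10 : 2 ^ (2 * (S.card + Units.rank K)) = 2 ^ B * 2 ^ (S.card + A + 2 * Units.rank K) := by
    rw [← pow_add]; congr 1; omega
  rw [h10, show S.card + A + (2 * Units.rank K + 1) = (S.card + A + 2 * Units.rank K) + 1 by ring, pow_succ] at h9
  have h11 : 0 < 2 ^ (S.card + A + 2 * Units.rank K) := by positivity
  nlinarith

open Classical in
theorem lemmaH [IsTotallyComplex K] {b : K} (hb : ¬ IsSquare b) (S : Finset (Pl K))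
    (hCT : CT (S : Set (Pl K)))
    (h2 : ∀ v ∉ S, v.valuation K (2:K) = 1) (hbS : ∀ v ∉ S, v.valuation K b = 1) :
    (Nrm b).relIndex (US K S) ≠ 0 ∧
      2 * (Nrm b).relIndex (US K S) ≤ 2 ^ (S.filter (fun v => ¬ Split v b)).card := by
  obtain ⟨M, _, _, _, ⟨Q⟩⟩ := exists_quad b hb
  exact lemmaH_Q Q hb S hCT h2 hbS
end
end DTO
end

section
namespace DTO
open IsDedekindDomain HeightOneSpectrum NumberField WithZero

section
variable {K : Type*} [Field K] [NumberField K]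

theorem not_sq_exp : ¬ IsSquare (exp (-1 : ℤ) : ℤᵐ⁰) := by
  rintro ⟨x, hx⟩
  have hx0 : x ≠ 0 := by rintro rfl; simp at hx
  have := congrArg log hx
  rw [log_mul hx0 hx0, log_exp] at this
  omega

theorem approx (v : Pl K) {x : K} (hx : v.valuation K x ≤ 1) (n : ℕ) :
    ∃ a : 𝓞 K, v.valuation K (x - a) ≤ exp (-(n:ℤ)) := by
  obtain ⟨m, d, h⟩ := exists_primeCompl_mul_eq_of_integer (K := K) v x hx
  have hd : (d : 𝓞 K) ∉ v.asIdeal := d.2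
  have hco : IsCoprime (Ideal.span {(d : 𝓞 K)}) (v.asIdeal ^ n) := by
    apply IsCoprime.pow_right
    rw [Ideal.isCoprime_iff_sup_eq]
    have hmax := v.isMaximal
    rw [sup_comm]
    by_contra hne
    have := hmax.eq_of_le hne le_sup_left
    apply hd
    exact this.ge (Ideal.mem_sup_right (Ideal.mem_span_singleton_self _))
  rw [Ideal.isCoprime_iff_exists] at hco
  obtain ⟨i, hi, j, hj, hij⟩ := hco
  obtain ⟨d', rfl⟩ := Ideal.mem_span_singleton'.mp hi
  refine ⟨m * d', ?_⟩
  have hd1 : v.valuation K ((d : 𝓞 K) : K) = 1 := (valuation_eq_one_iff_notMem (K := K) (v := v) (r := (d : 𝓞 K))).mpr hd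
  have hd0 : ((d : 𝓞 K) : K) ≠ 0 := by intro h0; rw [h0, map_zero] at hd1; exact zero_ne_one hd1
  have e : x - ((m * d' : 𝓞 K) : K) = x * ((j : 𝓞 K) : K) := by
    have h1 : ((d' * d + j : 𝓞 K) : K) = 1 := by rw [hij]; simp
    push_cast at h1 ⊢
    have h' : x * ((d : 𝓞 K) : K) = m := h
    linear_combination (-x) * h1 + (d' : K) * h'
  rw [e, map_mul]
  have hj' : v.valuation K ((j : 𝓞 K) : K) ≤ exp (-(n:ℤ)) := by
    rw [valuation_of_algebraMap]
    exact (intValuation_le_pow_iff_mem v j n).mpr hj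
  calc _ ≤ 1 * exp (-(n:ℤ)) := mul_le_mul' hx hj'
    _ = _ := one_mul _

theorem lt_of_le_exp1 {γ : ℤᵐ⁰} (h : γ ≤ exp (-((1:ℕ):ℤ))) : γ < 1 :=
  lt_of_le_of_lt h (by rw [← exp_zero, exp_lt_exp]; norm_num)

theorem approx1 (v : Pl K) {x : K} (hx : v.valuation K x ≤ 1) :
    ∃ a : 𝓞 K, v.valuation K (x - a) < 1 := by
  obtain ⟨a, ha⟩ := approx v hx 1
  exact ⟨a, lt_of_le_exp1 ha⟩

theorem v_one_of {v : Pl K} {x : K} (h : v.valuation K (x - 1) < 1) : v.valuation K x = 1 := by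
  have := (v.valuation K).map_one_add_of_lt h
  rwa [add_sub_cancel] at this

/-- congruence subgroup -/
def Cg (v : Pl K) (a : Kˣ) : Subgroup Kˣ where
  carrier := {x | v.valuation K ((x : K) - 1) < 1 ∧ v.valuation K ((x : K) - 1) < v.valuation K a}
  one_mem' := by
    simp only [Set.mem_ofPred_eq, Units.val_one, sub_self, map_zero]
    exact ⟨zero_lt_one, (Valuation.pos_iff _).mpr a.ne_zero⟩
  mul_mem' := by
    rintro x y ⟨h1, h2⟩ ⟨h3, h4⟩
    have e : ((x * y : Kˣ) : K) - 1 = x * (y - 1) + (x - 1) := by push_cast; ring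
    have hx := v_one_of h1
    simp only [Set.mem_ofPred_eq, e]
    constructor
    · apply Valuation.map_add_lt _ _ h1
      rwa [map_mul, hx, one_mul]
    · apply Valuation.map_add_lt _ _ h2
      rwa [map_mul, hx, one_mul]
  inv_mem' := by
    rintro x ⟨h1, h2⟩
    have hx := v_one_of h1
    have e : ((x⁻¹ : Kˣ) : K) - 1 = - ((x - 1) / x) := by
      rw [Units.val_inv_eq_inv_val]
      have := x.ne_zero
      field_simp
      ring
    simp only [Set.mem_ofPred_eq, e, Valuation.map_neg, map_div₀, hx, div_one]
    exact ⟨h1, h2⟩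

theorem mem_Cg {v : Pl K} {a x : Kˣ} : x ∈ Cg v a ↔
    v.valuation K ((x : K) - 1) < 1 ∧ v.valuation K ((x : K) - 1) < v.valuation K a := Iff.rfl

theorem mem_Cg1 {v : Pl K} {x : Kˣ} : x ∈ Cg v 1 ↔ v.valuation K ((x : K) - 1) < 1 := by
  rw [mem_Cg, Units.val_one, map_one, and_self]

/-- x ≡ y -/
theorem div_mem_Cg1 {v : Pl K} {x y : Kˣ} (h : v.valuation K ((x : K) - y) < v.valuation K (y : K)) : x / y ∈ Cg v 1 := by
  rw [mem_Cg1]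
  have : ((x / y : Kˣ) : K) - 1 = (x - y) / y := by
    rw [Units.val_div_eq_div_val]
    have := y.ne_zero
    field_simp
  rw [this, map_div₀]
  have hy : 0 < v.valuation K (y : K) := (Valuation.pos_iff _).mpr y.ne_zero
  exact (div_lt_one₀ hy).mpr h

/-- local squares -/
def LS (v : Pl K) : Subgroup Kˣ := sqs Kˣ ⊔ Cg v (Units.mk0 4 (by norm_num))

/-- local norms -/
def LN (b : K) (v : Pl K) : Subgroup Kˣ := Nrm b ⊔ Cg v 1

theorem sqs_le_Nrm (b : K) : sqs Kˣ ≤ Nrm b := by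
  rintro _ ⟨y, rfl⟩
  exact ⟨y, 0, by simp⟩

theorem LS_le_LN (b : K) (v : Pl K) : LS v ≤ LN b v := by
  apply sup_le_sup (sqs_le_Nrm b)
  intro x hx
  rw [mem_Cg1]; exact hx.1

theorem Split_of_LS {v : Pl K} {b : Kˣ} (h : b ∈ LS v) : Split v (b : K) := by
  rw [LS, Subgroup.mem_sup] at h
  obtain ⟨_, ⟨y, rfl⟩, t, ht, rfl⟩ := h
  have hy := y.ne_zero
  refine ⟨1/2, 1/(2*y), by simp, ?_⟩
  have e : ((1:K)/2) ^ 2 - ((powMonoidHom 2 y * t : Kˣ) : K) * (1/(2*y)) ^ 2 = - ((t - 1) / 4) := by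
    simp only [powMonoidHom_apply]
    push_cast
    field_simp
    ring
  rw [e, Valuation.map_neg, map_div₀]
  have h4 : 0 < v.valuation K (4 : K) := (Valuation.pos_iff _).mpr (by norm_num)
  exact (div_lt_one₀ h4).mpr ht.2

theorem exists_unif (v : Pl K) : ∃ π : Kˣ, v.valuation K (π : K) = exp (-1) := by
  obtain ⟨π, hπ⟩ := valuation_exists_uniformizer K v
  have : π ≠ 0 := by rintro rfl; rw [map_zero] at hπ; exact exp_ne_zero hπ.symm
  exact ⟨Units.mk0 π this, hπ⟩

theorem isSq_val {v : Pl K} (x : K) : IsSquare (v.valuation K (x ^ 2)) := ⟨v.valuation K x, by rw [map_pow, pow_two]⟩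

theorem odd_of_two {v : Pl K} (h : v.valuation K (2 : K) = 1) : ringChar (𝓞 K ⧸ v.asIdeal) ≠ 2 := by
  intro hc
  have h1 : ((2 : ℕ) : 𝓞 K ⧸ v.asIdeal) = 0 := by
    have := ringChar.Nat.cast_ringChar (R := 𝓞 K ⧸ v.asIdeal)
    rwa [hc] at this
  have h2 : Ideal.Quotient.mk v.asIdeal (2 : 𝓞 K) = 0 := by
    rw [map_ofNat]; exact_mod_cast h1
  rw [Ideal.Quotient.eq_zero_iff_mem] at h2
  have := (valuation_eq_one_iff_notMem (K := K) (v := v) (r := (2 : 𝓞 K))).mp (by simpa only [RingOfIntegers.coe_eq_algebraMap, map_ofNat] using h)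
  exact this h2

/-- if a proper local norm group is everything then split (odd case) -/
theorem split_of_LN_top {v : Pl K} {b : K} (h2 : v.valuation K (2 : K) = 1) (h : LN b v = ⊤) : Split v b := by
  by_cases hev : IsSquare (v.valuation K b)
  · -- even valuation
    obtain ⟨π, hπ⟩ := exists_unif v
    have : π ∈ LN b v := by rw [h]; trivial
    rw [LN, Subgroup.mem_sup] at this
    obtain ⟨x, ⟨α, β, hx⟩, p, hp, hxp⟩ := this
    rw [mem_Cg1] at hp
    have hp1 := v_one_of hp
    have hvx : v.valuation K (α ^ 2 - b * β ^ 2) = exp (-1) := by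
      rw [← hx, ← hπ, ← hxp, Units.val_mul, map_mul, hp1, mul_one]
    have hsqb : IsSquare (v.valuation K (b * β ^ 2)) := by
      rw [map_mul]; exact hev.mul (isSq_val β)
    have heq : v.valuation K (α ^ 2) = v.valuation K (b * β ^ 2) := by
      rcases lt_trichotomy (v.valuation K (α ^ 2)) (v.valuation K (b * β ^ 2)) with hl | hl | hl
      · exfalso
        rw [Valuation.map_sub_eq_of_lt_right _ hl] at hvx
        rw [hvx] at hsqb
        exact not_sq_exp hsqb
      · exact hl
      · exfalso
        rw [Valuation.map_sub_eq_of_lt_left _ hl] at hvx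
        have := isSq_val (v := v) α
        rw [hvx] at this
        exact not_sq_exp this
    have hα : α ≠ 0 := by
      rintro rfl
      have h0 : b * β ^ 2 = 0 := by
        rw [← Valuation.zero_iff (v.valuation K), ← heq]; simp
      rw [h0, zero_pow two_ne_zero, sub_zero, map_zero] at hvx; exact exp_ne_zero hvx.symm
    have hle : v.valuation K (α ^ 2 - b * β ^ 2) < v.valuation K (α ^ 2) := by
      apply lt_of_le_of_ne
      · exact (Valuation.map_sub _ _ _).trans (max_le le_rfl heq.ge)
      · intro he
        have := isSq_val (v := v) α
        rw [← he, hvx] at this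
        exact not_sq_exp this
    refine ⟨1, β / α, by rw [mul_one, h2], ?_⟩
    have e : (1:K) ^ 2 - b * (β / α) ^ 2 = (α ^ 2 - b * β ^ 2) / α ^ 2 := by field_simp
    rw [e, map_div₀]
    have hpos : 0 < v.valuation K (α ^ 2) := (Valuation.pos_iff _).mpr (pow_ne_zero 2 hα)
    exact (div_lt_one₀ hpos).mpr hle
  · exfalso
    have hmax := v.isMaximal
    let _ := Ideal.Quotient.field v.asIdeal
    obtain ⟨a, ha⟩ := FiniteField.exists_nonsquare (odd_of_two h2)
    obtain ⟨a, rfl⟩ := Ideal.Quotient.mk_surjective a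
    have hav : a ∉ v.asIdeal := by
      intro hm
      apply ha
      rw [Ideal.Quotient.eq_zero_iff_mem.mpr hm]
      exact IsSquare.zero
    have hav1 : v.valuation K (a : K) = 1 := (valuation_eq_one_iff_notMem (K := K) (v := v) (r := a)).mpr hav
    have ha0 : (a : K) ≠ 0 := by intro h0; rw [h0, map_zero] at hav1; exact zero_ne_one hav1
    have : Units.mk0 (a:K) ha0 ∈ LN b v := by rw [h]; trivial
    rw [LN, Subgroup.mem_sup] at this
    obtain ⟨x, ⟨α, β, hx⟩, p, hp, hxp⟩ := this
    rw [mem_Cg1] at hp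
    have hp1 := v_one_of hp
    have hxa : (x : K) * p = a := by rw [← Units.val_mul, hxp]; rfl
    have hvx : v.valuation K (x : K) = 1 := by
      have := congrArg (v.valuation K) hxa
      rwa [map_mul, hp1, mul_one, hav1] at this
    have hxa1 : v.valuation K (x - a) < 1 := by
      have e : (x : K) - a = - (x * (p - 1)) := by rw [← hxa]; ring
      rw [e, Valuation.map_neg, map_mul, hvx, one_mul]; exact hp
    rw [hx] at hvx hxa1
    have hβ : v.valuation K (b * β ^ 2) < 1 := by
      by_contra hge
      push Not at hge
      have hβ0 : β ≠ 0 := by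
        rintro rfl
        simp at hge
      have hns : ¬ IsSquare (v.valuation K (b * β ^ 2)) := by
        rintro ⟨y, hy⟩
        apply hev
        refine ⟨y / v.valuation K β, ?_⟩
        have : v.valuation K β ≠ 0 := (Valuation.ne_zero_iff _).mpr hβ0
        rw [map_mul, map_pow] at hy
        field_simp
        rw [hy, pow_two]
      rcases lt_trichotomy (v.valuation K (α ^ 2)) (v.valuation K (b * β ^ 2)) with hl | hl | hl
      · rw [Valuation.map_sub_eq_of_lt_right _ hl] at hvx
        rw [hvx] at hns
        exact hns (IsSquare.one)
      · exact hns (hl ▸ isSq_val α)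
      · rw [Valuation.map_sub_eq_of_lt_left _ hl] at hvx
        rw [hvx] at hl
        exact absurd hl (not_lt.mpr hge)
    have hα : v.valuation K (α ^ 2 - a) < 1 := by
      have e : α ^ 2 - (a:K) = (α ^ 2 - b * β ^ 2 - a) + b * β ^ 2 := by ring
      rw [e]; exact Valuation.map_add_lt _ hxa1 hβ
    have hα1 : v.valuation K α ≤ 1 := by
      have e : α ^ 2 = (α ^ 2 - a) + a := by ring
      have : v.valuation K (α ^ 2) ≤ 1 := by
        rw [e]; exact Valuation.map_add_le _ hα.le hav1.le
      rw [map_pow] at this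
      exact (pow_le_one_iff two_ne_zero).mp this
    obtain ⟨c, hc⟩ := approx1 v hα1
    apply ha
    refine ⟨Ideal.Quotient.mk _ c, ?_⟩
    rw [← map_mul, Ideal.Quotient.eq]
    rw [← valuation_lt_one_iff_mem (K := K)]
    push_cast
    have e : (a : K) - c * c = - (α ^ 2 - a) + ((α - c) * α + (α - c) * c) := by ring
    rw [e]
    apply Valuation.map_add_lt _ (by rwa [Valuation.map_neg])
    apply Valuation.map_add_lt
    · rw [map_mul]; exact mul_lt_one_of_lt_of_le hc hα1
    · rw [map_mul]; exact mul_lt_one_of_lt_of_le hc (valuation_le_one v c)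

/-- no cube roots of unity mod v -/
def NR (v : Pl K) : Prop := ∀ x : K, v.valuation K x ≤ 1 → v.valuation K (x ^ 2 + x + 1) = 1

theorem NR_of_not_split {v : Pl K} (h2 : v.valuation K (2 : K) < 1) (h : ¬ Split v (-3 : K)) : NR v := by
  intro x hx
  by_contra hne
  apply h
  refine ⟨x + 1/2, 1/2, ?_, ?_⟩
  · have e : (2:K) * (x + 1/2) = 1 + 2 * x := by ring
    rw [e]
    apply Valuation.map_one_add_of_lt
    rw [map_mul]
    exact mul_lt_one_of_lt_of_le h2 hx
  · have e : (x + 1/2) ^ 2 - (-3 : K) * (1/2) ^ 2 = x ^ 2 + x + 1 := by ring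
    rw [e]
    apply lt_of_le_of_ne _ hne
    apply Valuation.map_add_le _ _ (by simp)
    apply Valuation.map_add_le _ _ hx
    rw [map_pow]; exact pow_le_one₀ zero_le hx

theorem LN_ne_top_two {v : Pl K} (h : NR v) : LN (-3 : K) v ≠ ⊤ := by
  intro htop
  obtain ⟨π, hπ⟩ := exists_unif v
  have : π ∈ LN (-3 : K) v := by rw [htop]; trivial
  rw [LN, Subgroup.mem_sup] at this
  obtain ⟨x, ⟨α, β, hx⟩, p, hp, hxp⟩ := this
  rw [mem_Cg1] at hp
  have hp1 := v_one_of hp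
  have hvx : v.valuation K (α ^ 2 - (-3 : K) * β ^ 2) = exp (-1) := by
    rw [← hx, ← hπ, ← hxp, Units.val_mul, map_mul, hp1, mul_one]
  have hβ : β ≠ 0 := by
    rintro rfl
    have := isSq_val (v := v) α
    simp only [ne_eq, OfNat.ofNat_ne_zero, not_false_eq_true, zero_pow, mul_zero, sub_zero] at hvx
    rw [hvx] at this
    exact not_sq_exp this
  have hβv : v.valuation K β ≠ 0 := (Valuation.ne_zero_iff _).mpr hβ
  have e : α ^ 2 - (-3 : K) * β ^ 2 = (2 * β) ^ 2 * (((α / β - 1) / 2) ^ 2 + ((α / β - 1) / 2) + 1) := by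
    field_simp
    ring
  apply not_sq_exp
  rw [← hvx, e, map_mul]
  apply (isSq_val _).mul
  set y := (α / β - 1) / 2
  by_cases hy : v.valuation K y ≤ 1
  · rw [h y hy]; exact IsSquare.one
  · push Not at hy
    have h1 : v.valuation K (y ^ 2 + y + 1) = v.valuation K (y ^ 2) := by
      rw [add_assoc]
      apply Valuation.map_add_eq_of_lt_left
      have : v.valuation K (y + 1) = v.valuation K y := by
        apply Valuation.map_add_eq_of_lt_left
        rwa [map_one]
      rw [this, map_pow, pow_two]
      calc v.valuation K y = 1 * v.valuation K y := (one_mul _).symm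
        _ < v.valuation K y * v.valuation K y := mul_lt_mul_of_pos_right hy (lt_trans zero_lt_one hy)
    rw [h1]; exact isSq_val y

theorem exists_sqrt_mod {v : Pl K} (h2 : v.valuation K (2 : K) < 1) {u : K} (hu : v.valuation K u = 1) :
    ∃ y : K, v.valuation K (u - y ^ 2) < 1 := by
  obtain ⟨a, ha⟩ := approx1 v hu.le
  have hmax := v.isMaximal
  let _ := Ideal.Quotient.field v.asIdeal
  have hc : ringChar (𝓞 K ⧸ v.asIdeal) = 2 := by
    have : ((2 : ℕ) : 𝓞 K ⧸ v.asIdeal) = 0 := by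
      have h := (valuation_lt_one_iff_mem (K := K) v (2 : 𝓞 K)).mp (by simpa only [RingOfIntegers.coe_eq_algebraMap, map_ofNat] using h2)
      rw [← Ideal.Quotient.eq_zero_iff_mem] at h
      rw [map_ofNat] at h
      exact_mod_cast h
    have h1 := (ringChar.spec (𝓞 K ⧸ v.asIdeal) 2).mp this
    rcases (Nat.dvd_prime Nat.prime_two).mp h1 with h | h
    · exact absurd h CharP.ringChar_ne_one
    · exact h
  obtain ⟨c, hc⟩ := FiniteField.isSquare_of_char_two hc (Ideal.Quotient.mk _ a)
  obtain ⟨c, rfl⟩ := Ideal.Quotient.mk_surjective c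
  rw [← map_mul, Ideal.Quotient.eq, ← valuation_lt_one_iff_mem (K := K)] at hc
  refine ⟨c, ?_⟩
  have e : u - (c : K) ^ 2 = (u - a) + ((a - c * c : 𝓞 K) : K) := by push_cast; ring
  rw [e]; exact Valuation.map_add_lt _ ha hc

theorem LN_of_sq_val {v : Pl K} (b : K) (h2 : v.valuation K (2 : K) < 1) (x z : Kˣ)
    (h : v.valuation K (x : K) = v.valuation K (z : K) ^ 2) : x ∈ LN b v := by
  have hz : v.valuation K (z : K) ≠ 0 := (Valuation.ne_zero_iff _).mpr z.ne_zero
  have hu : v.valuation K ((x : K) / z ^ 2) = 1 := by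
    rw [map_div₀, map_pow, h]; exact div_self (pow_ne_zero 2 hz)
  obtain ⟨y, hy⟩ := exists_sqrt_mod h2 hu
  have hy1 : v.valuation K (y ^ 2) = 1 := by
    rw [← hu]; rw [← hu] at hy
    exact Valuation.map_eq_of_sub_lt _ (by rwa [Valuation.map_sub_swap])
  have hy0 : y ≠ 0 := by rintro rfl; simp at hy1
  have e : x = (z * Units.mk0 y hy0) ^ 2 * (x / (z * Units.mk0 y hy0) ^ 2) := by rw [mul_div_cancel]
  rw [e]
  apply Subgroup.mul_mem_sup
  · exact sqs_le_Nrm b ⟨_, rfl⟩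
  · apply div_mem_Cg1
    push_cast
    have e2 : (x:K) - (z * (Units.mk0 y hy0 : Kˣ)) ^ 2 = z ^ 2 * (x / z ^ 2 - y ^ 2) := by
      have := z.ne_zero
      rw [Units.val_mk0]
      field_simp
    rw [e2, map_mul, mul_pow, map_mul, Units.val_mk0, hy1, mul_one]
    have : 0 < v.valuation K ((z:K) ^ 2) := (Valuation.pos_iff _).mpr (pow_ne_zero 2 z.ne_zero)
    calc _ < v.valuation K ((z:K) ^ 2) * 1 := mul_lt_mul_of_pos_left hy this
      _ = _ := mul_one _

theorem LN_three {v : Pl K} (x : Kˣ) (hx : (x : K) = -2) (b : K) (h3 : v.valuation K (3 : K) < 1) : x ∈ LN b v := by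
  apply Subgroup.mem_sup_right
  rw [mem_Cg1, hx, show (-2 - 1 : K) = -3 by norm_num, Valuation.map_neg]
  exact h3

open Polynomial in
theorem LN_odd {v : Pl K} (x : Kˣ) (hx : (x : K) = -2) (h2 : v.valuation K (2 : K) = 1) (h3 : v.valuation K (3 : K) = 1) :
    x ∈ LN (-3 : K) v := by
  have hmax := v.isMaximal
  let _ := Ideal.Quotient.field v.asIdeal
  let _ := Fintype.ofFinite (𝓞 K ⧸ v.asIdeal)
  have h3' : (3 : 𝓞 K ⧸ v.asIdeal) ≠ 0 := by
    intro h
    have : Ideal.Quotient.mk v.asIdeal (3 : 𝓞 K) = 0 := by rw [map_ofNat]; exact h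
    rw [Ideal.Quotient.eq_zero_iff_mem] at this
    exact (valuation_eq_one_iff_notMem (K := K) (v := v) (r := (3 : 𝓞 K))).mp (by simpa only [RingOfIntegers.coe_eq_algebraMap, map_ofNat] using h3) this
  obtain ⟨a, c, h⟩ := FiniteField.exists_root_sum_quadratic (R := 𝓞 K ⧸ v.asIdeal) (f := X ^ 2 + C 2)
    (g := C 3 * X ^ 2) (degree_X_pow_add_C (by norm_num) _) (degree_C_mul_X_pow 2 h3')
    (FiniteField.odd_card_of_char_ne_two (odd_of_two h2))
  obtain ⟨a, rfl⟩ := Ideal.Quotient.mk_surjective a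
  obtain ⟨c, rfl⟩ := Ideal.Quotient.mk_surjective c
  simp only [eval_add, eval_pow, eval_X, eval_C, eval_mul] at h
  have h' : Ideal.Quotient.mk v.asIdeal (a ^ 2 + 2 + 3 * c ^ 2) = 0 := by
    simp only [map_add, map_mul, map_pow]; exact h
  rw [Ideal.Quotient.eq_zero_iff_mem, ← valuation_lt_one_iff_mem (K := K)] at h'
  push_cast at h'
  have hv2 : v.valuation K (-2 : K) = 1 := by rw [Valuation.map_neg, h2]
  set y : K := (a:K) ^ 2 - (-3) * (c:K) ^ 2 with hy
  have hyv : v.valuation K ((-2 : K) - y) < 1 := by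
    have e : (-2 : K) - y = - (algebraMap (𝓞 K) K (a ^ 2 + 2 + 3 * c ^ 2)) := by
      simp only [map_add, map_mul, map_pow, map_ofNat]; rw [hy]; ring
    rw [e, Valuation.map_neg]; exact h'
  have hy1 : v.valuation K y = 1 := by
    rw [← hv2] at hyv ⊢
    exact Valuation.map_eq_of_sub_lt _ (by rwa [Valuation.map_sub_swap])
  have hy0 : y ≠ 0 := by intro h; rw [h, map_zero] at hy1; exact zero_ne_one hy1
  have e : x = Units.mk0 y hy0 * (x / Units.mk0 y hy0) := by rw [mul_div_cancel]
  rw [e]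
  apply Subgroup.mul_mem_sup
  · exact ⟨a, c, hy⟩
  · apply div_mem_Cg1
    rw [hx, Units.val_mk0, hy1]; exact hyv

end
end DTO
end

section
namespace DTO
open IsDedekindDomain HeightOneSpectrum NumberField WithZero

section
variable {K : Type*} [Field K] [NumberField K]

theorem exists_exp (v : Pl K) {a : 𝓞 K} (ha : a ≠ 0) : ∃ n : ℕ, v.valuation K (a : K) = exp (-(n:ℤ)) := by
  rw [valuation_of_algebraMap, intValuation_eq_exp_neg_multiplicity v ha]
  exact ⟨_, rfl⟩

theorem le_exp_iff (v : Pl K) (a : 𝓞 K) (n : ℕ) : v.valuation K (a : K) ≤ exp (-(n:ℤ)) ↔ a ∈ v.asIdeal ^ n := by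
  rw [valuation_of_algebraMap]
  exact intValuation_le_pow_iff_mem v a n

theorem wapprox (T : Finset (Pl K)) (v : Pl K) (hv : v ∉ T) : Cg v 1 ⊔ ⨅ w ∈ T, Cg w 1 = ⊤ := by
  classical
  rw [eq_top_iff]
  intro x _
  obtain ⟨n, d, hd, hx⟩ := IsFractionRing.div_surjective (A := 𝓞 K) (x : K)
  have hd0 : d ≠ 0 := nonZeroDivisors.ne_zero hd
  have hdK : (d : K) ≠ 0 := by simpa using hd0
  have hn0 : n ≠ 0 := by
    rintro rfl
    rw [map_zero, zero_div] at hx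
    exact x.ne_zero hx.symm
  have hnK : (n : K) ≠ 0 := by simpa using hn0
  choose en hen using fun w : Pl K => exists_exp w hn0
  choose ed hed using fun w : Pl K => exists_exp w hd0
  obtain ⟨m, hm⟩ := exists_forall_sub_mem_ideal (s := insert v T) (fun w : Pl K => w.asIdeal)
    (fun w => en w + ed w + 1) (fun w _ => w.prime) (fun i _ j _ hij h => hij (HeightOneSpectrum.ext h))
    (fun w => if w.1 = v then d else n)
  have hmv : v.valuation K ((m : K) - d) < v.valuation K (d : K) := by
    have h := hm v (Finset.mem_insert_self _ _)
    simp only [if_true] at h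
    rw [← le_exp_iff] at h
    push_cast at h
    refine lt_of_le_of_lt h ?_
    rw [hed, exp_lt_exp]; push_cast; omega
  have hmw : ∀ w ∈ T, w.valuation K ((m : K) - n) < w.valuation K (n : K) := by
    intro w hw
    have h := hm w (Finset.mem_insert_of_mem hw)
    have hne : w ≠ v := by rintro rfl; exact hv hw
    simp only [if_neg hne] at h
    rw [← le_exp_iff] at h
    push_cast at h
    refine lt_of_le_of_lt h ?_
    rw [hen, exp_lt_exp]; push_cast; omega
  have hm0 : (m : K) ≠ 0 := by
    intro h
    rw [h, zero_sub, Valuation.map_neg] at hmv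
    exact lt_irrefl _ hmv
  have e : x = (Units.mk0 _ hm0 / Units.mk0 _ hdK) * (Units.mk0 _ hm0 / Units.mk0 _ hnK)⁻¹ := by
    apply Units.ext
    rw [Units.val_mul, Units.val_inv_eq_inv_val, Units.val_div_eq_div_val, Units.val_div_eq_div_val]
    simp only [Units.val_mk0]
    rw [← hx]
    change (n : K) / d = _
    field_simp
  rw [e]
  apply Subgroup.mul_mem_sup
  · exact div_mem_Cg1 hmv
  · simp only [Subgroup.mem_iInf]
    intro w hw
    exact inv_mem (div_mem_Cg1 (hmw w hw))

theorem index_LN (b : K) (T : Finset (Pl K)) (h : ∀ v ∈ T, LN b v ≠ ⊤)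
    (h0 : (⨅ v ∈ T, LN b v).index ≠ 0) : 2 ^ T.card ≤ (⨅ v ∈ T, LN b v).index := by
  classical
  induction T using Finset.induction_on with
  | empty => simp
  | insert v T hv ih =>
    rw [Finset.iInf_insert] at h0 ⊢
    set J := ⨅ w ∈ T, LN b w with hJ
    have htop : J ⊔ LN b v = ⊤ := by
      rw [eq_top_iff, ← wapprox T v hv, sup_comm]
      apply sup_le_sup
      · exact iInf₂_mono (fun w _ => le_sup_right)
      · exact le_sup_right
    have e1 := Subgroup.relIndex_mul_index (H := LN b v ⊓ J) (K := J) inf_le_right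
    rw [Subgroup.inf_relIndex_right, ← Subgroup.relIndex_sup_right, htop, Subgroup.relIndex_top_right] at e1
    rw [← e1] at h0 ⊢
    rw [Finset.card_insert_of_notMem hv, pow_succ, mul_comm (2 ^ _)]
    have hv' : (LN b v).index ≠ 1 := fun h1 => h v (Finset.mem_insert_self _ _) (Subgroup.index_eq_one.mp h1)
    have := ih (fun w hw => h w (Finset.mem_insert_of_mem hw)) (right_ne_zero_of_mul h0)
    have h00 := left_ne_zero_of_mul h0
    exact Nat.mul_le_mul (by omega) this

/-- units at v -/
def Vu (v : Pl K) : Subgroup Kˣ where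
  carrier := {x | v.valuation K (x : K) = 1}
  one_mem' := by simp
  mul_mem' := by
    intro x y hx hy
    simp only [Set.mem_ofPred_eq] at *
    rw [Units.val_mul, map_mul, hx, hy, one_mul]
  inv_mem' := by
    intro x hx
    simp only [Set.mem_ofPred_eq] at *
    rw [Units.val_inv_eq_inv_val, map_inv₀, hx, inv_one]

theorem mem_Vu {v : Pl K} {x : Kˣ} : x ∈ Vu v ↔ v.valuation K (x : K) = 1 := Iff.rfl

theorem index_sq_finite (G : Type*) [CommGroup G] [Finite G] : (sqs G).index = Nat.card (powMonoidHom (α := G) 2).ker := by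
  have h1 := Subgroup.card_mul_index (powMonoidHom (α := G) 2).ker
  have h2 := Subgroup.card_mul_index (sqs G)
  rw [Subgroup.index_ker] at h1
  have h3 : Nat.card (powMonoidHom (α := G) 2).range = Nat.card (sqs G) := rfl
  rw [h3, ← h2, mul_comm] at h1
  exact (Nat.eq_of_mul_eq_mul_left Nat.card_pos h1).symm

theorem card_tors_bound (v : Pl K) (e : ℕ) :
    Nat.card (powMonoidHom (α := (𝓞 K ⧸ v.asIdeal ^ (2 * e + 1))ˣ) 2).ker ≤ 2 * Ideal.absNorm v.asIdeal ^ e := by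
  have hfin : Finite (𝓞 K ⧸ v.asIdeal ^ (2 * e + 1)) :=
    Ring.HasFiniteQuotients.finiteQuotient (pow_ne_zero _ v.ne_bot)
  have hfin2 : Finite (𝓞 K ⧸ v.asIdeal ^ (e + 1)) :=
    Ring.HasFiniteQuotients.finiteQuotient (pow_ne_zero _ v.ne_bot)
  let π : (𝓞 K ⧸ v.asIdeal ^ (2 * e + 1)) →+* (𝓞 K ⧸ v.asIdeal ^ (e + 1)) :=
    Ideal.Quotient.factor (Ideal.pow_le_pow_right (by omega))
  have hπs : Function.Surjective π := Ideal.Quotient.factor_surjective _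
  have hker : Nat.card π.toAddMonoidHom.ker = Ideal.absNorm v.asIdeal ^ e := by
    have h1 := AddSubgroup.card_mul_index π.toAddMonoidHom.ker
    rw [AddSubgroup.index_ker] at h1
    have h2 : Nat.card π.toAddMonoidHom.range = Nat.card (𝓞 K ⧸ v.asIdeal ^ (e + 1)) := by
      have : π.toAddMonoidHom.range = ⊤ := AddMonoidHom.range_eq_top.mpr hπs
      rw [this]; exact AddSubgroup.card_top
    rw [h2, ← Submodule.cardQuot_apply, ← Submodule.cardQuot_apply, ← Ideal.absNorm_apply, ← Ideal.absNorm_apply, map_pow, map_pow] at h1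
    have hpos : 0 < Ideal.absNorm v.asIdeal ^ (e + 1) := by
      apply pow_pos
      exact Nat.pos_of_ne_zero (Ideal.absNorm_ne_zero_iff_mem_nonZeroDivisors.mpr (mem_nonZeroDivisors_of_ne_zero v.ne_bot))
    apply Nat.eq_of_mul_eq_mul_right hpos
    rw [h1, ← pow_add]; congr 1; ring
  have h2K : (exp (-(e:ℤ)) : ℤᵐ⁰) ≠ 0 := exp_ne_zero
  have key : ∀ x : (powMonoidHom (α := (𝓞 K ⧸ v.asIdeal ^ (2 * e + 1))ˣ) 2).ker,
      π (x.1 : (𝓞 K ⧸ v.asIdeal ^ (2 * e + 1))) = 1 ∨ π (x.1 : (𝓞 K ⧸ v.asIdeal ^ (2 * e + 1))) = -1 := by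
    rintro ⟨x, hx⟩
    obtain ⟨c, hc⟩ := Ideal.Quotient.mk_surjective (x : 𝓞 K ⧸ v.asIdeal ^ (2 * e + 1))
    rw [MonoidHom.mem_ker, powMonoidHom_apply, Units.ext_iff] at hx
    push_cast at hx
    change π (x : 𝓞 K ⧸ v.asIdeal ^ (2 * e + 1)) = 1 ∨ π (x : 𝓞 K ⧸ v.asIdeal ^ (2 * e + 1)) = -1
    rw [← hc] at hx ⊢
    have h1 : (c ^ 2 - 1) ∈ v.asIdeal ^ (2 * e + 1) := by
      rw [← Ideal.Quotient.eq, map_pow, map_one]; exact hx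
    rw [← le_exp_iff] at h1
    push_cast at h1
    have h3 : v.valuation K ((c:K) - 1) < exp (-(e:ℤ)) ∨ v.valuation K ((c:K) + 1) < exp (-(e:ℤ)) := by
      by_contra hcon
      push Not at hcon
      have := mul_le_mul' hcon.1 hcon.2
      rw [← map_mul, show ((c:K) - 1) * (c + 1) = c ^ 2 - 1 by ring] at this
      have := this.trans h1
      rw [← exp_add, exp_le_exp] at this
      omega
    have lt_le : ∀ z : K, v.valuation K z < exp (-(e:ℤ)) → v.valuation K z ≤ exp (-((e+1:ℕ):ℤ)) := by
      intro z hz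
      by_cases h0 : v.valuation K z = 0
      · rw [h0]; exact zero_le
      · rw [← exp_log h0] at hz ⊢
        rw [exp_lt_exp] at hz
        rw [exp_le_exp]; push_cast; omega
    have hπ : π (Ideal.Quotient.mk _ c) = Ideal.Quotient.mk _ c := rfl
    rw [hπ]
    rcases h3 with h3 | h3
    · left
      have h4 : (c - 1) ∈ v.asIdeal ^ (e + 1) := by
        rw [← le_exp_iff]; push_cast; exact lt_le _ h3
      rw [← Ideal.Quotient.eq, map_one] at h4; exact h4
    · right
      have h4 : (c - (-1)) ∈ v.asIdeal ^ (e + 1) := by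
        rw [← le_exp_iff]; push_cast; rw [sub_neg_eq_add]; exact lt_le _ h3
      rw [← Ideal.Quotient.eq, map_neg, map_one] at h4; exact h4
  classical
  let f : (powMonoidHom (α := (𝓞 K ⧸ v.asIdeal ^ (2 * e + 1))ˣ) 2).ker → Bool × π.toAddMonoidHom.ker := fun x =>
    if h : π (x.1 : (𝓞 K ⧸ v.asIdeal ^ (2 * e + 1))) = 1 then
      (true, ⟨(x.1 : (𝓞 K ⧸ v.asIdeal ^ (2 * e + 1))) - 1, by
        rw [AddMonoidHom.mem_ker]; change π _ = 0; rw [map_sub, h, map_one, sub_self]⟩)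
    else (false, ⟨(x.1 : (𝓞 K ⧸ v.asIdeal ^ (2 * e + 1))) + 1, by
        rw [AddMonoidHom.mem_ker]; change π _ = 0; rw [map_add, (key x).resolve_left h, map_one, neg_add_cancel]⟩)
  have hf : Function.Injective f := by
    intro x y hxy
    simp only [f] at hxy
    apply Subtype.ext
    apply Units.ext
    split_ifs at hxy with h1 h2 h2
    · have := congrArg (fun z => (z.2 : (𝓞 K ⧸ v.asIdeal ^ (2 * e + 1)))) hxy
      simpa using this
    · simp at hxy
    · simp at hxy
    · have := congrArg (fun z => (z.2 : (𝓞 K ⧸ v.asIdeal ^ (2 * e + 1)))) hxy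
      simpa using this
  have := Nat.card_le_card_of_injective f hf
  rw [Nat.card_prod, hker] at this
  simpa using this

theorem LS_relIndex (v : Pl K) (e : ℕ) (he : v.valuation K (2 : K) = exp (-(e:ℤ))) :
    (LS v).relIndex (Vu v) ≠ 0 ∧ (LS v).relIndex (Vu v) ≤ 2 * Ideal.absNorm v.asIdeal ^ e := by
  have hfin : Finite (𝓞 K ⧸ v.asIdeal ^ (2 * e + 1)) :=
    Ring.HasFiniteQuotients.finiteQuotient (pow_ne_zero _ v.ne_bot)
  choose a ha using fun x : Vu v => approx v (x := ((x : Kˣ) : K)) (mem_Vu.mp x.2).le (2 * e + 1)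
  have hmk : ∀ (x : Vu v) (b : 𝓞 K), v.valuation K (((x : Kˣ) : K) - b) ≤ exp (-((2 * e + 1 : ℕ):ℤ)) ↔
      Ideal.Quotient.mk (v.asIdeal ^ (2 * e + 1)) (a x) = Ideal.Quotient.mk (v.asIdeal ^ (2 * e + 1)) b := by
    intro x b
    rw [Ideal.Quotient.eq, ← le_exp_iff]
    push_cast
    have hax := ha x
    push_cast at hax
    constructor
    · intro h
      have e1 : (a x : K) - b = - (((x : Kˣ) : K) - a x) + (((x : Kˣ) : K) - b) := by ring
      rw [e1]
      exact Valuation.map_add_le _ (by rwa [Valuation.map_neg]) h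
    · intro h
      have e1 : ((x : Kˣ) : K) - b = (((x : Kˣ) : K) - a x) + ((a x : K) - b) := by ring
      rw [e1]
      exact Valuation.map_add_le _ hax h
  let φ₀ : Vu v →* 𝓞 K ⧸ v.asIdeal ^ (2 * e + 1) :=
    { toFun := fun x => Ideal.Quotient.mk (v.asIdeal ^ (2 * e + 1)) (a x)
      map_one' := by
        rw [← map_one (Ideal.Quotient.mk (v.asIdeal ^ (2 * e + 1))), ← hmk]
        simp
      map_mul' := by
        intro x y
        rw [← map_mul, ← hmk]
        have e1 : (((x * y : Vu v) : Kˣ) : K) - ((a x * a y : 𝓞 K) : K) =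
          (((x : Kˣ) : K) - a x) * ((y : Kˣ) : K) + (((y : Kˣ) : K) - a y) * a x := by push_cast; ring
        rw [e1]
        apply Valuation.map_add_le
        · rw [map_mul, mem_Vu.mp y.2, mul_one]; exact ha x
        · rw [map_mul]
          calc _ ≤ exp (-((2 * e + 1 : ℕ):ℤ)) * 1 := mul_le_mul' (ha y) (valuation_le_one v _)
            _ = _ := mul_one _ }
  let φ := φ₀.toHomUnits
  have hle : (sqs (𝓞 K ⧸ v.asIdeal ^ (2 * e + 1))ˣ).comap φ ≤ (LS v).subgroupOf (Vu v) := by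
    rintro x ⟨g, hg⟩
    rw [Subgroup.mem_subgroupOf]
    obtain ⟨c, hc⟩ := Ideal.Quotient.mk_surjective (g : 𝓞 K ⧸ v.asIdeal ^ (2 * e + 1))
    have h1 : Ideal.Quotient.mk (v.asIdeal ^ (2 * e + 1)) (a x) = Ideal.Quotient.mk (v.asIdeal ^ (2 * e + 1)) (c ^ 2) := by
      have := congrArg Units.val hg
      rw [powMonoidHom_apply, Units.val_pow_eq_pow_val, ← hc, MonoidHom.coe_toHomUnits, ← map_pow] at this
      exact this.symm
    rw [← hmk] at h1
    push_cast at h1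
    have h4 : v.valuation K (4 : K) = exp (-(2 * e : ℤ)) := by
      rw [show (4 : K) = 2 * 2 by norm_num, map_mul, he, ← exp_add]; congr 1; ring
    have h14 : v.valuation K (((x : Kˣ) : K) - (c:K) ^ 2) < v.valuation K (4 : K) :=
      lt_of_le_of_lt h1 (by rw [h4, exp_lt_exp]; omega)
    have h11 : v.valuation K (((x : Kˣ) : K) - (c:K) ^ 2) < 1 :=
      lt_of_le_of_lt h1 (by rw [← exp_zero, exp_lt_exp]; omega)
    have hc1 : v.valuation K ((c:K) ^ 2) = 1 := by
      rw [← mem_Vu.mp x.2]; rw [← mem_Vu.mp x.2] at h11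
      exact Valuation.map_eq_of_sub_lt _ (by rwa [Valuation.map_sub_swap])
    have hc0 : (c:K) ≠ 0 := by intro h; rw [h] at hc1; simp at hc1
    have e2 : (x : Kˣ) = (Units.mk0 (c:K) hc0) ^ 2 * ((x : Kˣ) / (Units.mk0 (c:K) hc0) ^ 2) := by rw [mul_div_cancel]
    rw [e2]
    refine Subgroup.mul_mem_sup (S := sqs Kˣ) ⟨_, rfl⟩ ?_
    rw [mem_Cg]
    have e3 : (((x : Kˣ) / (Units.mk0 (c:K) hc0) ^ 2 : Kˣ) : K) - 1 = (((x : Kˣ) : K) - (c:K) ^ 2) / (c:K) ^ 2 := by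
      rw [Units.val_div_eq_div_val, Units.val_pow_eq_pow_val, Units.val_mk0]
      field_simp
    rw [e3, map_div₀, hc1, div_one]
    exact ⟨h11, h14⟩
  have hdvd : (LS v).relIndex (Vu v) ∣ Nat.card (powMonoidHom (α := (𝓞 K ⧸ v.asIdeal ^ (2 * e + 1))ˣ) 2).ker := by
    rw [← index_sq_finite]
    refine (Subgroup.index_dvd_of_le hle).trans ?_
    rw [Subgroup.index_comap]
    exact Subgroup.relIndex_dvd_index_of_normal _ _
  have hpos : 0 < Nat.card (powMonoidHom (α := (𝓞 K ⧸ v.asIdeal ^ (2 * e + 1))ˣ) 2).ker := Nat.card_pos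
  exact ⟨fun h => hpos.ne' (Nat.eq_zero_of_zero_dvd (h ▸ hdvd)), (Nat.le_of_dvd hpos hdvd).trans (card_tors_bound v e)⟩

/-- even valuation -/
theorem index_even (v : Pl K) : (Vu v ⊔ sqs Kˣ).index ≠ 0 ∧ (Vu v ⊔ sqs Kˣ).index ≤ 2 := by
  obtain ⟨π, hπ⟩ := exists_unif v
  have hlog : ∀ x : Kˣ, log (v.valuation K (x : K)) % 2 = 0 → x ∈ Vu v ⊔ sqs Kˣ := by
    intro x hx
    obtain ⟨n, hn⟩ := Int.dvd_of_emod_eq_zero hx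
    have hx0 : v.valuation K (x : K) ≠ 0 := (Valuation.ne_zero_iff _).mpr x.ne_zero
    have e : x = x / (π ^ (-n)) ^ 2 * (π ^ (-n)) ^ 2 := by rw [div_mul_cancel]
    rw [e]
    refine Subgroup.mul_mem_sup (T := sqs Kˣ) ?_ ⟨_, rfl⟩
    rw [mem_Vu, Units.val_div_eq_div_val, Units.val_pow_eq_pow_val, Units.val_zpow_eq_zpow_val, map_div₀, map_pow, map_zpow₀, hπ,
      ← exp_log hx0, hn, ← exp_zsmul, ← exp_nsmul, ← exp_sub, ← exp_zero]
    congr 1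
    simp
  have h2 : (Vu v ⊔ sqs Kˣ).index ≠ 0 ∧ (Vu v ⊔ sqs Kˣ).index ∣ 2 := by
    by_cases htop : (Vu v ⊔ sqs Kˣ) = ⊤
    · rw [htop]; simp
    have : (Vu v ⊔ sqs Kˣ).index = 2 := by
      rw [Subgroup.index_eq_two_iff]
      refine ⟨π, fun x => ?_⟩
      have hπn : π ∉ Vu v ⊔ sqs Kˣ := by
        intro hmem
        apply htop
        rw [eq_top_iff]
        intro x _
        rcases Int.emod_two_eq_zero_or_one (log (v.valuation K (x : K))) with h | h
        · exact hlog x h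
        · have : x * π ∈ Vu v ⊔ sqs Kˣ := by
            apply hlog
            have hx0 : v.valuation K (x : K) ≠ 0 := (Valuation.ne_zero_iff _).mpr x.ne_zero
            rw [Units.val_mul, map_mul, hπ, log_mul hx0 exp_ne_zero, log_exp]; omega
          exact (Subgroup.mul_mem_cancel_right _ hmem).mp this
      rcases Int.emod_two_eq_zero_or_one (log (v.valuation K (x : K))) with h | h
      · right
        refine ⟨hlog x h, fun h' => hπn ?_⟩
        exact (Subgroup.mul_mem_cancel_left _ (hlog x h)).mp h'
      · left
        have : x * π ∈ Vu v ⊔ sqs Kˣ := by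
          apply hlog
          have hx0 : v.valuation K (x : K) ≠ 0 := (Valuation.ne_zero_iff _).mpr x.ne_zero
          rw [Units.val_mul, map_mul, hπ, log_mul hx0 exp_ne_zero, log_exp]; omega
        refine ⟨this, fun h' => hπn ?_⟩
        exact (Subgroup.mul_mem_cancel_left _ h').mp this
    rw [this]; simp
  exact ⟨h2.1, Nat.le_of_dvd (by norm_num) h2.2⟩

theorem LS_index (v : Pl K) (e : ℕ) (he : v.valuation K (2 : K) = exp (-(e:ℤ))) :
    (LS v).index ≠ 0 ∧ (LS v).index ≤ 4 * Ideal.absNorm v.asIdeal ^ e := by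
  have h1 := Subgroup.relIndex_mul_index (H := LS v) (K := Vu v ⊔ LS v) le_sup_right
  rw [Subgroup.relIndex_sup_right] at h1
  have h2 : (Vu v ⊔ LS v).index ∣ (Vu v ⊔ sqs Kˣ).index :=
    Subgroup.index_dvd_of_le (sup_le_sup_left le_sup_left _)
  obtain ⟨h3, h4⟩ := index_even v
  obtain ⟨h5, h6⟩ := LS_relIndex v e he
  have h7 : (Vu v ⊔ LS v).index ≠ 0 := fun h => h3 (Nat.eq_zero_of_zero_dvd (h ▸ h2))
  have h8 := Nat.le_of_dvd (Nat.pos_of_ne_zero h3) h2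
  rw [← h1]
  refine ⟨mul_ne_zero h5 h7, ?_⟩
  calc _ ≤ (2 * Ideal.absNorm v.asIdeal ^ e) * 2 := Nat.mul_le_mul h6 (h8.trans h4)
    _ = _ := by ring

theorem index_inf_ne_zero {G : Type*} [Group G] {ι : Type*} (T : Finset ι) (f : ι → Subgroup G) (h : ∀ i ∈ T, (f i).index ≠ 0) :
    (⨅ i ∈ T, f i).index ≠ 0 ∧ (⨅ i ∈ T, f i).index ≤ ∏ i ∈ T, (f i).index := by
  classical
  induction T using Finset.induction_on with
  | empty => simp
  | insert v T hv ih =>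
    obtain ⟨h1, h2⟩ := ih (fun i hi => h i (Finset.mem_insert_of_mem hi))
    rw [Finset.iInf_insert, Finset.prod_insert hv]
    exact ⟨Subgroup.index_inf_ne_zero (h v (Finset.mem_insert_self _ _)) h1,
      Subgroup.index_inf_le.trans (Nat.mul_le_mul_left _ h2)⟩

theorem LS_index_all [IsTotallyComplex K] (S : Finset (Pl K)) :
    (⨅ v ∈ S, LS v).index ≠ 0 ∧ (⨅ v ∈ S, LS v).index ≤ 2 ^ (2 * (S.card + (Units.rank K + 1))) := by
  have h20 : (2 : 𝓞 K) ≠ 0 := two_ne_zero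
  choose e he using fun v : Pl K => exists_exp v h20
  have he' : ∀ v : Pl K, v.valuation K (2 : K) = exp (-(e v:ℤ)) := by
    intro v
    rw [← he v]; congr 1
  obtain ⟨h1, h2⟩ := index_inf_ne_zero S LS (fun v _ => (LS_index v (e v) (he' v)).1)
  refine ⟨h1, h2.trans ?_⟩
  calc _ ≤ ∏ v ∈ S, 4 * Ideal.absNorm v.asIdeal ^ (e v) := Finset.prod_le_prod' (fun v _ => (LS_index v (e v) (he' v)).2)
    _ = 4 ^ S.card * Ideal.absNorm (∏ v ∈ S, v.asIdeal ^ (e v)) := by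
        rw [Finset.prod_mul_distrib, Finset.prod_const, map_prod]; simp only [map_pow]
    _ ≤ 4 ^ S.card * 2 ^ (Module.finrank ℚ K) := by
        apply Nat.mul_le_mul_left
        rw [← RingOfIntegers.rank, ← Ideal.absNorm_span_natCast]
        apply Nat.le_of_dvd
        · rw [Ideal.absNorm_span_natCast]; positivity
        · apply Ideal.absNorm_dvd_absNorm_of_le
          apply Ideal.le_of_dvd
          apply Finset.prod_dvd_of_coprime
          · intro v _ w _ hvw
            change IsCoprime _ _
            apply IsCoprime.pow
            rw [Ideal.isCoprime_iff_sup_eq]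
            exact Ideal.IsMaximal.coprime_of_ne v.isMaximal w.isMaximal (fun h => hvw (HeightOneSpectrum.ext h))
          · intro v _
            rw [Ideal.dvd_span_singleton, ← le_exp_iff, ← he v]
            simp
    _ = _ := by rw [rank_tc, show 4 = 2 ^ 2 by norm_num, ← pow_mul, ← pow_add]; congr 1; ring

end
end DTO
end

section
namespace DTO
open IsDedekindDomain HeightOneSpectrum NumberField WithZero

section
open Filter Topology
variable {K : Type*} [Field K] [NumberField K]

noncomputable def wt (s : ℝ) (v : Pl K) : ENNReal := ENNReal.ofReal ((Ideal.absNorm v.asIdeal : ℝ) ^ (-s))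
noncomputable def Wt (s : ℝ) (m : Multiset (Pl K)) : ENNReal := (m.map (wt s)).prod
noncomputable def idl (m : Multiset (Pl K)) : Ideal (𝓞 K) := (m.map HeightOneSpectrum.asIdeal).prod
noncomputable def ZZ (K : Type*) [Field K] [NumberField K] (s : ℝ) : ENNReal := ∑' m : Multiset (Pl K), Wt s m

theorem Wt_eq (s : ℝ) (m : Multiset (Pl K)) : Wt s m = ENNReal.ofReal ((Ideal.absNorm (idl m) : ℝ) ^ (-s)) := by
  induction m using Multiset.induction with
  | empty => simp [Wt, idl]
  | cons a m ih =>
    unfold Wt idl at *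
    rw [Multiset.map_cons, Multiset.prod_cons, ih, Multiset.map_cons, Multiset.prod_cons, map_mul, wt,
      Nat.cast_mul, Real.mul_rpow (Nat.cast_nonneg _) (Nat.cast_nonneg _), ENNReal.ofReal_mul (by positivity)]

theorem idl_ne (m : Multiset (Pl K)) : idl m ≠ 0 := by
  unfold idl
  intro h
  rw [Multiset.prod_eq_zero_iff, Multiset.mem_map] at h
  obtain ⟨v, _, h⟩ := h
  exact v.ne_bot h

theorem idl_inj : Function.Injective (idl (K := K)) := by
  intro m m' h
  have h1 : ∀ m : Multiset (Pl K), UniqueFactorizationMonoid.normalizedFactors (idl m) = m.map asIdeal := by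
    intro m
    unfold idl
    apply UniqueFactorizationMonoid.normalizedFactors_prod_of_prime
    intro I hI
    rw [Multiset.mem_map] at hI
    obtain ⟨v, _, rfl⟩ := hI
    exact v.prime
  have h2 : m.map asIdeal = m'.map asIdeal := by rw [← h1, ← h1, h]
  exact Multiset.map_injective (fun v w h => HeightOneSpectrum.ext h) h2

theorem idl_surj (I : Ideal (𝓞 K)) (hI : I ≠ 0) : ∃ m, idl m = I := by
  induction I using UniqueFactorizationMonoid.induction_on_prime with
  | h₁ => exact absurd rfl hI
  | h₂ I h => exact ⟨0, by rw [Ideal.isUnit_iff.mp h, ← Ideal.one_eq_top]; simp [idl]⟩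
  | h₃ I p hI0 hp ih =>
    obtain ⟨m, rfl⟩ := ih hI0
    exact ⟨⟨p, Ideal.isPrime_of_prime hp, hp.ne_zero⟩ ::ₘ m, by simp [idl]⟩

theorem ZZ_eq (s : ℝ) : ZZ K s = ∑' n : ℕ, ENNReal.ofReal
    (if n = 0 then 0 else (Nat.card {I : Ideal (𝓞 K) // Ideal.absNorm I = n} : ℝ) * (n:ℝ) ^ (-s)) := by
  unfold ZZ
  rw [← (Equiv.sigmaFiberEquiv (fun m : Multiset (Pl K) => Ideal.absNorm (idl m))).tsum_eq, ENNReal.tsum_sigma']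
  congr 1
  ext n
  have h1 : ∀ b : {m : Multiset (Pl K) // Ideal.absNorm (idl m) = n}, 
      Wt s ((Equiv.sigmaFiberEquiv (fun m : Multiset (Pl K) => Ideal.absNorm (idl m))) ⟨n, b⟩) = 
        ENNReal.ofReal ((n:ℝ) ^ (-s)) := by
    rintro ⟨m, hm⟩
    simp only [Equiv.sigmaFiberEquiv_apply]
    rw [Wt_eq, hm]
  rw [tsum_congr h1, ENNReal.tsum_const]
  by_cases hn : n = 0
  · subst hn
    have : IsEmpty {m : Multiset (Pl K) // Ideal.absNorm (idl m) = 0} := by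
      constructor
      rintro ⟨m, hm⟩
      rw [Ideal.absNorm_eq_zero_iff] at hm
      exact idl_ne m hm
    rw [ENat.card_eq_zero_iff_empty _ |>.mpr this]
    simp
  · rw [if_neg hn]
    let e : {m : Multiset (Pl K) // Ideal.absNorm (idl m) = n} ≃ {I : Ideal (𝓞 K) // Ideal.absNorm I = n} := 
      Equiv.ofBijective (fun m => ⟨idl m.1, m.2⟩) ⟨by
        rintro ⟨m, hm⟩ ⟨m', hm'⟩ h
        simp only [Subtype.mk.injEq] at h
        exact Subtype.ext (idl_inj h), by
        rintro ⟨I, hI⟩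
        obtain ⟨m, rfl⟩ := idl_surj I (by rintro rfl; apply hn; rw [← hI]; simp)
        exact ⟨⟨m, hI⟩, rfl⟩⟩
    have hf : Finite {I : Ideal (𝓞 K) // Ideal.absNorm I = n} := Ideal.finite_setOfPred_absNorm_eq n
    rw [ENat.card_congr e, ENat.card_eq_coe_natCard, ENNReal.ofReal_mul (Nat.cast_nonneg _), ENNReal.ofReal_natCast]
    simp

theorem ZZ_tend : (∀ᶠ s in 𝓝[>] (1:ℝ), ZZ K s ≠ ⊤) ∧ 
    Tendsto (fun s : ℝ => (s - 1) * (ZZ K s).toReal) (𝓝[>] 1) (𝓝 (dedekindZeta_residue K)) := by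
  have ht := NumberField.tendsto_sub_one_mul_dedekindZeta_nhdsGT K
  have hne : ∀ᶠ s : ℝ in 𝓝[>] (1:ℝ), dedekindZeta K s ≠ 0 := by
    have := ht.eventually_ne (Complex.ofReal_ne_zero.mpr (dedekindZeta_residue_ne_zero K))
    filter_upwards [this] with s hs h
    rw [h, mul_zero] at hs
    exact hs rfl
  have key : ∀ s : ℝ, dedekindZeta K s ≠ 0 → ZZ K s ≠ ⊤ ∧ dedekindZeta K s = ((ZZ K s).toReal : ℂ) := by
    intro s hs
    unfold dedekindZeta LSeries at hs ⊢
    have hsum := not_imp_comm.mp (tsum_eq_zero_of_not_summable) hs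
    have hterm : ∀ n, LSeries.term (fun n ↦ (Nat.card {I : Ideal (𝓞 K) // Ideal.absNorm I = n} : ℂ)) s n = 
      (((if n = 0 then 0 else (Nat.card {I : Ideal (𝓞 K) // Ideal.absNorm I = n} : ℝ) * (n:ℝ) ^ (-s)) : ℝ) : ℂ) := by
      intro n
      rw [LSeries.term_def]
      split_ifs with h
      · simp
      · rw [Real.rpow_neg (Nat.cast_nonneg _)]
        push_cast
        rw [Complex.ofReal_cpow (Nat.cast_nonneg _)]
        simp [div_eq_mul_inv]
    have hpos : ∀ n : ℕ, 0 ≤ (if n = 0 then 0 else (Nat.card {I : Ideal (𝓞 K) // Ideal.absNorm I = n} : ℝ) * (n:ℝ) ^ (-s)) := by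
      intro n; split_ifs <;> positivity
    rw [summable_congr hterm, Complex.summable_ofReal] at hsum
    rw [tsum_congr hterm, ← Complex.ofReal_tsum, ZZ_eq, ← ENNReal.ofReal_tsum_of_nonneg hpos hsum]
    exact ⟨ENNReal.ofReal_ne_top, by rw [ENNReal.toReal_ofReal (tsum_nonneg hpos)]⟩
  refine ⟨hne.mono fun s hs => (key s hs).1, ?_⟩
  have h2 : Tendsto (fun s : ℝ => (((s - 1) * (ZZ K s).toReal : ℝ) : ℂ)) (𝓝[>] 1) (𝓝 (dedekindZeta_residue K)) := by
    refine ht.congr' ?_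
    filter_upwards [hne] with s hs
    rw [(key s hs).2]; push_cast; ring
  exact tendsto_ofReal_iff.mp h2
end
end DTO
end

section
namespace DTO
open IsDedekindDomain HeightOneSpectrum NumberField WithZero

section
variable {K M : Type*} [Field K] [NumberField K] [Field M] [NumberField M] [Algebra K M]

theorem Quad.finrank_le {b : K} (Q : Quad K M b) : Module.finrank K M ≤ 2 := by
  have h : Submodule.span K (Set.range ![(1:M), Q.ω]) = ⊤ := by
    rw [eq_top_iff]
    intro x _
    obtain ⟨α, β, rfl⟩ := Q.rep x
    apply Submodule.add_mem
    · rw [Algebra.algebraMap_eq_smul_one]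
      exact Submodule.smul_mem _ _ (Submodule.subset_span ⟨0, rfl⟩)
    · rw [← Algebra.smul_def]
      exact Submodule.smul_mem _ _ (Submodule.subset_span ⟨1, rfl⟩)
  have := finrank_le_of_span_eq_top h
  simpa using this

theorem absNorm_pos (v : Pl K) : 2 ≤ Ideal.absNorm v.asIdeal := by
  have h0 : Ideal.absNorm v.asIdeal ≠ 0 := by
    rw [Ne, Ideal.absNorm_eq_zero_iff]; exact v.ne_bot
  have h1 : Ideal.absNorm v.asIdeal ≠ 1 := by
    rw [Ne, Ideal.absNorm_eq_one_iff]; exact v.isPrime.ne_top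
  omega

theorem norm_two {b : K} (Q : Quad K M b) {w w' : Pl M} (hne : w ≠ w') (h : dn K w = dn K w') :
    Ideal.absNorm w.asIdeal ≤ Ideal.absNorm (dn K w).asIdeal := by
  have l1 : w.asIdeal.LiesOver (dn K w).asIdeal := ⟨rfl⟩
  have l2 : w'.asIdeal.LiesOver (dn K w).asIdeal := ⟨by rw [h]; rfl⟩
  have hle : ∀ u : Pl M, u.asIdeal.LiesOver (dn K w).asIdeal → 
      (dn K w).asIdeal.map (algebraMap (𝓞 K) (𝓞 M)) ≤ u.asIdeal := by
    intro u hu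
    rw [Ideal.map_le_iff_le_comap]
    exact hu.over.le
  have hcop : IsCoprime w.asIdeal w'.asIdeal := by
    rw [Ideal.isCoprime_iff_sup_eq]
    exact w.isMaximal.coprime_of_ne w'.isMaximal (fun h => hne (HeightOneSpectrum.ext h))
  have hd : w.asIdeal * w'.asIdeal ∣ (dn K w).asIdeal.map (algebraMap (𝓞 K) (𝓞 M)) := 
    hcop.mul_dvd (Ideal.dvd_iff_le.mpr (hle w l1)) (Ideal.dvd_iff_le.mpr (hle w' l2))
  have h1 := Ideal.absNorm_dvd_absNorm_of_le (Ideal.dvd_iff_le.mp hd)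
  rw [Ideal.absNorm_algebraMap, map_mul] at h1
  have hfr : Module.finrank (𝓞 K) (𝓞 M) ≤ 2 := by
    rw [← IsFractionRing.finrank_eq (𝓞 K) K (𝓞 M) M]
    exact Q.finrank_le
  have hp := absNorm_pos (dn K w)
  have h2 : Ideal.absNorm (dn K w).asIdeal ≤ Ideal.absNorm w'.asIdeal := by
    have := Ideal.absNorm_pow_inertiaDeg (dn K w).asIdeal w'.asIdeal
    rw [← this]
    exact Nat.le_self_pow (Ideal.inertiaDeg_pos _ _).ne' _
  have h3 := Nat.le_of_dvd (by positivity) h1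
  have h4 := Nat.pow_le_pow_right (n := Ideal.absNorm (dn K w).asIdeal) (by omega) hfr
  have h5 := Nat.mul_le_mul_left (Ideal.absNorm w.asIdeal) h2
  have h6 : Ideal.absNorm w.asIdeal * Ideal.absNorm (dn K w).asIdeal ≤ Ideal.absNorm (dn K w).asIdeal * Ideal.absNorm (dn K w).asIdeal := by
    rw [← pow_two]; omega
  exact Nat.le_of_mul_le_mul_right h6 (by omega)

noncomputable def GG (B : Finset (Pl K)) (s : ℝ) : ENNReal :=
  ∑' m : {m : Multiset (Pl K) // ∀ v ∈ m, v ∉ B}, Wt s m.1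

theorem wt_le (v : Pl K) {s : ℝ} (hs : 1 ≤ s) : wt s v ≤ 2⁻¹ := by
  unfold wt
  have h := absNorm_pos v
  have h' : (2:ℝ) ≤ Ideal.absNorm v.asIdeal := by exact_mod_cast h
  have : ((Ideal.absNorm v.asIdeal : ℝ) ^ (-s)) ≤ 2⁻¹ := by
    rw [Real.rpow_neg (by positivity)]
    apply inv_anti₀ (by norm_num)
    calc (2:ℝ) ≤ Ideal.absNorm v.asIdeal := h'
      _ = (Ideal.absNorm v.asIdeal : ℝ) ^ (1:ℝ) := (Real.rpow_one _).symm
      _ ≤ _ := Real.rpow_le_rpow_of_exponent_le (by linarith) hs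
  calc _ ≤ ENNReal.ofReal (2⁻¹) := ENNReal.ofReal_le_ofReal this
    _ = _ := by rw [ENNReal.ofReal_inv_of_pos (by norm_num)]; simp

open Classical in
theorem GG_insert (B : Finset (Pl K)) (p : Pl K) {s : ℝ} (hs : 1 ≤ s) : GG B s ≤ 2 * GG (insert p B) s := by
  let φ : {m : Multiset (Pl K) // ∀ v ∈ m, v ∉ B} → ℕ × {m : Multiset (Pl K) // ∀ v ∈ m, v ∉ insert p B} :=
    fun m => (m.1.count p, ⟨m.1.filter (· ≠ p), by
      intro v hv
      rw [Multiset.mem_filter] at hv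
      rw [Finset.mem_insert, not_or]
      exact ⟨hv.2, m.2 v hv.1⟩⟩)
  have hrec : ∀ m : Multiset (Pl K), m = Multiset.replicate (m.count p) p + m.filter (· ≠ p) := by
    intro m
    rw [← Multiset.filter_eq', Multiset.filter_add_not]
  have hφ : Function.Injective φ := by
    rintro ⟨m, hm⟩ ⟨m', hm'⟩ h
    simp only [φ, Prod.mk.injEq, Subtype.mk.injEq] at h
    apply Subtype.ext
    change m = m'
    rw [hrec m, hrec m', h.1, h.2]
  have hW : ∀ m, Wt s m.1 = (fun x : ℕ × {m : Multiset (Pl K) // ∀ v ∈ m, v ∉ insert p B} => wt s p ^ x.1 * Wt s x.2.1) (φ m) := by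
    rintro ⟨m, hm⟩
    simp only [φ]
    conv_lhs => rw [hrec m]
    simp [Wt]
  unfold GG
  rw [tsum_congr hW]
  refine (ENNReal.tsum_comp_le_tsum_of_injective hφ (fun x : ℕ × {m : Multiset (Pl K) // ∀ v ∈ m, v ∉ insert p B} => wt s p ^ x.1 * Wt s x.2.1)).trans ?_
  rw [ENNReal.tsum_prod']
  simp only [ENNReal.tsum_mul_left, ENNReal.tsum_mul_right]
  gcongr
  rw [ENNReal.tsum_geometric]
  rw [ENNReal.inv_le_iff_inv_le]
  have := wt_le p hs
  calc (2:ENNReal)⁻¹ = 1 - 2⁻¹ := by rw [ENNReal.one_sub_inv_two]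
    _ ≤ _ := tsub_le_tsub_left this 1

theorem ZZ_le_GG (B : Finset (Pl K)) {s : ℝ} (hs : 1 ≤ s) : ZZ K s ≤ 2 ^ B.card * GG B s := by
  classical
  induction B using Finset.induction_on with
  | empty =>
    unfold ZZ GG
    simp only [Finset.card_empty, pow_zero, one_mul]
    rw [← (Equiv.subtypeUnivEquiv (p := fun m : Multiset (Pl K) => ∀ v ∈ m, v ∉ (∅ : Finset (Pl K))) (by simp)).tsum_eq]
    exact le_rfl
  | insert p B hp ih =>
    rw [Finset.card_insert_of_notMem hp, pow_succ, mul_assoc]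
    exact ih.trans (by gcongr; exact GG_insert B p hs)

open Classical in
theorem GG_sq (B : Finset (Pl K)) (w₁ w₂ : Pl K → Pl M) (h₁ : ∀ v, dn K (w₁ v) = v) (h₂ : ∀ v, dn K (w₂ v) = v)
    (hne : ∀ v ∉ B, w₁ v ≠ w₂ v) (n₁ : ∀ v ∉ B, Ideal.absNorm (w₁ v).asIdeal ≤ Ideal.absNorm v.asIdeal)
    (n₂ : ∀ v ∉ B, Ideal.absNorm (w₂ v).asIdeal ≤ Ideal.absNorm v.asIdeal) {s : ℝ} (hs : 1 ≤ s) :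
    GG B s * GG B s ≤ ZZ M s := by
  let φ : {m : Multiset (Pl K) // ∀ v ∈ m, v ∉ B} × {m : Multiset (Pl K) // ∀ v ∈ m, v ∉ B} → Multiset (Pl M) :=
    fun x => x.1.1.map w₁ + x.2.1.map w₂
  have i₁ : Function.Injective w₁ := fun a b h => by rw [← h₁ a, h, h₁]
  have i₂ : Function.Injective w₂ := fun a b h => by rw [← h₂ a, h, h₂]
  have hB : ∀ v w, w₁ v = w₂ w → v ∈ B := by
    intro v w h
    by_contra hv
    have : v = w := by rw [← h₁ v, h, h₂]
    subst this
    exact hne v hv h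
  have hφ : Function.Injective φ := by
    rintro ⟨⟨a, ha⟩, ⟨b, hb⟩⟩ ⟨⟨c, hc⟩, ⟨d, hd⟩⟩ h
    simp only [φ] at h
    have c1 : ∀ (m : Multiset (Pl K)) v, v ∉ B → (m.map w₂).count (w₁ v) = 0 := by
      intro m v hv
      rw [Multiset.count_eq_zero, Multiset.mem_map]
      rintro ⟨w, _, hw⟩
      exact hv (hB v w hw.symm)
    have c2 : ∀ (m : Multiset (Pl K)) v, v ∉ B → (m.map w₁).count (w₂ v) = 0 := by
      intro m v hv
      rw [Multiset.count_eq_zero, Multiset.mem_map]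
      rintro ⟨w, _, hw⟩
      have : w = v := by rw [← h₁ w, hw, h₂]
      subst this
      exact hv (hB _ _ hw)
    have e1 : a = c := by
      ext v
      by_cases hv : v ∈ B
      · rw [Multiset.count_eq_zero.mpr (fun h => ha v h hv), Multiset.count_eq_zero.mpr (fun h => hc v h hv)]
      · have := congrArg (Multiset.count (w₁ v)) h
        rwa [Multiset.count_add, Multiset.count_add, c1 _ v hv, c1 _ v hv, Multiset.count_map_eq_count' _ _ i₁,
          Multiset.count_map_eq_count' _ _ i₁, add_zero, add_zero] at this
    have e2 : b = d := by
      ext v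
      by_cases hv : v ∈ B
      · rw [Multiset.count_eq_zero.mpr (fun h => hb v h hv), Multiset.count_eq_zero.mpr (fun h => hd v h hv)]
      · have := congrArg (Multiset.count (w₂ v)) h
        rwa [Multiset.count_add, Multiset.count_add, c2 _ v hv, c2 _ v hv, Multiset.count_map_eq_count' _ _ i₂,
          Multiset.count_map_eq_count' _ _ i₂, zero_add, zero_add] at this
    subst e1; subst e2; rfl
  have hw : ∀ (w : Pl K → Pl M), (∀ v ∉ B, Ideal.absNorm (w v).asIdeal ≤ Ideal.absNorm v.asIdeal) →
      ∀ m : Multiset (Pl K), (∀ v ∈ m, v ∉ B) → Wt s m ≤ Wt s (m.map w) := by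
    intro w hw m hm
    induction m using Multiset.induction with
    | empty => simp [Wt]
    | cons a m ih =>
      have h1 := ih (fun v hv => hm v (Multiset.mem_cons_of_mem hv))
      unfold Wt at h1 ⊢
      simp only [Multiset.map_cons, Multiset.prod_cons]
      refine mul_le_mul' ?_ h1
      unfold wt
      apply ENNReal.ofReal_le_ofReal
      have h3 := absNorm_pos (w a)
      exact Real.rpow_le_rpow_of_nonpos (by positivity) (by exact_mod_cast hw a (hm a (Multiset.mem_cons_self _ _))) (by linarith)
  calc GG B s * GG B s = ∑' x : {m : Multiset (Pl K) // ∀ v ∈ m, v ∉ B} × {m : Multiset (Pl K) // ∀ v ∈ m, v ∉ B}, Wt s x.1.1 * Wt s x.2.1 := by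
        unfold GG
        rw [ENNReal.tsum_prod']
        simp only [ENNReal.tsum_mul_left, ENNReal.tsum_mul_right]
    _ ≤ ∑' x, Wt s (φ x) := by
        apply ENNReal.tsum_le_tsum
        rintro ⟨⟨a, ha⟩, ⟨b, hb⟩⟩
        have : Wt s (a.map w₁ + b.map w₂) = Wt s (a.map w₁) * Wt s (b.map w₂) := by
          simp [Wt]
        simp only [φ]
        rw [this]
        exact mul_le_mul' (hw w₁ n₁ a ha) (hw w₂ n₂ b hb)
    _ ≤ _ := ENNReal.tsum_comp_le_tsum_of_injective hφ _
end

section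
open Filter Topology
universe u
variable {K : Type u} [Field K] [NumberField K]

theorem exists_nonsplit {b : K} (hb : ¬ IsSquare b) (B : Finset (Pl K)) : ∃ q ∉ B, ¬ Split q b := by
  by_contra! hall
  obtain ⟨M, _, _, _, ⟨Q⟩⟩ := exists_quad b hb
  have hex : ∀ v : Pl K, ∃ w : Pl M × Pl M, dn K w.1 = v ∧ dn K w.2 = v ∧ (v ∉ B → w.1 ≠ w.2) := by
    intro v
    by_cases hv : v ∈ B
    · obtain ⟨w, hw⟩ := dn_surj (M := M) v
      exact ⟨(w, w), hw, hw, fun h => absurd hv h⟩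
    · obtain ⟨w, w', hne, h1, h2⟩ := Split.two Q (hall v hv)
      exact ⟨(w, w'), h1, h2, fun _ => hne⟩
  choose w h1 h2 hne using hex
  have key : ∀ s : ℝ, 1 ≤ s → ZZ K s * ZZ K s ≤ 2 ^ B.card * 2 ^ B.card * ZZ M s := by
    intro s hs
    have hG := GG_sq B (fun v => (w v).1) (fun v => (w v).2) h1 h2 hne (fun v hv => by
      have := norm_two Q (hne v hv) ((h1 v).trans (h2 v).symm)
      rwa [h1] at this) (fun v hv => by
      have := norm_two Q (hne v hv).symm ((h2 v).trans (h1 v).symm)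
      rwa [h2] at this) hs
    calc _ ≤ (2 ^ B.card * GG B s) * (2 ^ B.card * GG B s) := mul_le_mul' (ZZ_le_GG B hs) (ZZ_le_GG B hs)
      _ = 2 ^ B.card * 2 ^ B.card * (GG B s * GG B s) := by ring
      _ ≤ _ := by gcongr
  obtain ⟨f1, t1⟩ := ZZ_tend (K := K)
  obtain ⟨f2, t2⟩ := ZZ_tend (K := M)
  have t0 : Tendsto (fun s : ℝ => s - 1) (𝓝[>] 1) (𝓝 0) := by
    have : Tendsto (fun s : ℝ => s - 1) (𝓝 1) (𝓝 (1 - 1)) := (continuous_id.sub continuous_const).tendsto 1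
    rw [sub_self] at this
    exact this.mono_left nhdsWithin_le_nhds
  have hlim := le_of_tendsto_of_tendsto (t1.mul t1) ((t0.const_mul (2 ^ B.card * 2 ^ B.card)).mul t2) (by
    filter_upwards [f1, f2, self_mem_nhdsWithin] with s g1 g2 hs
    have hs' : 1 ≤ s := (Set.mem_Ioi.mp hs).le
    have h := ENNReal.toReal_mono (by finiteness) (key s hs')
    simp only [ENNReal.toReal_mul, ENNReal.toReal_pow, ENNReal.toReal_ofNat] at h
    have := mul_le_mul_of_nonneg_left h (mul_self_nonneg (s - 1))
    nlinarith [this])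
  have := dedekindZeta_residue_pos K
  rw [mul_zero, zero_mul] at hlim
  nlinarith

/-- Lemma P -/
theorem lemmaP {u : Kˣ} (hu : ¬ IsSquare (u : K)) (B : Finset (Pl K)) : ∃ q ∉ B, u ∉ LS q := by
  obtain ⟨q, hq, h⟩ := exists_nonsplit hu B
  exact ⟨q, hq, fun h' => h (Split_of_LS h')⟩
end
end DTO
end

section
namespace DTO
open IsDedekindDomain HeightOneSpectrum NumberField WithZero

section
variable {K M : Type*} [Field K] [NumberField K] [Field M] [NumberField M] [Algebra K M]

theorem LS_up (w : Pl M) {x : Kˣ} (hx : x ∈ LS (dn K w)) : Units.map (algebraMap K M : K →* M) x ∈ LS w := by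
  obtain ⟨e, he, hv⟩ := dn_val (K := K) w
  have hle : LS (dn K w) ≤ (LS w).comap (Units.map (algebraMap K M : K →* M)) := by
    apply sup_le
    · intro y hy
      rw [mem_sqs] at hy
      rw [Subgroup.mem_comap]
      apply (le_sup_left : sqs Mˣ ≤ LS w)
      rw [mem_sqs]
      obtain ⟨z, rfl⟩ := hy
      exact ⟨Units.map (algebraMap K M : K →* M) z, by rw [map_pow]⟩
    · intro y hy
      rw [Subgroup.mem_comap]
      apply (le_sup_right : Cg w _ ≤ LS w)
      rw [mem_Cg] at hy ⊢
      simp only [Units.val_mk0, Units.coe_map, MonoidHom.coe_coe] at hy ⊢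
      have e1 : algebraMap K M y - 1 = algebraMap K M (y - 1) := by simp
      have e2 : (4 : M) = algebraMap K M 4 := (map_ofNat _ 4).symm
      rw [e1, e2, hv, hv]
      exact ⟨pow_lt_one_iff he |>.mpr hy.1, pow_lt_pow_left₀ hy.2 (zero_le) he⟩
  exact hle hx

theorem LS_mul {q : Pl K} (h2 : q.valuation K (2:K) = 1) {x y : Kˣ} (hx : x ∈ Vu q) (hy : y ∈ Vu q) 
    (hx' : x ∉ LS q) (hy' : y ∉ LS q) : x * y ∈ LS q := by
  have h := LS_relIndex q 0 (by simpa using h2)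
  rw [pow_zero, mul_one] at h
  have hd : (LS q).relIndex (Vu q) ∣ 2 := by
    have : (LS q).relIndex (Vu q) = 1 ∨ (LS q).relIndex (Vu q) = 2 := by omega
    rcases this with h | h <;> simp [h]
  rw [Subgroup.relIndex_dvd_two_iff] at hd
  obtain ⟨a, ha, hab⟩ := hd
  have h1 := (hab x hx).resolve_right hx'
  have h2 := (hab y hy).resolve_right hy'
  have h3 : a ^ 2 ∈ LS q := (le_sup_left : sqs Kˣ ≤ LS q) (by rw [mem_sqs]; exact ⟨a, rfl⟩)
  have : x * y = (x * a) * (y * a) * (a ^ 2)⁻¹ := by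
    rw [pow_two, mul_mul_mul_comm, mul_inv_cancel_right]
  rw [this]
  exact mul_mem (mul_mem h1 h2) (inv_mem h3)

theorem relIndex_fin {G : Type*} [CommGroup G] {ι : Type*} (T : Finset ι) (f : ι → Subgroup G) (H : Subgroup G)
    (h : ∀ i ∈ T, (f i).relIndex H ≠ 0 ∧ (f i).relIndex H ≤ 2) :
    (⨅ i ∈ T, f i).relIndex H ≠ 0 ∧ (⨅ i ∈ T, f i).relIndex H ≤ 2 ^ T.card := by
  classical
  induction T using Finset.induction_on with
  | empty => simp
  | insert a T ha ih =>
    have h1 := h a (Finset.mem_insert_self _ _)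
    have h2 := ih (fun i hi => h i (Finset.mem_insert_of_mem hi))
    rw [Finset.iInf_insert, Finset.card_insert_of_notMem ha, pow_succ']
    exact ⟨Subgroup.relIndex_inf_ne_zero h1.1 h2.1,
      Subgroup.relIndex_inf_le.trans (Nat.mul_le_mul h1.2 h2.2)⟩

theorem US_le_Vu {S : Finset (Pl K)} {v : Pl K} (hv : v ∉ S) : US K S ≤ Vu v := by
  intro x hx
  exact hx v (by simpa using hv)

theorem US_mem {S : Finset (Pl K)} {x : Kˣ} : x ∈ US K S ↔ ∀ v ∉ S, v.valuation K (x:K) = 1 := by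
  constructor
  · intro h v hv; exact h v (by simpa using hv)
  · intro h v hv; exact h v (by simpa using hv)

theorem US_sqrt {S : Finset (Pl K)} {x : Kˣ} (h : x ^ 2 ∈ US K S) : x ∈ US K S := by
  rw [US_mem] at h ⊢
  intro v hv
  have := h v hv
  rw [Units.val_pow_eq_pow_val, map_pow, pow_eq_one_iff, or_iff_left two_ne_zero] at this
  exact this

theorem relIndex_sq' {A : Type*} [CommGroup A] (H : Subgroup A) [Group.FG H] :
    (H.map (powMonoidHom 2)).relIndex H = 2 ^ Module.finrank ℤ (Additive H) * Nat.card (powMonoidHom (α := H) 2).ker := by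
  rw [← index_sq, Subgroup.relIndex]
  congr 1
  ext x
  rw [Subgroup.mem_subgroupOf, Subgroup.mem_map, MonoidHom.mem_range]
  constructor
  · rintro ⟨y, hy, h⟩
    exact ⟨⟨y, hy⟩, Subtype.ext h⟩
  · rintro ⟨y, rfl⟩
    exact ⟨y.1, y.2, rfl⟩

theorem US_index [IsTotallyComplex K] (S : Finset (Pl K)) :
    ((US K S).map (powMonoidHom 2)).relIndex (US K S) = 2 ^ (S.card + (Units.rank K + 1)) := by
  have hm : (-1 : Kˣ) ∈ US K S := by
    rw [US_mem]; intro v _; simp [Valuation.map_neg]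
  rw [relIndex_sq', US_rank, card_tors (US K S).subtype Subtype.val_injective ⟨-1, hm⟩ rfl]
  ring

theorem US_map_le (S : Finset (Pl K)) : (US K S).map (powMonoidHom 2) ≤ US K S := by
  rintro _ ⟨x, hx, rfl⟩
  exact pow_mem hx 2

theorem nonsq_L {b : K} (Q : Quad K M b) (hb : ¬ IsSquare b) {u : K} (hu : ¬ IsSquare u) (hbu : ¬ IsSquare (b * u)) :
    ¬ IsSquare (algebraMap K M u) := by
  rintro ⟨x, hx⟩
  obtain ⟨α, β, rfl⟩ := Q.rep x
  have h2 : algebraMap K M u = algebraMap K M (α ^ 2 + b * β ^ 2) + algebraMap K M (2 * α * β) * Q.ω := by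
    rw [hx]
    simp only [map_add, map_mul, map_pow, map_ofNat, ← Q.sq]
    ring
  have inj := (algebraMap K M).injective
  have h0 : 2 * α * β = 0 := by
    by_contra h
    apply hb
    refine ⟨(u - (α ^ 2 + b * β ^ 2)) / (2 * α * β), ?_⟩
    have hne : algebraMap K M (2 * α * β) ≠ 0 := by rwa [Ne, map_eq_zero_iff _ inj]
    have h3 : Q.ω = algebraMap K M ((u - (α ^ 2 + b * β ^ 2)) / (2 * α * β)) := by
      rw [map_div₀, map_sub, h2, add_sub_cancel_left, mul_div_cancel_left₀ _ hne]
    apply inj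
    rw [map_mul, ← h3, ← Q.sq, pow_two]
  rw [h0, map_zero, zero_mul, add_zero] at h2
  have h3 := inj h2
  have h4 : α = 0 ∨ β = 0 := by simpa using h0
  rcases h4 with rfl | rfl
  · exact hbu ⟨b * β, by rw [h3]; ring⟩
  · exact hu ⟨α, by rw [h3]; ring⟩
end

section
universe u
variable {K : Type u} [Field K] [NumberField K]

theorem stepQ [IsTotallyComplex K] (D : Kˣ) (hD : ¬ IsSquare (D : K)) (S : Finset (Pl K))
    (h2 : ∀ v ∉ S, v.valuation K (2:K) = 1) (hDS : D ∈ US K S) (n : ℕ) (hn : n + 1 ≤ S.card + (Units.rank K + 1)) :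
    ∃ Q : Finset (Pl K), Q.card = n ∧ (∀ q ∈ Q, q ∉ S ∧ D ∈ LS q) ∧
      ∀ x : Kˣ, (∀ q ∈ Q, x ∈ Vu q) → ∃ u ∈ US K S, ∀ q ∈ Q, x * u ∈ LS q := by
  classical
  induction n with
  | zero => exact ⟨∅, rfl, by simp, fun x _ => ⟨1, one_mem _, by simp⟩⟩
  | succ n ih =>
    obtain ⟨Q, hQn, hQ, hx⟩ := ih (by omega)
    let U := US K S
    let U2 := U.map (powMonoidHom 2)
    let Ker := U ⊓ ⨅ q ∈ Q, LS q
    have hKer : Ker.relIndex U ≠ 0 ∧ Ker.relIndex U ≤ 2 ^ n := by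
      have e : Ker.relIndex U = (⨅ q ∈ Q, LS q).relIndex U := by
        change (U ⊓ ⨅ q ∈ Q, LS q).relIndex U = _
        rw [inf_comm, Subgroup.inf_relIndex_right]
      rw [e, ← hQn]
      apply relIndex_fin
      intro q hq
      have h1 := LS_relIndex q 0 (by simpa using h2 q (hQ q hq).1)
      rw [pow_zero, mul_one] at h1
      have hle : U ≤ Vu q := US_le_Vu (hQ q hq).1
      have hd := Subgroup.relIndex_le_of_le_right hle h1.1
      exact ⟨fun h => h1.1 (Subgroup.relIndex_eq_zero_of_le_right hle h), hd.trans h1.2⟩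
    have hsqLS : ∀ q (x : Kˣ), x ^ 2 ∈ LS q := fun q x => (le_sup_left : sqs Kˣ ≤ LS q) (by rw [mem_sqs]; exact ⟨x, rfl⟩)
    have hU2K : U2 ≤ Ker := by
      rintro _ ⟨x, hx, rfl⟩
      refine Subgroup.mem_inf.mpr ⟨pow_mem hx 2, ?_⟩
      simp only [Subgroup.mem_iInf]
      intro q _
      exact hsqLS q x
    have hex : ∃ u ∈ Ker, u ∉ U2 ∧ u * D ∉ U2 := by
      by_contra! hcon
      have hd : U2.relIndex Ker ≤ 2 := by
        by_cases hD' : D ∈ Ker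
        · apply Nat.le_of_dvd two_pos
          rw [Subgroup.relIndex_dvd_two_iff]
          refine ⟨D, hD', fun b hb => ?_⟩
          by_cases h : b ∈ U2
          · exact Or.inr h
          · exact Or.inl (hcon b hb h)
        · have : Ker ≤ U2 := by
            intro b hb
            by_contra h
            have := hU2K (hcon b hb h)
            exact hD' ((Subgroup.mul_mem_cancel_left _ hb).mp this)
          rw [Subgroup.relIndex_eq_one.mpr this]; norm_num
      have h3 := Subgroup.relIndex_mul_relIndex U2 Ker U hU2K inf_le_left
      rw [US_index] at h3
      have h4 : 2 ^ (n + 2) ≤ 2 ^ (S.card + (Units.rank K + 1)) := Nat.pow_le_pow_right two_pos (by omega)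
      rw [← h3] at h4
      have h5 := h4.trans (Nat.mul_le_mul hd hKer.2)
      have : 0 < 2 ^ n := by positivity
      rw [pow_add] at h5
      omega
    obtain ⟨u, huK, hu1, hu2⟩ := hex
    have hsq : ∀ x : Kˣ, x ∈ U → x ∉ U2 → ¬ IsSquare (x : K) := by
      rintro x hxU hx2 ⟨y, hy⟩
      have hy0 : y ≠ 0 := by rintro rfl; simp at hy
      have e : x = (Units.mk0 y hy0) ^ 2 := Units.ext (by simp [hy, pow_two])
      apply hx2
      refine ⟨Units.mk0 y hy0, ?_, e.symm⟩
      exact US_sqrt (by rw [← e]; exact hxU)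
    have huns := hsq u huK.1 hu1
    have huD := hsq (u * D) (mul_mem huK.1 hDS) hu2
    obtain ⟨L, _, _, _, ⟨QQ⟩⟩ := exists_quad (D : K) hD
    have huL := nonsq_L QQ hD huns (by rw [mul_comm]; simpa using huD)
    obtain ⟨w, hwB, hw⟩ := lemmaP (u := Units.map (algebraMap K L : K →* L) u) (by simpa using huL) (up L (S ∪ Q))
    rw [mem_up, Finset.mem_union, not_or] at hwB
    obtain ⟨hqS, hqQ⟩ := hwB
    have huq : u ∉ LS (dn K w) := fun h => hw (LS_up w h)
    have hV : U ≤ Vu (dn K w) := US_le_Vu hqS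
    have hDq : D ∈ LS (dn K w) := by
      by_contra hDq
      have h3 := LS_mul (h2 _ hqS) (hV hDS) (hV huK.1) hDq huq
      have h4 := LS_up w h3
      rw [map_mul] at h4
      have h5 : Units.map (algebraMap K L : K →* L) D ∈ LS w := by
        apply (le_sup_left : sqs Lˣ ≤ LS w)
        rw [mem_sqs]
        have h0 : QQ.ω ≠ 0 := by
          intro h
          have := QQ.sq
          rw [h, zero_pow two_ne_zero] at this
          have h' := (map_eq_zero_iff _ (algebraMap K L).injective).mp this.symm
          exact D.ne_zero h'
        exact ⟨Units.mk0 QQ.ω h0, Units.ext (by simp [QQ.sq])⟩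
      exact hw ((Subgroup.mul_mem_cancel_left _ h5).mp h4)
    refine ⟨insert (dn K w) Q, by rw [Finset.card_insert_of_notMem hqQ, hQn], ?_, ?_⟩
    · intro q hq
      rw [Finset.mem_insert] at hq
      rcases hq with rfl | hq
      · exact ⟨hqS, hDq⟩
      · exact hQ q hq
    · intro x hxV
      obtain ⟨t, ht, hxt⟩ := hx x (fun q hq => hxV q (Finset.mem_insert_of_mem hq))
      by_cases hc : x * t ∈ LS (dn K w)
      · refine ⟨t, ht, fun q hq => ?_⟩
        rw [Finset.mem_insert] at hq
        rcases hq with rfl | hq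
        · exact hc
        · exact hxt q hq
      · refine ⟨t * u, mul_mem ht huK.1, fun q hq => ?_⟩
        rw [Finset.mem_insert] at hq
        rw [← mul_assoc]
        rcases hq with rfl | hq
        · exact LS_mul (h2 _ hqS) (mul_mem (hxV _ (Finset.mem_insert_self _ _)) (hV ht)) (hV huK.1) hc huq
        · refine mul_mem (hxt q hq) ?_
          have := (Subgroup.mem_inf.mp huK).2
          simp only [Subgroup.mem_iInf] at this
          exact this q hq
end
end DTO
end

section
namespace DTO
open IsDedekindDomain HeightOneSpectrum NumberField WithZero

section
universe u
variable {K : Type u} [Field K] [NumberField K]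

open Classical in
theorem surjQ {S Q : Finset (Pl K)} (hCT : CT (S : Set (Pl K))) (hQS : ∀ q ∈ Q, q ∉ S)
    (hQ : ∀ x : Kˣ, (∀ q ∈ Q, x ∈ Vu q) → ∃ u ∈ US K S, ∀ q ∈ Q, x * u ∈ LS q) (x : Kˣ) :
    ∃ y ∈ US K (S ∪ Q), ∀ q ∈ Q, x * y ∈ LS q := by
  obtain ⟨c, hc⟩ := hCT.exists_fun Q (fun v => -(log (v.valuation K (x : K))))
  obtain ⟨u, hu, hxu⟩ := hQ (x * c) (fun q hq => by
    rw [mem_Vu, Units.val_mul, map_mul, hc q (by simpa using hQS q hq), if_pos hq, exp_neg,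
      exp_log (by simp), mul_inv_cancel₀ (by simp)])
  refine ⟨c * u, mul_mem ?_ ?_, fun q hq => by rw [← mul_assoc]; exact hxu q hq⟩
  · rw [US_mem]
    intro v hv
    rw [Finset.mem_union, not_or] at hv
    rw [hc v (by simpa using hv.1), if_neg hv.2]
  · rw [US_mem] at hu ⊢
    intro v hv
    rw [Finset.mem_union, not_or] at hv
    exact hu v hv.1

theorem Nrm_le_iInf (b : K) (T : Finset (Pl K)) : Nrm b ≤ ⨅ v ∈ T, LN b v := by
  refine le_iInf₂ fun v _ => ?_
  exact le_sup_left

open Classical in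
theorem stepK [IsTotallyComplex K] {S Q : Finset (Pl K)} (hCT : CT (S : Set (Pl K))) 
    (h2 : ∀ v ∉ S, v.valuation K (2:K) = 1) (hQS : ∀ q ∈ Q, q ∉ S)
    (hQ : ∀ x : Kˣ, (∀ q ∈ Q, x ∈ Vu q) → ∃ u ∈ US K S, ∀ q ∈ Q, x * u ∈ LS q) 
    (b : Kˣ) (hb : b ∈ US K (S ∪ Q)) (hbS : ∀ v ∈ S, b ∈ LS v) : IsSquare (b : K) := by
  by_contra hns
  have hCT' : CT ((S ∪ Q : Finset (Pl K)) : Set (Pl K)) := hCT.mono (by simp)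
  obtain ⟨h0, hle⟩ := lemmaH hns (S ∪ Q) hCT' (fun v hv => h2 v (fun h => hv (Finset.mem_union_left _ h)))
    (US_mem.mp hb)
  have hT : ∀ v ∈ (S ∪ Q).filter (fun v => ¬ Split v (b : K)), v ∉ S ∧ v ∈ Q ∧ ¬ Split v (b:K) := by
    intro v hv
    rw [Finset.mem_filter, Finset.mem_union] at hv
    have : v ∉ S := fun h => hv.2 (Split_of_LS (hbS v h))
    exact ⟨this, hv.1.resolve_left this, hv.2⟩
  generalize (S ∪ Q).filter (fun v => ¬ Split v (b : K)) = T at hT hle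
  have hsup : US K (S ∪ Q) ⊔ ⨅ v ∈ T, LN (b:K) v = ⊤ := by
    rw [eq_top_iff]
    intro x _
    obtain ⟨y, hy, hxy⟩ := surjQ hCT hQS hQ x
    have e : x = y⁻¹ * (x * y) := by rw [mul_comm x y, inv_mul_cancel_left]
    rw [e]
    apply Subgroup.mul_mem_sup (inv_mem hy)
    simp only [Subgroup.mem_iInf]
    intro v hv
    exact LS_le_LN _ _ (hxy v (hT v hv).2.1)
  have hidx : (⨅ v ∈ T, LN (b:K) v).index = (⨅ v ∈ T, LN (b:K) v).relIndex (US K (S ∪ Q)) := by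
    rw [← Subgroup.relIndex_top_right, ← hsup, Subgroup.relIndex_sup_right]
  have hle2 := Subgroup.relIndex_le_of_le_left (Nrm_le_iInf (b:K) T) h0
  have hne : (⨅ v ∈ T, LN (b:K) v).index ≠ 0 := by
    rw [hidx]
    exact fun h => h0 (Subgroup.relIndex_eq_zero_of_le_left (Nrm_le_iInf (b:K) T) h)
  have hge := index_LN (b:K) T (fun v hv h => (hT v hv).2.2 (split_of_LN_top (h2 v (hT v hv).1) h)) hne
  rw [hidx] at hge
  have : 0 < 2 ^ T.card := by positivity
  omega

open Classical in
theorem HN [IsTotallyComplex K] (h : ∀ v : Pl K, v.valuation K (2:K) < 1 → NR v → 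
    ∃ z : K, v.valuation K (2:K) = v.valuation K z ^ 2) (h3 : ¬ IsSquare (-3 : K)) : ∃ α β : K, α ^ 2 + 3 * β ^ 2 = -2 := by
  obtain ⟨S, hS0, hCT⟩ := exists_CT ((finite_supp (K := K) (x := 2) two_ne_zero).toFinset ∪ (finite_supp (K := K) (x := 3) three_ne_zero).toFinset)
  have h2S : ∀ v ∉ S, v.valuation K (2:K) = 1 := by
    intro v hv
    by_contra hne
    exact hv (hS0 (by simp [hne]))
  have h3S : ∀ v ∉ S, v.valuation K (3:K) = 1 := by
    intro v hv
    by_contra hne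
    exact hv (hS0 (by simp [hne]))
  obtain ⟨Q, hQn, hQS, hQ⟩ := stepQ (Units.mk0 (-3 : K) (by norm_num)) (by simpa using h3) S h2S (by
    rw [US_mem]; intro v hv; rw [Units.val_mk0, Valuation.map_neg]; exact h3S v hv) (S.card + Units.rank K) (by omega)
  have hK := stepK hCT h2S (fun q hq => (hQS q hq).1) hQ
  have hdisj : Disjoint S Q := Finset.disjoint_right.mpr (fun q hq => (hQS q hq).1)
  have hcard : (S ∪ Q).card = S.card + Q.card := Finset.card_union_of_disjoint hdisj
  have hCT' : CT ((S ∪ Q : Finset (Pl K)) : Set (Pl K)) := hCT.mono (by simp)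
  have hind := US_index (S ∪ Q)
  have h2U : ∀ v ∉ S ∪ Q, v.valuation K (2:K) = 1 := fun v hv => h2S v (fun h => hv (Finset.mem_union_left _ h))
  obtain ⟨h0, hle⟩ := lemmaH h3 (S ∪ Q) hCT' h2U 
    (fun v hv => by rw [Valuation.map_neg]; exact h3S v (fun h => hv (Finset.mem_union_left _ h)))
  have hT : ∀ v ∈ (S ∪ Q).filter (fun v => ¬ Split v (-3 : K)), v ∈ S ∧ ¬ Split v (-3:K) := by
    intro v hv
    rw [Finset.mem_filter, Finset.mem_union] at hv
    exact ⟨hv.1.resolve_right (fun h => hv.2 (by simpa using Split_of_LS (hQS v h).2)), hv.2⟩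
  generalize (S ∪ Q).filter (fun v => ¬ Split v (-3 : K)) = T at hT hle
  have hm2U : Units.mk0 (-2 : K) (by norm_num) ∈ US K (S ∪ Q) := by
    rw [US_mem]; intro v hv; rw [Units.val_mk0, Valuation.map_neg]; exact h2U v hv
  generalize hUeq : US K (S ∪ Q) = U at *
  obtain ⟨hL0, hLle⟩ := LS_index_all (K := K) S
  set LSS := ⨅ v ∈ S, LS v with hLSS
  set loc := ⨅ v ∈ T, LN (-3 : K) v with hloc
  have hLl : LSS ≤ loc := by
    refine le_iInf₂ fun v hv => ?_
    exact (iInf₂_le v (hT v hv).1).trans (LS_le_LN _ _)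
  have hrel0 : LSS.relIndex U ≠ 0 := fun h => hL0 (by
    have := Subgroup.relIndex_dvd_index_of_normal LSS U
    rw [h] at this
    exact zero_dvd_iff.mp this)
  have hrel : 2 ^ ((S ∪ Q).card + (Units.rank K + 1)) ≤ LSS.relIndex U := by
    rw [← hind, ← Subgroup.inf_relIndex_right LSS]
    apply Subgroup.relIndex_le_of_le_left
    · intro x hx
      obtain ⟨hx1, hx2⟩ := Subgroup.mem_inf.mp hx
      obtain ⟨y, hy⟩ := hK x hx2 (fun v hv => by
        rw [hLSS] at hx1
        simp only [Subgroup.mem_iInf] at hx1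
        exact hx1 v hv)
      have hy0 : y ≠ 0 := by rintro rfl; simp at hy
      have e : x = (Units.mk0 y hy0) ^ 2 := Units.ext (by simp [hy, pow_two])
      refine ⟨Units.mk0 y hy0, ?_, e.symm⟩
      rw [← hUeq] at hx2 ⊢
      exact US_sqrt (by rw [← e]; exact hx2)
    · rwa [Subgroup.inf_relIndex_right]
  have hsup : (U ⊔ LSS).index ≤ 2 ∧ (U ⊔ LSS).index ≠ 0 := by
    have h1 := Subgroup.relIndex_mul_index (le_sup_right : LSS ≤ U ⊔ LSS)
    rw [Subgroup.relIndex_sup_right] at h1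
    refine ⟨?_, ?_⟩
    · have e : 2 ^ (2 * (S.card + (Units.rank K + 1))) = 2 ^ ((S ∪ Q).card + (Units.rank K + 1)) * 2 := by
        rw [← pow_succ]; congr 1; omega
      rw [← h1, e] at hLle
      have h2 := (Nat.mul_le_mul_right _ hrel).trans hLle
      exact Nat.le_of_mul_le_mul_left h2 (by positivity)
    · intro h
      rw [h, mul_zero] at h1
      exact hL0 h1.symm
  have hsup2 : (U ⊔ loc).index ≤ 2 := by
    have := Subgroup.index_dvd_of_le (sup_le_sup_left hLl U)
    exact (Nat.le_of_dvd (Nat.pos_of_ne_zero hsup.2) this).trans hsup.1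
  have hloc0 : loc.index ≠ 0 := fun h => hL0 (by
    have := Subgroup.index_dvd_of_le hLl
    rw [h] at this
    exact zero_dvd_iff.mp this)
  have hval2 : ∀ v : Pl K, v.valuation K (2:K) ≤ 1 := by
    intro v
    have := vl_int v 2
    simpa only [RingOfIntegers.coe_eq_algebraMap, map_ofNat] using this
  have hval3 : ∀ v : Pl K, v.valuation K (3:K) ≤ 1 := by
    intro v
    have := vl_int v 3
    simpa only [RingOfIntegers.coe_eq_algebraMap, map_ofNat] using this
  have hge := index_LN (-3 : K) T (fun v hv ht => by
    rcases (hval2 v).lt_or_eq with h2 | h2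
    · exact LN_ne_top_two (NR_of_not_split h2 (hT v hv).2) ht
    · exact (hT v hv).2 (split_of_LN_top h2 ht)) hloc0
  change 2 ^ T.card ≤ loc.index at hge
  have hl1 := Subgroup.relIndex_mul_index (le_sup_right : loc ≤ U ⊔ loc)
  rw [Subgroup.relIndex_sup_right] at hl1
  have hNl : Nrm (-3 : K) ≤ loc := Nrm_le_iInf _ _
  have hcmp : (Nrm (-3:K)).relIndex U ≤ loc.relIndex U := by
    have h1 : loc.index ≤ loc.relIndex U * 2 := by rw [← hl1]; exact Nat.mul_le_mul_left _ hsup2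
    omega
  have htower := Subgroup.relIndex_mul_relIndex (Nrm (-3:K) ⊓ U) (loc ⊓ U) U (inf_le_inf_right _ hNl) inf_le_right
  rw [Subgroup.inf_relIndex_right, Subgroup.inf_relIndex_right] at htower
  have hone : (Nrm (-3:K) ⊓ U).relIndex (loc ⊓ U) = 1 := by
    have hpos : 0 < loc.relIndex U := Nat.pos_of_ne_zero (fun h => by rw [h, mul_zero] at htower; exact h0 htower.symm)
    have hne : (Nrm (-3:K) ⊓ U).relIndex (loc ⊓ U) ≠ 0 := fun h => by rw [h, zero_mul] at htower; exact h0 htower.symm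
    have : (Nrm (-3:K) ⊓ U).relIndex (loc ⊓ U) * loc.relIndex U ≤ 1 * loc.relIndex U := by rw [htower, one_mul]; exact hcmp
    have := Nat.le_of_mul_le_mul_right this hpos
    omega
  have hfin := Subgroup.relIndex_eq_one.mp hone
  have hm2 : Units.mk0 (-2 : K) (by norm_num) ∈ loc := by
    rw [hloc]
    simp only [Subgroup.mem_iInf]
    intro v hv
    rcases (hval2 v).lt_or_eq with h2 | h2
    · obtain ⟨z, hz⟩ := h v h2 (NR_of_not_split h2 (hT v hv).2)
      have hz0 : z ≠ 0 := by
        rintro rfl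
        rw [map_zero, zero_pow two_ne_zero, map_eq_zero] at hz
        exact two_ne_zero hz
      exact LN_of_sq_val _ h2 _ (Units.mk0 z hz0) (by simpa [Valuation.map_neg] using hz)
    · rcases (hval3 v).lt_or_eq with h3 | h3
      · exact LN_three _ (by simp) _ h3
      · exact LN_odd _ (by simp) h2 h3
  have := (Subgroup.mem_inf.mp (hfin (Subgroup.mem_inf.mpr ⟨hm2, hm2U⟩))).1
  rw [mem_Nrm] at this
  obtain ⟨α, β, hab⟩ := this
  exact ⟨α, β, by rw [Units.val_mk0] at hab; rw [hab]; ring⟩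

theorem HN4 [IsTotallyComplex K] (h : ∀ v : Pl K, v.valuation K (2:K) < 1 → NR v → 
    ∃ z : K, v.valuation K (2:K) = v.valuation K z ^ 2) : 
    ∃ a b c d : K, ¬ (a = 0 ∧ b = 0 ∧ c = 0 ∧ d = 0) ∧ a ^ 2 + b ^ 2 + c ^ 2 + d ^ 2 = 0 := by
  by_cases h3 : IsSquare (-3 : K)
  · obtain ⟨y, hy⟩ := h3
    refine ⟨y, 1, 1, 1, by simp, ?_⟩
    rw [pow_two y, ← hy]; norm_num
  · obtain ⟨α, β, hab⟩ := HN h h3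
    refine ⟨α, β + 1, β - 1, β, ?_, by linear_combination hab⟩
    rintro ⟨-, h1, h2, h3⟩
    rw [h3] at h1
    simp at h1
end
end DTO
end

section
namespace DTO
open IsDedekindDomain HeightOneSpectrum NumberField WithZero

section
variable {K : Type*} [Field K] [NumberField K]

theorem val_intCast (v : Pl K) (n : ℤ) : v.valuation K (n : K) ≤ 1 := by
  have := vl_int v (n : 𝓞 K)
  simpa using this

theorem val_odd (v : Pl K) (h2 : v.valuation K (2:K) < 1) {n : ℤ} (hn : Odd n) : v.valuation K (n : K) = 1 := by
  obtain ⟨j, rfl⟩ := hn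
  apply v_one_of
  push_cast
  rw [add_sub_cancel_right, map_mul]
  exact mul_lt_one_of_lt_of_le h2 (val_intCast v j)

theorem val_poly (v : Pl K) (f : Polynomial ℤ) {θ : K} (hθ : 1 < v.valuation K θ) :
    v.valuation K (Polynomial.aeval θ f) ≤ v.valuation K θ ^ f.natDegree := by
  rw [Polynomial.aeval_eq_sum_range]
  apply Valuation.map_sum_le
  intro i hi
  rw [zsmul_eq_mul, map_mul, map_pow]
  calc _ ≤ 1 * v.valuation K θ ^ i := mul_le_mul_left (val_intCast v _) _
    _ ≤ _ := by
      rw [one_mul]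
      exact pow_le_pow_right₀ hθ.le (by rw [Finset.mem_range] at hi; omega)

theorem val_poly_int (v : Pl K) (f : Polynomial ℤ) {θ : K} (hθ : v.valuation K θ ≤ 1) :
    v.valuation K (Polynomial.aeval θ f) ≤ 1 := by
  rw [Polynomial.aeval_eq_sum_range]
  apply Valuation.map_sum_le
  intro i hi
  rw [zsmul_eq_mul, map_mul, map_pow]
  exact mul_le_one' (val_intCast v _) (pow_le_one' hθ i)

theorem val_poly_sub (v : Pl K) (f : Polynomial ℤ) {θ : K} (hθ : v.valuation K θ ≤ 1) :
    v.valuation K (Polynomial.aeval θ f - (f.coeff 0 : K)) ≤ v.valuation K θ := by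
  have h : Polynomial.aeval θ f - (f.coeff 0 : K) = θ * Polynomial.aeval θ f.divX := by
    conv_lhs => rw [← Polynomial.divX_mul_X_add f]
    simp [mul_comm]
  rw [h, map_mul]
  calc _ ≤ v.valuation K θ * 1 := mul_le_mul_right (val_poly_int v _ hθ) _
    _ = _ := mul_one _

theorem val_quad (v : Pl K) {z : K} (hz : 1 < v.valuation K z) : v.valuation K (z ^ 2 + z + 1) = v.valuation K z ^ 2 := by
  rw [← map_pow]
  apply Valuation.map_eq_of_sub_lt
  have : z ^ 2 + z + 1 - z ^ 2 = z + 1 := by ring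
  rw [this]
  have h1 : v.valuation K z < v.valuation K (z ^ 2) := by
    rw [map_pow]
    exact lt_self_pow₀ hz (by norm_num)
  apply Valuation.map_add_lt _ h1
  rw [map_one]; exact hz.trans h1

theorem two_adic (v : Pl K) (h2 : v.valuation K (2:K) < 1) (hNR : NR v) (f : Polynomial ℤ) (k ℓ m : ℕ) (w : ℤ)
    (hdeg : f.natDegree = 2 * (2 * k + 1)) (hw : Odd w) (hf0 : f.coeff 0 = 2 ^ m * w) (hml : m + 3 ≤ ℓ)
    (hw1 : Even m → ¬ (8 ∣ w - 1)) (θ : K)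
    (hθ : 2 ^ (2 * ℓ) * Polynomial.aeval θ f = (θ ^ 2 + θ + 1) ^ (2 * k) * θ ^ 2) :
    ∃ z : K, v.valuation K (2:K) = v.valuation K z ^ 2 := by
  have h20 : v.valuation K (2:K) ≠ 0 := by rw [Ne, map_eq_zero]; exact two_ne_zero
  have hpos2 : 0 < v.valuation K (2:K) := zero_lt_iff.mpr h20
  have hint : v.valuation K θ ≤ 1 := by
    by_contra! hgt
    have h1 := congrArg (v.valuation K) hθ
    simp only [map_mul, map_pow, val_quad v hgt] at h1
    have h3 := val_poly v f hgt
    rw [hdeg] at h3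
    have h4 : v.valuation K (2:K) ^ (2 * ℓ) < 1 := pow_lt_one₀ zero_le h2 (by omega)
    have h5 : (v.valuation K θ ^ 2) ^ (2 * k) * v.valuation K θ ^ 2 = v.valuation K θ ^ (2 * (2 * k + 1)) := by
      rw [← pow_mul, ← pow_add]; congr 1
    rw [h5] at h1
    have h6 : 0 < v.valuation K θ ^ (2 * (2 * k + 1)) := pow_pos (zero_lt_one.trans hgt) _
    have h7 : v.valuation K 2 ^ (2 * ℓ) * v.valuation K (Polynomial.aeval θ f) < v.valuation K θ ^ (2 * (2 * k + 1)) := by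
      calc _ ≤ v.valuation K 2 ^ (2 * ℓ) * v.valuation K θ ^ (2 * (2 * k + 1)) := mul_le_mul_right h3 _
        _ < 1 * v.valuation K θ ^ (2 * (2 * k + 1)) := mul_lt_mul_of_pos_right h4 h6
        _ = _ := one_mul _
    exact h7.ne h1
  have hq := hNR θ hint
  have hsmall : v.valuation K θ ≤ v.valuation K (2:K) ^ ℓ := by
    have h1 := congrArg (v.valuation K) hθ
    simp only [map_mul, map_pow, hq, one_pow, one_mul] at h1
    have h3 : v.valuation K θ ^ 2 ≤ (v.valuation K (2:K) ^ ℓ) ^ 2 := by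
      rw [← h1, ← pow_mul, mul_comm ℓ 2]
      calc _ ≤ v.valuation K (2:K) ^ (2 * ℓ) * 1 := mul_le_mul_right (val_poly_int v f hint) _
        _ = _ := mul_one _
    exact (pow_le_pow_iff_left₀ zero_le zero_le two_ne_zero).mp h3
  have hs2 : v.valuation K (Polynomial.aeval θ f - (f.coeff 0 : K)) ≤ v.valuation K (2:K) ^ (m + 3) :=
    (val_poly_sub v f hint).trans (hsmall.trans (pow_le_pow_of_le_one zero_le h2.le hml))
  obtain ⟨y0, hy0⟩ : ∃ y0 : K, y0 ^ 2 = Polynomial.aeval θ f := by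
    refine ⟨θ * (θ ^ 2 + θ + 1) ^ k / 2 ^ ℓ, ?_⟩
    rw [div_pow, div_eq_iff (pow_ne_zero _ (pow_ne_zero _ two_ne_zero))]
    rw [← pow_mul, mul_comm ℓ 2, mul_comm _ (2 ^ (2 * ℓ)), hθ]
    ring
  rw [← hy0, hf0] at hs2
  push_cast at hs2
  have hvw := val_odd v h2 hw
  have h8 : v.valuation K (2:K) ^ 3 < v.valuation K (2:K) := by
    calc _ < v.valuation K (2:K) ^ 1 := pow_lt_pow_right_of_lt_one₀ hpos2 h2 (by norm_num)
      _ = _ := pow_one _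
  rcases Nat.even_or_odd' m with ⟨j, rfl | rfl⟩
  · have hj : (2:K) ^ j ≠ 0 := pow_ne_zero _ two_ne_zero
    obtain ⟨y, rfl⟩ : ∃ y, y0 = 2 ^ j * y := ⟨y0 / 2 ^ j, by field_simp⟩
    have e : (2 ^ j * y) ^ 2 - 2 ^ (2 * j) * (w : K) = 2 ^ (2 * j) * (y ^ 2 - w) := by ring
    rw [e, map_mul, pow_add, map_pow, mul_le_mul_iff_right₀ (pow_pos hpos2 _)] at hs2
    have hyw : v.valuation K (y ^ 2) = 1 := by
      rw [← hvw]
      apply Valuation.map_eq_of_sub_lt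
      rw [hvw]
      exact hs2.trans_lt (h8.trans h2)
    have hy1 : v.valuation K y = 1 := by
      rw [map_pow, pow_eq_one_iff, or_iff_left two_ne_zero] at hyw; exact hyw
    have hw1' := hw1 (by simp)
    have hcases : (∃ i : ℤ, w + 3 = 8 * i) ∨ ∃ i : ℤ, w + 1 = 4 * i := by
      obtain ⟨t, rfl⟩ := hw
      have : (2 * t + 1) % 8 = 5 ∨ (2 * t + 1) % 4 = 3 := by omega
      rcases this with h | h
      · exact Or.inl ⟨(2 * t + 4) / 8, by omega⟩
      · exact Or.inr ⟨(2 * t + 2) / 4, by omega⟩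
    rcases hcases with ⟨i, hi⟩ | ⟨i, hi⟩
    · exfalso
      have hiK : (w : K) + 3 = 8 * i := by exact_mod_cast congrArg (Int.cast : ℤ → K) hi
      have hz : v.valuation K (((y - 1) / 2) ^ 2 + (y - 1) / 2 + 1) < 1 := by
        have e : ((y - 1) / 2) ^ 2 + (y - 1) / 2 + 1 = ((y ^ 2 - w) + 2 ^ 3 * i) / 2 ^ 2 := by
          have : (2:K) ^ 3 * i = w + 3 := by rw [hiK]; norm_num
          rw [this]; field_simp; ring
        rw [e, map_div₀, map_pow, div_lt_one₀ (pow_pos hpos2 _)]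
        refine lt_of_le_of_lt (?_ : _ ≤ v.valuation K (2:K) ^ 3) (pow_lt_pow_right_of_lt_one₀ hpos2 h2 (by norm_num))
        apply Valuation.map_add_le _ hs2
        rw [map_mul, map_pow]
        calc _ ≤ v.valuation K (2:K) ^ 3 * 1 := mul_le_mul_right (val_intCast v i) _
          _ = _ := mul_one _
      have hzi : v.valuation K ((y - 1) / 2) ≤ 1 := by
        by_contra! hgt
        rw [val_quad v hgt] at hz
        exact absurd hz (not_lt.mpr (one_le_pow₀ hgt.le))
      exact hz.ne (hNR _ hzi)
    · refine ⟨y + 1, ?_⟩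
      have hiK : (w : K) + 1 = 4 * i := by exact_mod_cast congrArg (Int.cast : ℤ → K) hi
      rw [← map_pow]
      have h2y : v.valuation K (2 * y) = v.valuation K 2 := by rw [map_mul, hy1, mul_one]
      rw [← h2y]
      symm
      apply Valuation.map_eq_of_sub_lt
      have e : (y + 1) ^ 2 - 2 * y = (y ^ 2 - w) + 2 ^ 2 * i := by
        have : (2:K) ^ 2 * i = w + 1 := by rw [hiK]; norm_num
        rw [this]; ring
      rw [e, h2y]
      apply Valuation.map_add_lt _ (hs2.trans_lt h8)
      rw [map_mul, map_pow]
      calc _ ≤ v.valuation K (2:K) ^ 2 * 1 := mul_le_mul_right (val_intCast v i) _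
        _ < v.valuation K (2:K) ^ 1 := by
          rw [mul_one]; exact pow_lt_pow_right_of_lt_one₀ hpos2 h2 (by norm_num)
        _ = _ := pow_one _
  · have hv0 : v.valuation K (y0 ^ 2) = v.valuation K (2:K) ^ (2 * j + 1) := by
      have hvc : v.valuation K (2 ^ (2 * j + 1) * (w:K)) = v.valuation K (2:K) ^ (2 * j + 1) := by
        rw [map_mul, map_pow, hvw, mul_one]
      rw [← hvc]
      apply Valuation.map_eq_of_sub_lt
      rw [hvc]
      exact hs2.trans_lt (pow_lt_pow_right_of_lt_one₀ hpos2 h2 (by omega))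
    refine ⟨y0 / 2 ^ j, ?_⟩
    rw [← map_pow, div_pow, map_div₀, hv0, eq_div_iff (by simp), ← pow_mul, map_pow, mul_comm j 2, pow_succ, mul_comm]
end

section
open Polynomial

theorem aeval_root (p : ℚ[X]) [Fact (Irreducible p)] [inst : Algebra ℚ (AdjoinRoot p)] (q : ℚ[X]) :
    aeval (AdjoinRoot.root p) q = AdjoinRoot.mk p q := by
  rw [aeval_def, Subsingleton.elim (algebraMap ℚ (AdjoinRoot p)) (AdjoinRoot.of p)]
  exact AdjoinRoot.aeval_eq q

theorem totallyComplex_adjoinRoot (p : ℚ[X]) [Fact (Irreducible p)] (h : ∀ t : ℝ, aeval t p ≠ 0) :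
    IsTotallyComplex (AdjoinRoot p) := by
  constructor
  intro v
  rw [← InfinitePlace.not_isReal_iff_isComplex]
  intro hv
  let φ : AdjoinRoot p →+* ℝ := InfinitePlace.embedding_of_isReal hv
  apply h (φ (AdjoinRoot.root p))
  have h1 : aeval (AdjoinRoot.root p) p = 0 := by
    rw [aeval_root, AdjoinRoot.mk_self]
  have := congrArg φ.toRatAlgHom h1
  rw [← aeval_algHom_apply, map_zero] at this
  exact this

theorem main (f : ℤ[X]) (k : ℕ) (hdeg : f.natDegree = 2 * (2 * k + 1))
    (hpos : ∀ t : ℝ, 0 < aeval t f)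
    (hc : ¬ ∃ a b : ℕ, f.coeff 0 = 2 ^ (2 * a) * (8 * b + 1)) :
    ∃ ℓ₀ : ℕ, ∀ ℓ : ℕ, ℓ₀ ≤ ℓ → S4 (gpoly f k ℓ) := by
  obtain ⟨ℓ₁, hℓ₁⟩ := gpoly_pos f k hdeg hpos
  have hc0 : 0 < f.coeff 0 := by
    have := hpos 0
    rw [← coeff_zero_eq_aeval_zero'] at this
    simpa using this
  obtain ⟨m, w, hw, hmw⟩ := Nat.exists_eq_two_pow_mul_odd (n := (f.coeff 0).toNat) (by omega)
  have hf0 : f.coeff 0 = 2 ^ m * (w : ℤ) := by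
    have : (f.coeff 0) = ((f.coeff 0).toNat : ℤ) := by omega
    rw [this, hmw]; push_cast; rfl
  have hw1 : Even m → ¬ ((8:ℤ) ∣ (w:ℤ) - 1) := by
    rintro ⟨a, rfl⟩ h8
    apply hc
    refine ⟨a, w / 8, ?_⟩
    rw [hf0, ← two_mul]
    congr 1
    omega
  refine ⟨max ℓ₁ (m + 3), fun ℓ hℓ => ?_⟩
  have hgpos := hℓ₁ ℓ (le_trans (le_max_left _ _) hℓ)
  have hml : m + 3 ≤ ℓ := le_trans (le_max_right _ _) hℓ
  have hg0 : gpoly f k ℓ ≠ 0 := by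
    intro h
    have := hgpos 0
    rw [h, map_zero] at this
    exact lt_irrefl _ this
  apply S4_of_factors _ hg0 hgpos
  intro p hp hpg
  have := Fact.mk hp
  have hnr : ∀ t : ℝ, aeval t p ≠ 0 := by
    intro t ht
    obtain ⟨q, hq⟩ := hpg
    have := hgpos t
    rw [hq, map_mul, ht, zero_mul] at this
    exact lt_irrefl _ this
  have := totallyComplex_adjoinRoot p hnr
  have hroot : aeval (AdjoinRoot.root p) (gpoly f k ℓ) = 0 := by
    rw [aeval_root, AdjoinRoot.mk_eq_zero]; exact hpg
  have hθ : 2 ^ (2 * ℓ) * aeval (AdjoinRoot.root p) f = 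
      (AdjoinRoot.root p ^ 2 + AdjoinRoot.root p + 1) ^ (2 * k) * AdjoinRoot.root p ^ 2 := by
    unfold gpoly at hroot
    simp only [map_sub, map_mul, map_pow, map_add, aeval_X, map_one, aeval_C] at hroot
    have e : aeval (AdjoinRoot.root p) (f.map (Int.castRingHom ℚ)) = aeval (AdjoinRoot.root p) f := by
      rw [← algebraMap_int_eq, aeval_map_algebraMap]
    rw [e, sub_eq_zero] at hroot
    rw [hroot, ← mul_assoc]
    have : (2:AdjoinRoot p) ^ (2 * ℓ) * algebraMap ℚ (AdjoinRoot p) (1 / 2 ^ (2 * ℓ)) = 1 := by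
      rw [map_div₀, map_one, map_pow, map_ofNat]
      field_simp
    rw [this, one_mul]
  obtain ⟨a, b, c, d, hne, hsum⟩ := HN4 (K := AdjoinRoot p) (fun v h2 hNR => 
    two_adic v h2 hNR f k ℓ m w hdeg (by exact_mod_cast hw) hf0 hml hw1 _ hθ)
  obtain ⟨a, rfl⟩ := AdjoinRoot.mk_surjective a
  obtain ⟨b, rfl⟩ := AdjoinRoot.mk_surjective b
  obtain ⟨c, rfl⟩ := AdjoinRoot.mk_surjective c
  obtain ⟨d, rfl⟩ := AdjoinRoot.mk_surjective d
  simp only [AdjoinRoot.mk_eq_zero] at hne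
  refine ⟨a, b, c, d, hne, ?_⟩
  rw [← AdjoinRoot.mk_eq_zero]
  simpa using hsum
end
end DTO
end

open Polynomial

theorem deg_twice_odd_minus_power_sum_of_four_squares
    (f : Polynomial ℤ) (k : ℕ) (hdeg : f.natDegree = 2 * (2 * k + 1))
    (hsf : ∀ p : Polynomial ℤ, 0 < p.natDegree → ¬ p ^ 2 ∣ f)
    (hpos : ∀ t : ℝ, 0 < Polynomial.aeval t f)
    (hc : ¬ ∃ a b : ℕ, f.coeff 0 = 2 ^ (2 * a) * (8 * b + 1)) :
    ∃ ℓ₀ : ℕ, ∀ ℓ : ℕ, ℓ₀ ≤ ℓ →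
      ∃ p₁ p₂ p₃ p₄ : Polynomial ℚ,
        f.map (Int.castRingHom ℚ) -
            C ((1 : ℚ) / 2 ^ (2 * ℓ)) * ((X ^ 2 + X + 1) ^ (2 * k) * X ^ 2) =
          p₁ ^ 2 + p₂ ^ 2 + p₃ ^ 2 + p₄ ^ 2 := by
  exact DTO.main f k hdeg hpos hc
end

section
/- Let a, b, k be nonnegative integers and let f ∈ ℤ[x] be a polynomial of degree d = 2(2k + 1) whose constant coefficient satisfies f(0) = 2^{2a}·(8b + 1). Then for every integer ℓ ≥ a + 3, the polynomial q(x) = 2^{2ℓ}·f(x) − (x² + x + 1)^{2k}·x², viewed in ℤ₂[x], has a root γ̄ ∈ ℤ₂ satisfying γ̄ ≡ 2^{ℓ+a} (mod 2^{ℓ+a+2}·ℤ₂). -/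
open Polynomial

theorem hensel_aux (H : Polynomial ℤ_[2]) :
    ∃ z : ℤ_[2], 1 - z ^ 2 + 8 * H.eval z = 0 ∧ (4 : ℤ_[2]) ∣ z - 1 := by
  have h2 : ‖(2 : ℤ_[2])‖ = 1 / 2 := by
    have := PadicInt.norm_p (p := 2)
    norm_num at this ⊢
    exact this
  have e1 : (1 - X ^ 2 + C 8 * H : Polynomial ℤ_[2]).aeval (1 : ℤ_[2]) = 2 ^ 3 * H.eval 1 := by
    simp only [coe_aeval_eq_eval]
    simp
    norm_num
  have e2 : (derivative (1 - X ^ 2 + C 8 * H : Polynomial ℤ_[2])).aeval (1 : ℤ_[2])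
      = 2 * (2 ^ 2 * (derivative H).eval 1 - 1) := by
    simp only [coe_aeval_eq_eval]
    simp
    ring
  have hn1 : ‖(2 : ℤ_[2]) ^ 3 * H.eval 1‖ ≤ 1 / 8 := by
    rw [norm_mul, norm_pow, h2]
    have := PadicInt.norm_le_one (H.eval 1)
    norm_num
    linarith
  have hu : ‖(2 : ℤ_[2]) ^ 2 * (derivative H).eval 1 - 1‖ = 1 := by
    have hlt : ‖(2 : ℤ_[2]) ^ 2 * (derivative H).eval 1‖ < 1 := by
      rw [norm_mul, norm_pow, h2]
      have := PadicInt.norm_le_one ((derivative H).eval 1)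
      norm_num
      linarith
    rw [← norm_neg, neg_sub]
    apply PadicInt.isUnit_iff.1
    apply IsLocalRing.isUnit_one_sub_self_of_mem_nonunits
    exact PadicInt.mem_nonunits.2 hlt
  have hd : ‖(derivative (1 - X ^ 2 + C 8 * H : Polynomial ℤ_[2])).aeval (1 : ℤ_[2])‖ = 1 / 2 := by
    rw [e2, norm_mul, hu, h2, mul_one]
  obtain ⟨z, hz, hz1, -⟩ := hensels_lemma (p := 2) (F := (1 - X ^ 2 + C 8 * H : Polynomial ℤ_[2]))
    (a := (1 : ℤ_[2])) (by rw [hd, e1]; norm_num at hn1 ⊢; linarith)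
  refine ⟨z, ?_, ?_⟩
  · simpa [coe_aeval_eq_eval] using hz
  · rw [hd] at hz1
    have := (PadicInt.norm_le_pow_iff_norm_lt_pow_add_one (p := 2) (z - 1) (-2)).2
      (by norm_num; norm_num at hz1; exact hz1)
    have := (PadicInt.norm_le_pow_iff_mem_span_pow (p := 2) (z - 1) 2).1 (by exact_mod_cast this)
    rw [Ideal.mem_span_singleton] at this
    norm_num at this
    exact this

theorem exists_padic_root_near_power_of_two
    (a b k : ℕ) (f : Polynomial ℤ)
    (hdeg : f.natDegree = 2 * (2 * k + 1))
    (hc : f.coeff 0 = 2 ^ (2 * a) * (8 * b + 1))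
    (ℓ : ℕ) (hℓ : a + 3 ≤ ℓ)
    (q : Polynomial ℤ_[2])
    (hq : q = C ((2 : ℤ_[2]) ^ (2 * ℓ)) * f.map (Int.castRingHom ℤ_[2]) -
        (X ^ 2 + X + 1) ^ (2 * k) * X ^ 2) :
    ∃ γ : ℤ_[2], q.eval γ = 0 ∧
      (2 : ℤ_[2]) ^ (ℓ + a + 2) ∣ (γ - 2 ^ (ℓ + a)) := by
  obtain ⟨n, rfl⟩ := Nat.exists_eq_add_of_le hℓ
  set P : Polynomial ℤ_[2] := (X ^ 2 + X + 1) ^ (2 * k) with hP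
  set g : Polynomial ℤ_[2] := f.map (Int.castRingHom ℤ_[2]) with hg
  have hg0 : g.coeff 0 = 2 ^ (2 * a) * (8 * b + 1) := by
    rw [hg, coeff_map, hc]; simp
  have hP0 : P.coeff 0 = 1 := by
    rw [coeff_zero_eq_eval_zero, hP]; simp
  have key : ∀ (r : Polynomial ℤ_[2]) (x : ℤ_[2]),
      r.eval x = x * r.divX.eval x + r.coeff 0 := by
    intro r x
    conv_lhs => rw [← X_mul_divX_add r]
    rw [eval_add, eval_mul, eval_X, eval_C]
  let s : Polynomial ℤ_[2] := C (2 ^ (a + 3 + n + a)) * X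
  obtain ⟨z, hz, w, hw⟩ := hensel_aux (C (b : ℤ_[2]) + C (2 ^ n) * X * g.divX.comp s
    - C (2 ^ (2 * a + n)) * X ^ 3 * P.divX.comp s)
  refine ⟨2 ^ (a + 3 + n + a) * z, ?_, w, ?_⟩
  · rw [hq, eval_sub, eval_mul, eval_mul, key g, key P, hg0, hP0]
    simp only [eval_sub, eval_add, eval_mul, eval_C, eval_X, eval_pow, eval_comp, s] at hz ⊢
    generalize eval _ g.divX = G at *
    generalize eval _ P.divX = Q at *
    linear_combination (2 : ℤ_[2]) ^ (2 * (a + 3 + n) + 2 * a) * hz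
  · linear_combination (2 : ℤ_[2]) ^ (a + 3 + n + a) * hw
end
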